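/- Let d ≥ 3 be an integer. For a general pencil of plane curves of degree d over ℂ and a general point x ∈ ℙ², the number of lines L passing through x such that L is a bitangent line to some member of the pencil (i.e., L has contact order at least 2 with that member at each of two distinct points) is exactly 2d(d−2)(d−3). -/

import Mathlib

noncomputable section

/-- The restriction of the form `F` to the line through `[v]` and `[w]`,
parametrized by `t ↦ v + t • w`, as a polynomial in `t`. -/
def linePoly (F : MvPolynomial (Fin 3) ℂ) (v w : Fin 3 → ℂ) : Polynomial ℂ :=
  MvPolynomial.aeval (fun i => Polynomial.C (v i) + Polynomial.X * Polynomial.C (w i)) F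

/-- The line through the two (projectively distinct) points `[v]`, `[w]` has contact
order at least `m` with the curve `{F = 0}` at the point `[v]`. -/
def ContactLE (F : MvPolynomial (Fin 3) ℂ) (v w : Fin 3 → ℂ) (m : ℕ) : Prop :=
  (Polynomial.X : Polynomial ℂ) ^ m ∣ linePoly F v w

/-- The member of the pencil spanned by `F` and `G` corresponding to `c ∈ ℙ¹`. -/
def pencilMember (F G : MvPolynomial (Fin 3) ℂ) (c : Projectivization ℂ (Fin 2 → ℂ)) :
    MvPolynomial (Fin 3) ℂ :=
  c.rep 0 • F + c.rep 1 • G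

/-- The coefficient vector of a pair of forms. -/
def coeffs2 (F G : MvPolynomial (Fin 3) ℂ) : (Fin 3 →₀ ℕ) ⊕ (Fin 3 →₀ ℕ) → ℂ :=
  Sum.elim (fun m => MvPolynomial.coeff m F) (fun m => MvPolynomial.coeff m G)

/-- The set of lines (2-dimensional linear subspaces of `ℂ³`) through the point `[x]`
which are bitangent to some member of the pencil spanned by `F` and `G`, i.e. tangent
(contact order at least 2) to that member at each of two distinct points. -/
def bitangentLinesThrough (F G : MvPolynomial (Fin 3) ℂ) (x : Fin 3 → ℂ) :
    Set (Submodule ℂ (Fin 3 → ℂ)) :=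
  {W | x ∈ W ∧ Module.finrank ℂ ↥W = 2 ∧
    ∃ (c : Projectivization ℂ (Fin 2 → ℂ)) (v w : Fin 3 → ℂ),
      v ∈ W ∧ w ∈ W ∧ LinearIndependent ℂ ![v, w] ∧
      ContactLE (pencilMember F G c) v w 2 ∧ ContactLE (pencilMember F G c) w v 2}

section Part1
open Polynomial
noncomputable section

def PolyFn {σ : Type*} (u : (σ → ℂ) → ℂ) : Prop :=
  ∃ p : MvPolynomial σ ℂ, ∀ x, MvPolynomial.eval x p = u x

namespace PolyFn
variable {σ : Type*} {u v : (σ → ℂ) → ℂ}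

lemma const (c : ℂ) : PolyFn (fun _ : σ → ℂ => c) := ⟨MvPolynomial.C c, fun x => by simp⟩
lemma proj (i : σ) : PolyFn (fun x : σ → ℂ => x i) := ⟨MvPolynomial.X i, fun x => by simp⟩
lemma add (hu : PolyFn u) (hv : PolyFn v) : PolyFn (fun x => u x + v x) := by
  obtain ⟨p, hp⟩ := hu; obtain ⟨q, hq⟩ := hv
  exact ⟨p + q, fun x => by simp [hp, hq]⟩
lemma mul (hu : PolyFn u) (hv : PolyFn v) : PolyFn (fun x => u x * v x) := by
  obtain ⟨p, hp⟩ := hu; obtain ⟨q, hq⟩ := hv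
  exact ⟨p * q, fun x => by simp [hp, hq]⟩
lemma neg (hu : PolyFn u) : PolyFn (fun x => - u x) := by
  obtain ⟨p, hp⟩ := hu
  exact ⟨-p, fun x => by simp [hp]⟩
lemma sum {ι : Type*} (s : Finset ι) {w : ι → (σ → ℂ) → ℂ} (h : ∀ i ∈ s, PolyFn (w i)) :
    PolyFn (fun x => ∑ i ∈ s, w i x) := by
  classical
  induction s using Finset.induction_on with
  | empty => simpa using const 0
  | insert a s ha ih =>
    simp only [Finset.sum_insert ha]
    exact add (h a (by simp)) (ih fun i hi => h i (by simp [hi]))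
/-- Composition with a polynomial. -/
lemma comp {N : Type*} (Q : MvPolynomial N ℂ) {w : (σ → ℂ) → N → ℂ}
    (h : ∀ n, PolyFn (fun x => w x n)) : PolyFn (fun x => MvPolynomial.eval (w x) Q) := by
  choose p hp using h
  refine ⟨MvPolynomial.aeval p Q, fun x => ?_⟩
  have : w x = fun n => MvPolynomial.eval x (p n) := by ext n; rw [hp]
  show _ = MvPolynomial.eval (w x) Q
  rw [this]
  induction Q using MvPolynomial.induction_on with
  | C a => simp
  | add p q h1 h2 => simp only [map_add, h1, h2]
  | mul_X p i h => simp only [map_mul, h, MvPolynomial.aeval_X, MvPolynomial.eval_X]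
end PolyFn

/-- Polynomial-valued functions with polynomial coefficients. -/
def PolyFnP {σ : Type*} (u : (σ → ℂ) → ℂ[X]) : Prop := ∀ n, PolyFn (fun x => (u x).coeff n)

namespace PolyFnP
variable {σ : Type*} {u v : (σ → ℂ) → ℂ[X]}
lemma const (c : ℂ[X]) : PolyFnP (fun _ : σ → ℂ => c) := fun _ => PolyFn.const _
lemma CC {a : (σ → ℂ) → ℂ} (h : PolyFn a) : PolyFnP (fun x => C (a x)) := by
  intro n
  rcases eq_or_ne n 0 with rfl | hn
  · simpa using h
  · simpa [coeff_C, hn] using PolyFn.const 0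
lemma add (hu : PolyFnP u) (hv : PolyFnP v) : PolyFnP (fun x => u x + v x) := by
  intro n; simpa using (hu n).add (hv n)
lemma neg (hu : PolyFnP u) : PolyFnP (fun x => - u x) := by
  intro n; simpa using (hu n).neg
lemma sub (hu : PolyFnP u) (hv : PolyFnP v) : PolyFnP (fun x => u x - v x) := by
  intro n; simpa [sub_eq_add_neg] using (hu n).add (hv n).neg
lemma mul (hu : PolyFnP u) (hv : PolyFnP v) : PolyFnP (fun x => u x * v x) := by
  intro n
  simp only [coeff_mul]
  exact PolyFn.sum _ fun i _ => (hu _).mul (hv _)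
lemma pow (hu : PolyFnP u) (k : ℕ) : PolyFnP (fun x => u x ^ k) := by
  induction k with
  | zero => simpa using const 1
  | succ k ih => simpa [pow_succ] using ih.mul hu
lemma sum {ι : Type*} (s : Finset ι) {w : ι → (σ → ℂ) → ℂ[X]} (h : ∀ i ∈ s, PolyFnP (w i)) :
    PolyFnP (fun x => ∑ i ∈ s, w i x) := by
  intro n
  simp only [finsetSum_coeff]
  exact PolyFn.sum _ fun i hi => h i hi n
lemma prod {ι : Type*} (s : Finset ι) {w : ι → (σ → ℂ) → ℂ[X]} (h : ∀ i ∈ s, PolyFnP (w i)) :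
    PolyFnP (fun x => ∏ i ∈ s, w i x) := by
  classical
  induction s using Finset.induction_on with
  | empty => simpa using const 1
  | insert a s ha ih =>
    simp only [Finset.prod_insert ha]
    exact mul (h a (by simp)) (ih fun i hi => h i (by simp [hi]))
end PolyFnP

def PolyFnPP {σ : Type*} (u : (σ → ℂ) → ℂ[X][X]) : Prop := ∀ n, PolyFnP (fun x => (u x).coeff n)

namespace PolyFnPP
variable {σ : Type*} {u v : (σ → ℂ) → ℂ[X][X]}
lemma const (c : ℂ[X][X]) : PolyFnPP (fun _ : σ → ℂ => c) := fun _ => PolyFnP.const _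
lemma CC {a : (σ → ℂ) → ℂ[X]} (h : PolyFnP a) : PolyFnPP (fun x => C (a x)) := by
  intro n
  rcases eq_or_ne n 0 with rfl | hn
  · simpa using h
  · simpa [coeff_C, hn] using PolyFnP.const 0
lemma mapC {a : (σ → ℂ) → ℂ[X]} (h : PolyFnP a) : PolyFnPP (fun x => (a x).map C) := by
  intro n
  simpa using PolyFnP.CC (h n)
lemma add (hu : PolyFnPP u) (hv : PolyFnPP v) : PolyFnPP (fun x => u x + v x) := by
  intro n; simpa using (hu n).add (hv n)
lemma mul (hu : PolyFnPP u) (hv : PolyFnPP v) : PolyFnPP (fun x => u x * v x) := by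
  intro n
  simp only [coeff_mul]
  exact PolyFnP.sum _ fun i _ => (hu _).mul (hv _)
lemma pow (hu : PolyFnPP u) (k : ℕ) : PolyFnPP (fun x => u x ^ k) := by
  induction k with
  | zero => simpa using const 1
  | succ k ih => simpa [pow_succ] using ih.mul hu
lemma sum {ι : Type*} (s : Finset ι) {w : ι → (σ → ℂ) → ℂ[X][X]} (h : ∀ i ∈ s, PolyFnPP (w i)) :
    PolyFnPP (fun x => ∑ i ∈ s, w i x) := by
  intro n
  simp only [finsetSum_coeff]
  exact PolyFnP.sum _ fun i hi => h i hi n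
lemma prod {ι : Type*} (s : Finset ι) {w : ι → (σ → ℂ) → ℂ[X][X]} (h : ∀ i ∈ s, PolyFnPP (w i)) :
    PolyFnPP (fun x => ∏ i ∈ s, w i x) := by
  classical
  induction s using Finset.induction_on with
  | empty => simpa using const 1
  | insert a s ha ih =>
    simp only [Finset.prod_insert ha]
    exact mul (h a (by simp)) (ih fun i hi => h i (by simp [hi]))
end PolyFnPP

/-- Dimension lemma: a polynomial map from a smaller affine space is not dominant. -/
lemma dimension_lemma {I N : Type} [Fintype I] [Fintype N] (hc : Fintype.card I < Fintype.card N)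
    (u : (I → ℂ) → N → ℂ) (hu : ∀ n, PolyFn (fun x => u x n)) :
    ∃ Q : MvPolynomial N ℂ, Q ≠ 0 ∧ ∀ x, MvPolynomial.eval (u x) Q = 0 := by
  choose p hp using hu
  have h : ¬ AlgebraicIndependent ℂ p := by
    intro h
    have := h.cardinalMk_le_trdeg
    rw [MvPolynomial.trdeg_of_isDomain] at this
    simp at this
    omega
  rw [algebraicIndependent_iff] at h
  push Not at h
  obtain ⟨Q, h1, h2⟩ := h
  refine ⟨Q, h2, fun x => ?_⟩
  have : u x = fun n => MvPolynomial.eval x (p n) := by ext n; rw [hp]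
  have h3 : ∀ Q : MvPolynomial N ℂ, MvPolynomial.eval (u x) Q
      = MvPolynomial.eval x (MvPolynomial.aeval p Q) := by
    intro Q
    rw [this]
    induction Q using MvPolynomial.induction_on with
    | C a => simp
    | add p q h1 h2 => simp only [map_add, h1, h2]
    | mul_X p i h => simp only [map_mul, h, MvPolynomial.aeval_X, MvPolynomial.eval_X]
  rw [h3, h1]; simp

end
end Part1

section Part2
open Polynomial
noncomputable section

/-- The polynomial with given coefficient vector. -/
def pol (m : ℕ) (y : Fin m → ℂ) : ℂ[X] := ∑ i : Fin m, C (y i) * X ^ (i : ℕ)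

lemma pol_surj {m : ℕ} {n : ℂ[X]} (h : n.degree < m) : pol m (fun i => n.coeff i) = n := by
  rcases eq_or_ne n 0 with rfl | hn
  · simp [pol]
  have h' : n.natDegree < m := (natDegree_lt_iff_degree_lt hn).2 h
  unfold pol
  rw [Fin.sum_univ_eq_sum_range (fun i => C (n.coeff i) * X ^ i) m]
  exact (as_sum_range_C_mul_X_pow' _ h').symm

lemma PolyFnP.pol {σ : Type*} {m : ℕ} {y : (σ → ℂ) → Fin m → ℂ}
    (h : ∀ i, PolyFn (fun x => y x i)) : PolyFnP (fun x => pol m (y x)) :=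
  PolyFnP.sum _ fun i _ => (PolyFnP.CC (h i)).mul (PolyFnP.const _)

lemma PolyFnP.lin {σ : Type*} (i : σ) : PolyFnP (fun x : σ → ℂ => X - C (x i)) :=
  (PolyFnP.const _).sub (PolyFnP.CC (PolyFn.proj i))

lemma PolyFnP.cst {σ : Type*} (i : σ) : PolyFnP (fun x : σ → ℂ => C (x i)) :=
  PolyFnP.CC (PolyFn.proj i)

/-- A condition on pairs of polynomials that is parametrized by at most `N` parameters. -/
def Thin (N : ℕ) (Ev : ℂ[X] → ℂ[X] → Prop) : Prop :=
  ∃ (I : Type) (_ : Fintype I) (u v : (I → ℂ) → ℂ[X]), Fintype.card I ≤ N ∧ PolyFnP u ∧ PolyFnP v ∧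
    ∀ f g, Ev f g → ∃ x, u x = f ∧ v x = g

def Thin4 (N : ℕ) (Ev : ℂ[X] → ℂ[X] → ℂ[X] → ℂ[X] → Prop) : Prop :=
  ∃ (I : Type) (_ : Fintype I) (u v u1 v1 : (I → ℂ) → ℂ[X]), Fintype.card I ≤ N ∧
    PolyFnP u ∧ PolyFnP v ∧ PolyFnP u1 ∧ PolyFnP v1 ∧
    ∀ f g f1 g1, Ev f g f1 g1 → ∃ x, u x = f ∧ v x = g ∧ u1 x = f1 ∧ v1 x = g1

/-- If a two-polynomial event is thin then so is the four-polynomial event with free `f1`, `g1`. -/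
lemma Thin.thin4 {d : ℕ} {Ev} (h : Thin (2 * d) Ev) :
    Thin4 (4 * d) (fun f g f1 g1 => Ev f g ∧ f1.degree < d ∧ g1.degree < d) := by
  obtain ⟨I, hI, u, v, hc, hu, hv, H⟩ := h
  refine ⟨I ⊕ (Fin d ⊕ Fin d), inferInstance, fun x => u (fun i => x (.inl i)),
    fun x => v (fun i => x (.inl i)), fun x => pol d (fun i => x (.inr (.inl i))),
    fun x => pol d (fun i => x (.inr (.inr i))), by simp; omega, ?_, ?_, ?_, ?_, ?_⟩
  · intro n
    obtain ⟨p, hp⟩ := hu n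
    exact ⟨MvPolynomial.rename Sum.inl p, fun x => by
      rw [MvPolynomial.eval_rename]; exact hp _⟩
  · intro n
    obtain ⟨p, hp⟩ := hv n
    exact ⟨MvPolynomial.rename Sum.inl p, fun x => by
      rw [MvPolynomial.eval_rename]; exact hp _⟩
  · exact PolyFnP.pol fun i => PolyFn.proj _
  · exact PolyFnP.pol fun i => PolyFn.proj _
  · rintro f g f1 g1 ⟨h0, h1, h2⟩
    obtain ⟨x, rfl, rfl⟩ := H f g h0
    exact ⟨Sum.elim x (Sum.elim (fun i => f1.coeff i) (fun i => g1.coeff i)), rfl, rfl,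
      pol_surj h1, pol_surj h2⟩

def rootProd {k : ℕ} (μ : Fin k → ℕ) (p : Fin k → ℂ) : ℂ[X] := ∏ i, (X - C (p i)) ^ μ i

lemma PolyFnP.rootProd {σ : Type*} {k : ℕ} (μ : Fin k → ℕ) {y : (σ → ℂ) → Fin k → ℂ}
    (h : ∀ i, PolyFn (fun x => y x i)) : PolyFnP (fun x => rootProd μ (y x)) :=
  PolyFnP.prod _ fun i _ => PolyFnP.pow ((PolyFnP.const _).sub (PolyFnP.CC (h i))) _

def EvL (d : ℕ) {k : ℕ} (μ : Fin k → ℕ) (m : ℕ) (f g : ℂ[X]) : Prop :=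
  g.degree < (d + 1 : ℕ) ∧ ∃ (l : ℂ) (p : Fin k → ℂ) (n : ℂ[X]), n.degree < m ∧
    f = C l * g + rootProd μ p * n

def EvB (d : ℕ) (e : ℕ) {k : ℕ} (μ : Fin k → ℕ) (m : ℕ) (f g : ℂ[X]) : Prop :=
  ∃ (r l : ℂ) (p : Fin k → ℂ) (g' n : ℂ[X]), g'.degree < d ∧ n.degree < m ∧
    g = (X - C r) * g' ∧ f = (X - C r) * (C l * g' + (X - C r) ^ e * rootProd μ p * n)

def EvG (d : ℕ) {k : ℕ} (μ : Fin k → ℕ) (m : ℕ) (f g : ℂ[X]) : Prop :=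
  f.degree < (d + 1 : ℕ) ∧ ∃ (p : Fin k → ℂ) (n : ℂ[X]), n.degree < m ∧ g = rootProd μ p * n

/-- Common roots: `f` and `g` divisible by `∏ (t - p_i)`, with exponents `μ`, `ν`. -/
def EvC {k : ℕ} (μ ν : Fin k → ℕ) (m m' : ℕ) (f g : ℂ[X]) : Prop :=
  ∃ (p : Fin k → ℂ) (f' g' : ℂ[X]), f'.degree < m ∧ g'.degree < m' ∧ f = rootProd μ p * f' ∧
    g = rootProd ν p * g'

def EvN {k : ℕ} (μ : Fin k → ℕ) (m : ℕ) (f g : ℂ[X]) : Prop :=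
  ∃ (c l : ℂ) (p q : Fin k → ℂ) (n n' : ℂ[X]), n.degree < m ∧ n'.degree < m ∧
    g = C c * (rootProd μ p * n - rootProd μ q * n') ∧ f = C l * g + rootProd μ p * n

def EvTN (d : ℕ) (f g f1 g1 : ℂ[X]) : Prop :=
  g.degree < (d + 1 : ℕ) ∧ g1.degree < d ∧ ∃ (l r p q : ℂ) (n n1 : ℂ[X]), n.degree < (d - 3 : ℕ) ∧
    n1.degree < (d - 2 : ℕ) ∧ f = C l * g + ((X - C p) * (X - C q)) ^ 2 * n ∧
    f1 = C l * g1 + C r * (g - C (g.coeff d) * X ^ (d - 2) * ((X - C p) * (X - C q)))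
      + ((X - C p) * (X - C q)) * n1

def EvTB (d : ℕ) (f g f1 g1 : ℂ[X]) : Prop :=
  g1.degree < d ∧ ∃ (r l : ℂ) (g' n n1 : ℂ[X]), g'.degree < d ∧ n.degree < (d - 1 : ℕ) ∧
    n1.degree < (d - 1 : ℕ) ∧ g = (X - C r) * g' ∧ f = (X - C r) * (C l * g' + (X - C r) * n) ∧
    f1 = C l * g1 + (X - C r) * n1

lemma thinL {d k : ℕ} (μ : Fin k → ℕ) {m N : ℕ} (h : d + 2 + k + m ≤ N) : Thin N (EvL d μ m) := by
  refine ⟨Fin (d + 1) ⊕ Unit ⊕ Fin k ⊕ Fin m, inferInstance,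
    fun x => C (x (.inr (.inl ()))) * pol (d + 1) (fun i => x (.inl i)) +
      rootProd μ (fun i => x (.inr (.inr (.inl i)))) * pol m (fun i => x (.inr (.inr (.inr i)))),
    fun x => pol (d + 1) (fun i => x (.inl i)), by simp; omega, ?_, ?_, ?_⟩
  · exact ((PolyFnP.cst _).mul (PolyFnP.pol fun i => PolyFn.proj _)).add
      ((PolyFnP.rootProd μ fun i => PolyFn.proj _).mul (PolyFnP.pol fun i => PolyFn.proj _))
  · exact PolyFnP.pol fun i => PolyFn.proj _
  · rintro f g ⟨hg, l, p, n, hn, rfl⟩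
    refine ⟨Sum.elim (fun i => g.coeff i) (Sum.elim (fun _ => l) (Sum.elim p fun i => n.coeff i)),
      ?_, ?_⟩ <;> simp [pol_surj hg, pol_surj hn]

lemma thinB {d e k : ℕ} (μ : Fin k → ℕ) {m N : ℕ} (h : d + 2 + k + m ≤ N) :
    Thin N (EvB d e μ m) := by
  refine ⟨Fin d ⊕ (Unit ⊕ Unit) ⊕ Fin k ⊕ Fin m, inferInstance,
    fun x => (X - C (x (.inr (.inl (.inl ()))))) *
      (C (x (.inr (.inl (.inr ())))) * pol d (fun i => x (.inl i)) +
      (X - C (x (.inr (.inl (.inl ()))))) ^ e *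
      rootProd μ (fun i => x (.inr (.inr (.inl i)))) * pol m (fun i => x (.inr (.inr (.inr i))))),
    fun x => (X - C (x (.inr (.inl (.inl ()))))) * pol d (fun i => x (.inl i)),
    by simp; omega, ?_, ?_, ?_⟩
  · exact (PolyFnP.lin _).mul (((PolyFnP.cst _).mul (PolyFnP.pol fun i => PolyFn.proj _)).add
      ((((PolyFnP.lin _).pow _).mul (PolyFnP.rootProd μ fun i => PolyFn.proj _)).mul
        (PolyFnP.pol fun i => PolyFn.proj _)))
  · exact (PolyFnP.lin _).mul (PolyFnP.pol fun i => PolyFn.proj _)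
  · rintro f g ⟨r, l, p, g', n, hg, hn, rfl, rfl⟩
    refine ⟨Sum.elim (fun i => g'.coeff i) (Sum.elim (Sum.elim (fun _ => r) fun _ => l)
      (Sum.elim p fun i => n.coeff i)),
      ?_, ?_⟩ <;> simp [pol_surj hg, pol_surj hn]

lemma thinG {d k : ℕ} (μ : Fin k → ℕ) {m N : ℕ} (h : d + 1 + k + m ≤ N) : Thin N (EvG d μ m) := by
  refine ⟨Fin (d + 1) ⊕ Fin k ⊕ Fin m, inferInstance, fun x => pol (d + 1) (fun i => x (.inl i)),
    fun x => rootProd μ (fun i => x (.inr (.inl i))) * pol m (fun i => x (.inr (.inr i))),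
    by simp; omega, ?_, ?_, ?_⟩
  · exact PolyFnP.pol fun i => PolyFn.proj _
  · exact (PolyFnP.rootProd μ fun i => PolyFn.proj _).mul (PolyFnP.pol fun i => PolyFn.proj _)
  · rintro f g ⟨hg, p, n, hn, rfl⟩
    refine ⟨Sum.elim (fun i => f.coeff i) (Sum.elim p fun i => n.coeff i),
      ?_, ?_⟩ <;> simp [pol_surj hg, pol_surj hn]

lemma thinC {k : ℕ} (μ ν : Fin k → ℕ) {m m' N : ℕ} (h : k + m + m' ≤ N) :
    Thin N (EvC μ ν m m') := by
  refine ⟨Fin k ⊕ Fin m ⊕ Fin m', inferInstance,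
    fun x => rootProd μ (fun i => x (.inl i)) * pol m (fun i => x (.inr (.inl i))),
    fun x => rootProd ν (fun i => x (.inl i)) * pol m' (fun i => x (.inr (.inr i))),
    by simp; omega, ?_, ?_, ?_⟩
  · exact (PolyFnP.rootProd μ fun i => PolyFn.proj _).mul (PolyFnP.pol fun i => PolyFn.proj _)
  · exact (PolyFnP.rootProd ν fun i => PolyFn.proj _).mul (PolyFnP.pol fun i => PolyFn.proj _)
  · rintro f g ⟨p, f', g', hg, hn, rfl, rfl⟩
    refine ⟨Sum.elim p (Sum.elim (fun i => f'.coeff i) fun i => g'.coeff i),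
      ?_, ?_⟩ <;> simp [pol_surj hg, pol_surj hn]

lemma thinN {k : ℕ} (μ : Fin k → ℕ) {m N : ℕ} (h : 2 + 2 * k + 2 * m ≤ N) :
    Thin N (EvN μ m) := by
  have key : PolyFnP (fun x : (Unit ⊕ Unit) ⊕ (Fin k ⊕ Fin k) ⊕ (Fin m ⊕ Fin m) → ℂ =>
      C (x (.inl (.inl ()))) *
      (rootProd μ (fun i => x (.inr (.inl (.inl i)))) * pol m (fun i => x (.inr (.inr (.inl i)))) -
      rootProd μ (fun i => x (.inr (.inl (.inr i)))) *
        pol m (fun i => x (.inr (.inr (.inr i)))))) :=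
    (PolyFnP.cst _).mul (((PolyFnP.rootProd μ fun i => PolyFn.proj _).mul
      (PolyFnP.pol fun i => PolyFn.proj _)).sub ((PolyFnP.rootProd μ fun i => PolyFn.proj _).mul
      (PolyFnP.pol fun i => PolyFn.proj _)))
  refine ⟨(Unit ⊕ Unit) ⊕ (Fin k ⊕ Fin k) ⊕ (Fin m ⊕ Fin m), inferInstance, _, _,
    by simp; omega, ((PolyFnP.cst (.inl (.inr ()))).mul key).add
      ((PolyFnP.rootProd μ fun i => PolyFn.proj (.inr (.inl (.inl i)))).mul
      (PolyFnP.pol fun i => PolyFn.proj (.inr (.inr (.inl i))))), key, ?_⟩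
  · rintro f g ⟨c, l, p, q, n, n', hg, hn, rfl, rfl⟩
    refine ⟨Sum.elim (Sum.elim (fun _ => c) fun _ => l) (Sum.elim (Sum.elim p q)
      (Sum.elim (fun i => n.coeff i) fun i => n'.coeff i)),
      ?_, ?_⟩ <;> simp [pol_surj hg, pol_surj hn]

lemma thinTN {d : ℕ} (hd : 3 ≤ d) : Thin4 (4 * d) (EvTN d) := by
  refine ⟨Fin (d + 1) ⊕ Fin d ⊕ Fin 4 ⊕ Fin (d - 3) ⊕ Fin (d - 2), inferInstance, 
    fun x => C (x (.inr (.inr (.inl 0)))) * pol (d + 1) (fun i => x (.inl i)) +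
      ((X - C (x (.inr (.inr (.inl 2))))) * (X - C (x (.inr (.inr (.inl 3)))))) ^ 2 *
       pol (d - 3) (fun i => x (.inr (.inr (.inr (.inl i))))),
    fun x => pol (d + 1) (fun i => x (.inl i)),
    fun x => C (x (.inr (.inr (.inl 0)))) * pol d (fun i => x (.inr (.inl i))) +
      C (x (.inr (.inr (.inl 1)))) * (pol (d + 1) (fun i => x (.inl i)) -
        C ((pol (d + 1) (fun i => x (.inl i))).coeff d) * X ^ (d - 2) *
        ((X - C (x (.inr (.inr (.inl 2))))) * (X - C (x (.inr (.inr (.inl 3)))))))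
      + ((X - C (x (.inr (.inr (.inl 2))))) * (X - C (x (.inr (.inr (.inl 3)))))) *
       pol (d - 2) (fun i => x (.inr (.inr (.inr (.inr i))))),
    fun x => pol d (fun i => x (.inr (.inl i))), by simp; omega, ?_, ?_, ?_, ?_, ?_⟩
  · exact ((PolyFnP.cst _).mul (PolyFnP.pol fun i => PolyFn.proj _)).add
      ((((PolyFnP.lin _).mul (PolyFnP.lin _)).pow _).mul (PolyFnP.pol fun i => PolyFn.proj _))
  · exact (PolyFnP.pol fun i => PolyFn.proj _)
  · exact (((PolyFnP.cst _).mul (PolyFnP.pol fun i => PolyFn.proj _)).add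
      ((PolyFnP.cst _).mul ((PolyFnP.pol fun i => PolyFn.proj _).sub
        (((PolyFnP.CC ((PolyFnP.pol fun i => PolyFn.proj _) d)).mul (PolyFnP.const _)).mul
        ((PolyFnP.lin _).mul (PolyFnP.lin _)))))).add
        (((PolyFnP.lin _).mul (PolyFnP.lin _)).mul (PolyFnP.pol fun i => PolyFn.proj _))
  · exact (PolyFnP.pol fun i => PolyFn.proj _)
  · rintro f g f1 g1 ⟨hg, hg1, l, r, p, q, n, n1, hn, hn1, rfl, rfl⟩
    refine ⟨Sum.elim (fun i => g.coeff i) (Sum.elim (fun i => g1.coeff i)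
      (Sum.elim ![l, r, p, q] (Sum.elim (fun i => n.coeff i) fun i => n1.coeff i))), ?_⟩
    simp [pol_surj hg, pol_surj hn, pol_surj hg1, pol_surj hn1]

lemma thinTB {d : ℕ} (hd : 3 ≤ d) : Thin4 (4 * d) (EvTB d) := by
  refine ⟨Fin d ⊕ Fin d ⊕ Fin 2 ⊕ Fin (d - 1) ⊕ Fin (d - 1), inferInstance, 
    fun x => (X - C (x (.inr (.inr (.inl 0))))) * (C (x (.inr (.inr (.inl 1)))) *
      pol d (fun i => x (.inl i)) + (X - C (x (.inr (.inr (.inl 0))))) *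
       pol (d - 1) (fun i => x (.inr (.inr (.inr (.inl i)))))),
    fun x => (X - C (x (.inr (.inr (.inl 0))))) * pol d (fun i => x (.inl i)),
    fun x => C (x (.inr (.inr (.inl 1)))) * pol d (fun i => x (.inr (.inl i))) +
      (X - C (x (.inr (.inr (.inl 0))))) *
       pol (d - 1) (fun i => x (.inr (.inr (.inr (.inr i))))),
    fun x => pol d (fun i => x (.inr (.inl i))), by simp; omega, ?_, ?_, ?_, ?_, ?_⟩
  · exact (PolyFnP.lin _).mul (((PolyFnP.cst _).mul (PolyFnP.pol fun i => PolyFn.proj _)).add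
      ((PolyFnP.lin _).mul (PolyFnP.pol fun i => PolyFn.proj _)))
  · exact (PolyFnP.lin _).mul (PolyFnP.pol fun i => PolyFn.proj _)
  · exact ((PolyFnP.cst _).mul (PolyFnP.pol fun i => PolyFn.proj _)).add
        ((PolyFnP.lin _).mul (PolyFnP.pol fun i => PolyFn.proj _))
  · exact (PolyFnP.pol fun i => PolyFn.proj _)
  · rintro f g f1 g1 ⟨hg1, r, l, g', n, n1, hg, hn, hn1, rfl, rfl, rfl⟩
    refine ⟨Sum.elim (fun i => g'.coeff i) (Sum.elim (fun i => g1.coeff i)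
      (Sum.elim ![r, l] (Sum.elim (fun i => n.coeff i) fun i => n1.coeff i))), ?_⟩
    simp [pol_surj hg, pol_surj hn, pol_surj hg1, pol_surj hn1]
end
end Part2

section Part3
open Polynomial
noncomputable section

/-- Polynomials in `ℂ[a][t]` of total degree at most `d`. -/
def InV (d : ℕ) (φ : ℂ[X][X]) : Prop := ∀ j k, d < j + k → (φ.coeff j).coeff k = 0

abbrev JJ (d : ℕ) : Type := Σ j : Fin (d + 1), Fin (d + 1 - j)
abbrev JJ2 (d : ℕ) : Type := Σ j : Fin (d + 1), Fin (d - 1 - j)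

def cf (d : ℕ) (φ : ℂ[X][X]) : JJ d → ℂ := fun i => (φ.coeff i.1).coeff i.2

/-- Restriction to the line `a`. -/
def sl (a : ℂ) (φ : ℂ[X][X]) : ℂ[X] := φ.map (evalRingHom a)
/-- First derivative in `a`. -/
def sl1 (d : ℕ) (a : ℂ) (φ : ℂ[X][X]) : ℂ[X] :=
  ∑ j ∈ Finset.range (d + 1), C ((derivative (φ.coeff j)).eval a) * X ^ j

lemma InV.coeff_eq_zero {d : ℕ} {φ : ℂ[X][X]} (h : InV d φ) {j : ℕ} (hj : d < j) :
    φ.coeff j = 0 := by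
  ext k; simpa using h j k (by omega)

lemma InV.natDegree_coeff {d : ℕ} {φ : ℂ[X][X]} (h : InV d φ) (j : ℕ) :
    (φ.coeff j).natDegree ≤ d - j :=
  natDegree_le_iff_coeff_eq_zero.2 fun k hk => h j k (by omega)

lemma InV.natDegree_le {d : ℕ} {φ : ℂ[X][X]} (h : InV d φ) : φ.natDegree ≤ d :=
  natDegree_le_iff_coeff_eq_zero.2 fun _ hk => h.coeff_eq_zero hk

lemma sl1_coeff {d : ℕ} {φ : ℂ[X][X]} (h : InV d φ) (a : ℂ) (j : ℕ) :
    (sl1 d a φ).coeff j = (derivative (φ.coeff j)).eval a := by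
  simp only [sl1, finsetSum_coeff, coeff_C_mul, coeff_X_pow, mul_ite, mul_one, mul_zero]
  rw [Finset.sum_ite_eq (Finset.range (d+1)) j]
  split_ifs with hj
  · rfl
  · rw [h.coeff_eq_zero (by simpa using hj)]; simp

def expand2 (d : ℕ) (a : ℂ) (e : JJ2 d → ℂ) : ℂ[X][X] :=
  ∑ i : JJ2 d, C (C (e i) * (X - C a) ^ ((i.2 : ℕ) + 2)) * X ^ (i.1 : ℕ)

lemma expand_eq {d : ℕ} {φ : ℂ[X][X]} (h : InV d φ) (a : ℂ) :
    φ = (sl a φ).map C + C (X - C a) * (sl1 d a φ).map C +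
      expand2 d a (fun i => (taylor a (φ.coeff i.1)).coeff (i.2 + 2)) := by
  apply Polynomial.ext; intro j
  simp only [coeff_add, coeff_C_mul, coeff_map, sl1_coeff h, sl, expand2, finsetSum_coeff,
    coeff_X_pow, mul_ite, mul_one, mul_zero, coe_evalRingHom]
  rw [Fintype.sum_sigma]
  simp only
  by_cases hj : d < j
  · rw [h.coeff_eq_zero hj]
    rw [Finset.sum_eq_zero]
    · simp
    intro i _
    refine Finset.sum_eq_zero fun k _ => ?_
    rw [if_neg (by have := i.2; omega)]
  · have hj' : j < d + 1 := by omega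
    rw [Finset.sum_eq_single ⟨j, hj'⟩]
    · simp only [if_true]
      conv_lhs => rw [← sum_taylor_eq (φ.coeff j) a]
      rw [sum_over_range' _ (by simp) (d - 1 - j + 2)
        (by have := h.natDegree_coeff j; rw [natDegree_taylor]; omega)]
      rw [Finset.sum_range_succ', Finset.sum_range_succ',
        Fin.sum_univ_eq_sum_range (fun k => C ((taylor a (φ.coeff j)).coeff (k + 2))
          * (X - C a) ^ (k + 2)) (d - 1 - j)]
      simp [taylor_coeff_zero, taylor_coeff_one]
      ring
    · intro i _ hi
      rw [Finset.sum_eq_zero]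
      intro k _
      rw [if_neg]
      rintro rfl; exact hi rfl
    · simp

lemma card_JJ (d : ℕ) : Fintype.card (JJ d) = Fintype.card (JJ2 d) + (2 * d + 1) := by
  simp only [JJ, JJ2, Fintype.card_sigma, Fintype.card_fin]
  rw [Fin.sum_univ_castSucc, Fin.sum_univ_castSucc (n := d)]
  have : ∀ i : Fin d, d + 1 - (i.castSucc : ℕ) = (d - 1 - (i.castSucc : ℕ)) + 2 := by
    intro i; have := i.2; simp; omega
  simp only [this, Finset.sum_add_distrib]
  simp
  omega

lemma PolyFn.rename {σ τ : Type*} {u : (σ → ℂ) → ℂ} (h : PolyFn u) (e : σ → τ) :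
    PolyFn (fun x : τ → ℂ => u (fun i => x (e i))) := by
  obtain ⟨p, hp⟩ := h
  exact ⟨MvPolynomial.rename e p, fun x => by rw [MvPolynomial.eval_rename]; exact hp _⟩

lemma PolyFnP.rename {σ τ : Type*} {u : (σ → ℂ) → ℂ[X]} (h : PolyFnP u) (e : σ → τ) :
    PolyFnP (fun x : τ → ℂ => u (fun i => x (e i))) := fun n => (h n).rename e

theorem gen_moving {d : ℕ} {Ev} (h : Thin4 (4 * d) Ev) :
    ∃ Q : MvPolynomial (JJ d ⊕ JJ d) ℂ, Q ≠ 0 ∧ ∀ φ γ, InV d φ → InV d γ → ∀ a,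
      Ev (sl a φ) (sl a γ) (sl1 d a φ) (sl1 d a γ) →
        MvPolynomial.eval (Sum.elim (cf d φ) (cf d γ)) Q = 0 := by
  obtain ⟨I, hI, u, v, u1, v1, hc, hu, hv, hu1, hv1, H⟩ := h
  have key : ∀ (u u1 : (I → ℂ) → ℂ[X]) (_ : PolyFnP u) (_ : PolyFnP u1) (T : JJ2 d → JJ2 d ⊕ JJ2 d),
      PolyFnPP (fun x : I ⊕ Unit ⊕ (JJ2 d ⊕ JJ2 d) → ℂ => (u (fun i => x (.inl i))).map C +
        C (X - C (x (.inr (.inl ())))) * (u1 (fun i => x (.inl i))).map C +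
        expand2 d (x (.inr (.inl ()))) (fun i => x (.inr (.inr (T i))))) := by
    intro u u1 hu hu1 T
    exact ((PolyFnPP.mapC (hu.rename _)).add ((PolyFnPP.CC (PolyFnP.lin _)).mul
      (PolyFnPP.mapC (hu1.rename _)))).add (PolyFnPP.sum _ fun i _ => (PolyFnPP.CC
      ((PolyFnP.cst _).mul ((PolyFnP.lin _).pow _))).mul (PolyFnPP.const _))
  have k1 := key u u1 hu hu1 Sum.inl
  have k2 := key v v1 hv hv1 Sum.inr
  obtain ⟨Q, hQ, hQ'⟩ := dimension_lemma (I := I ⊕ Unit ⊕ (JJ2 d ⊕ JJ2 d)) (N := JJ d ⊕ JJ d)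
    (by simp only [Fintype.card_sum, card_JJ, Fintype.card_unit]; omega)
    (fun x => Sum.elim
      (cf d ((u (fun i => x (.inl i))).map C +
        C (X - C (x (.inr (.inl ())))) * (u1 (fun i => x (.inl i))).map C +
        expand2 d (x (.inr (.inl ()))) (fun i => x (.inr (.inr (.inl i))))))
      (cf d ((v (fun i => x (.inl i))).map C +
        C (X - C (x (.inr (.inl ())))) * (v1 (fun i => x (.inl i))).map C +
        expand2 d (x (.inr (.inl ()))) (fun i => x (.inr (.inr (.inr i)))))))
    (by
      rintro (i | i)
      · exact k1 i.1 i.2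
      · exact k2 i.1 i.2)
  refine ⟨Q, hQ, fun φ γ hφ hγ a hE => ?_⟩
  obtain ⟨y, h1, h2, h3, h4⟩ := H _ _ _ _ hE
  have := hQ' (Sum.elim y (Sum.elim (fun _ => a) (Sum.elim
    (fun i => (taylor a (φ.coeff i.1)).coeff (i.2 + 2))
    (fun i => (taylor a (γ.coeff i.1)).coeff (i.2 + 2)))))
  simp only [Sum.elim_inl, Sum.elim_inr, h1, h2, h3, h4] at this
  rwa [← expand_eq hφ a, ← expand_eq hγ a] at this

/-- Restriction to the line at infinity: top coefficients. -/
def slInf (d : ℕ) (φ : ℂ[X][X]) : ℂ[X] :=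
  ∑ j ∈ Finset.range (d + 1), C ((φ.coeff j).coeff (d - j)) * X ^ j

lemma slInf_coeff (d : ℕ) (φ : ℂ[X][X]) {j : ℕ} (hj : j ≤ d) :
    (slInf d φ).coeff j = (φ.coeff j).coeff (d - j) := by
  simp only [slInf, finsetSum_coeff, coeff_C_mul, coeff_X_pow, mul_ite, mul_one, mul_zero]
  rw [Finset.sum_ite_eq (Finset.range (d+1)) j, if_pos (by simp; omega)]

theorem gen_fixed {d : ℕ} {Ev} (h : Thin (2 * d + 1) Ev) :
    ∃ Q : MvPolynomial (JJ d ⊕ JJ d) ℂ, Q ≠ 0 ∧ ∀ φ γ,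
      Ev (slInf d φ) (slInf d γ) → MvPolynomial.eval (Sum.elim (cf d φ) (cf d γ)) Q = 0 := by
  obtain ⟨I, hI, u, v, hc, hu, hv, H⟩ := h
  obtain ⟨Q, hQ, hQ'⟩ := dimension_lemma (I := I) (N := Fin (d + 1) ⊕ Fin (d + 1))
    (by simp; omega)
    (fun x => Sum.elim (fun j => (u x).coeff j) (fun j => (v x).coeff j))
    (by
      rintro (i | i)
      · exact hu _
      · exact hv _)
  let e : Fin (d + 1) → JJ d := fun j => ⟨j, ⟨d - j, by omega⟩⟩
  have he : Function.Injective e := fun i j hij => congrArg (fun z => z.1) hij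
  have he' : Function.Injective (Sum.map e e) := he.sumMap he
  refine ⟨MvPolynomial.rename (Sum.map e e) Q, ?_, ?_⟩
  · intro h0
    exact hQ (MvPolynomial.rename_injective _ he' (by simpa using h0))
  · intro φ γ hE
    obtain ⟨y, h1, h2⟩ := H _ _ hE
    rw [MvPolynomial.eval_rename]
    have := hQ' y
    rw [h1, h2] at this
    convert this using 3
    funext i
    rcases i with i | i
    · simp [cf, e, slInf_coeff d φ (Nat.lt_succ_iff.1 i.2)]
    · simp [cf, e, slInf_coeff d γ (Nat.lt_succ_iff.1 i.2)]
end
end Part3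

section Part4
open Polynomial
noncomputable section

section general
variable {R : Type*} [CommRing R]

/-- Taylor coefficient. -/
def tc (f : R[X]) (i : ℕ) (c : R) : R := (taylor c f).coeff i

lemma tc_zero (f : R[X]) (c : R) : tc f 0 c = f.eval c := taylor_coeff_zero ..
lemma tc_one (f : R[X]) (c : R) : tc f 1 c = (derivative f).eval c := taylor_coeff_one ..

lemma pow_dvd_iff_tc (f : R[X]) (c : R) (k : ℕ) :
    (X - C c) ^ k ∣ f ↔ ∀ i < k, tc f i c = 0 := by
  have h1 : (taylorEquiv c) ((X - C c) ^ k) = X ^ k := by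
    show taylor c ((X - C c) ^ k) = X ^ k
    rw [taylor_pow]; simp
  have h2 : (taylorEquiv c) f = taylor c f := rfl
  rw [← map_dvd_iff (taylorEquiv c), h1, X_pow_dvd_iff, h2]; rfl

lemma derivative_taylor' (f : R[X]) (c : R) :
    derivative (taylor c f) = taylor c (derivative f) := by
  rw [taylor_apply, derivative_comp, taylor_apply]; simp

lemma tc_derivative (f : R[X]) (c : R) (i : ℕ) :
    tc (derivative f) i c = tc f (i + 1) c * (i + 1) := by
  rw [tc, ← derivative_taylor', coeff_derivative]; rfl

lemma tc_mul (f g : R[X]) (c : R) (i : ℕ) :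
    tc (f * g) i c = ∑ x ∈ Finset.range (i + 1), tc f x c * tc g (i - x) c := by
  rw [tc, taylor_mul, coeff_mul, Finset.Nat.sum_antidiagonal_eq_sum_range_succ_mk]; rfl

lemma tc_sub (f g : R[X]) (c : R) (i : ℕ) : tc (f - g) i c = tc f i c - tc g i c := by
  simp [tc]
lemma tc_add (f g : R[X]) (c : R) (i : ℕ) : tc (f + g) i c = tc f i c + tc g i c := by
  simp [tc]
lemma tc_C_mul (l : R) (g : R[X]) (c : R) (i : ℕ) : tc (C l * g) i c = l * tc g i c := by
  simp [tc, taylor_mul]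

/-- The two-point determinant. -/
def AA (f g : R[X]) (p q : R) : R := f.eval p * g.eval q - f.eval q * g.eval p
/-- Two-index determinants of Taylor coefficients. -/
def DD (f g : R[X]) (i j : ℕ) (c : R) : R := tc f i c * tc g j c - tc f j c * tc g i c
def EE (f g : R[X]) (c : R) : R := DD f g 0 3 c + DD f g 1 2 c

lemma wr_tc0 (f g : R[X]) (c : R) : tc (wronskian f g) 0 c = DD f g 0 1 c := by
  simp [wronskian, tc_sub, tc_mul, tc_derivative, DD]
lemma wr_tc1 (f g : R[X]) (c : R) : tc (wronskian f g) 1 c = 2 * DD f g 0 2 c := by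
  simp [wronskian, tc_sub, tc_mul, tc_derivative, DD, Finset.sum_range_succ]
  ring
lemma wr_tc2 (f g : R[X]) (c : R) :
    tc (wronskian f g) 2 c = 3 * DD f g 0 3 c + DD f g 1 2 c := by
  simp [wronskian, tc_sub, tc_mul, tc_derivative, DD, Finset.sum_range_succ]
  ring

lemma wr_sub (f g : R[X]) (l : R) : wronskian (f - C l * g) g = wronskian f g := by
  simp [wronskian]; ring

end general

lemma degree_C_mul_le' (l : ℂ) (g : ℂ[X]) : (C l * g).degree ≤ g.degree := by
  rw [← smul_eq_C_mul]; exact degree_smul_le _ _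

lemma degree_cofactor {P n h : ℂ[X]} (hP : P.Monic) (e : h = P * n) {N : ℕ} (hN : h.degree < N) :
    n.degree < ((N - P.natDegree : ℕ) : WithBot ℕ) := by
  rcases eq_or_ne n 0 with rfl | hn
  · simp
  have hh : h ≠ 0 := by rw [e]; exact mul_ne_zero hP.ne_zero hn
  rw [← natDegree_lt_iff_degree_lt hn]
  rw [← natDegree_lt_iff_degree_lt hh, e, hP.natDegree_mul' hn] at hN
  omega

lemma rootProd_monic {k : ℕ} (μ : Fin k → ℕ) (p : Fin k → ℂ) : (rootProd μ p).Monic :=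
  monic_prod_of_monic _ _ fun i _ => (monic_X_sub_C _).pow _

lemma rootProd_natDegree {k : ℕ} (μ : Fin k → ℕ) (p : Fin k → ℂ) :
    (rootProd μ p).natDegree = ∑ i, μ i := by
  rw [rootProd, natDegree_prod_of_monic _ _ fun i _ => (monic_X_sub_C _).pow _]
  simp

lemma cop {p q : ℂ} (h : p ≠ q) (a b : ℕ) : IsCoprime ((X - C p) ^ a) ((X - C q) ^ b) :=
  (isCoprime_X_sub_C_of_isUnit_sub (sub_ne_zero.2 h).isUnit).pow

/-- Genericity conditions on a moving line. -/
structure Mov (d : ℕ) (f g : ℂ[X]) : Prop where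
  df : f.degree < (d + 1 : ℕ)
  dg : g.degree < (d + 1 : ℕ)
  gd : g.coeff d ≠ 0
  L4 : ¬ EvL d ![4] (d - 3) f g
  L32 : 4 ≤ d → ¬ EvL d ![3, 2] (d - 4) f g
  L222 : 5 ≤ d → ¬ EvL d ![2, 2, 2] (d - 5) f g
  L22 : ¬ EvL d ![2] (d - 3) f g
  L03 : ¬ EvL d ![] (d - 2) f g
  B2 : ¬ EvB d 2 ![] (d - 2) f g
  B022 : 4 ≤ d → ¬ EvB d 0 ![2, 2] (d - 4) f g
  B12 : ¬ EvB d 1 ![2] (d - 3) f g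
  B02 : ¬ EvB d 0 ![] (d - 2) f g
  B5 : ¬ EvC ![1, 1] ![1, 1] (d - 1) (d - 1) f g
  B6 : ¬ EvC ![1] ![2] d (d - 1) f g
  G3 : ¬ EvG d ![3] (d - 2) f g
  G22 : ¬ EvG d ![2, 2] (d - 3) f g
  NN : ¬ EvN ![2, 2] (d - 3) f g

structure GInf (d : ℕ) (f g : ℂ[X]) : Prop where
  df : f.degree < (d + 1 : ℕ)
  dg : g.degree < (d + 1 : ℕ)
  gd : g.coeff d ≠ 0
  base : ¬ EvC ![1] ![1] d d f g
  L22 : ¬ EvL d ![2, 2] (d - 3) f g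
  L02 : ¬ EvL d ![] (d - 1) f g
  L3 : ¬ EvL d ![3] (d - 2) f g
  G3 : ¬ EvG d ![3] (d - 2) f g
  G22 : ¬ EvG d ![2, 2] (d - 3) f g

lemma mkL' {d k : ℕ} {μ : Fin k → ℕ} {m N : ℕ} {f g : ℂ[X]}
    (dg : g.degree < (d + 1 : ℕ)) (l : ℂ) (p : Fin k → ℂ)
    (h : rootProd μ p ∣ f - C l * g) (hN : (f - C l * g).degree < (N : ℕ))
    (hm : m = N - ∑ i, μ i) : EvL d μ m f g := by
  obtain ⟨n, hn⟩ := h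
  refine ⟨dg, l, p, n, ?_, by rw [← hn]; ring⟩
  rw [hm, ← rootProd_natDegree μ p]
  exact degree_cofactor (rootProd_monic μ p) hn hN

/-- General mechanism for producing a linear system event. -/
lemma mkL {d k : ℕ} {μ : Fin k → ℕ} {m : ℕ} {f g : ℂ[X]} (df : f.degree < (d + 1 : ℕ))
    (dg : g.degree < (d + 1 : ℕ)) (l : ℂ) (p : Fin k → ℂ)
    (h : rootProd μ p ∣ f - C l * g) (hm : m = d + 1 - ∑ i, μ i) : EvL d μ m f g := by
  refine mkL' dg l p h ?_ hm
  refine (degree_sub_le _ _).trans_lt (max_lt df ?_)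
  exact (degree_C_mul_le' _ _).trans_lt dg

lemma mkG {d k : ℕ} {μ : Fin k → ℕ} {m : ℕ} {f g : ℂ[X]} (df : f.degree < (d + 1 : ℕ))
    (dg : g.degree < (d + 1 : ℕ)) (p : Fin k → ℂ)
    (h : rootProd μ p ∣ g) (hm : m = d + 1 - ∑ i, μ i) : EvG d μ m f g := by
  obtain ⟨n, hn⟩ := h
  refine ⟨df, p, n, ?_, hn⟩
  rw [hm, ← rootProd_natDegree μ p]
  exact degree_cofactor (rootProd_monic μ p) hn dg

lemma mkC {d k : ℕ} {μ ν : Fin k → ℕ} {m m' : ℕ} {f g : ℂ[X]} (df : f.degree < (d + 1 : ℕ))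
    (dg : g.degree < (d + 1 : ℕ)) (p : Fin k → ℂ)
    (hf : rootProd μ p ∣ f) (hg : rootProd ν p ∣ g) (hm : m = d + 1 - ∑ i, μ i)
    (hm' : m' = d + 1 - ∑ i, ν i) : EvC μ ν m m' f g := by
  obtain ⟨n, hn⟩ := hf
  obtain ⟨n', hn'⟩ := hg
  refine ⟨p, n, n', ?_, ?_, hn, hn'⟩
  · rw [hm, ← rootProd_natDegree μ p]
    exact degree_cofactor (rootProd_monic μ p) hn df
  · rw [hm', ← rootProd_natDegree ν p]
    exact degree_cofactor (rootProd_monic ν p) hn' dg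

/-- Base point events: `(X - r)` divides `g`, and `h = f - l g = (X - r)^(e+1) ∏ …`. -/
lemma mkB' {d e k : ℕ} {μ : Fin k → ℕ} {m N : ℕ} {f g : ℂ[X]}
    (dg : g.degree < (d + 1 : ℕ)) (r l : ℂ) (p : Fin k → ℂ) (hg : X - C r ∣ g)
    (h : (X - C r) * ((X - C r) ^ e * rootProd μ p) ∣ f - C l * g)
    (hN : (f - C l * g).degree < (N : ℕ)) (hm : m = N - (1 + (e + ∑ i, μ i))) :
    EvB d e μ m f g := by
  obtain ⟨g', hg'⟩ := hg
  obtain ⟨n, hn⟩ := h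
  refine ⟨r, l, p, g', n, ?_, ?_, hg', ?_⟩
  · have := degree_cofactor (monic_X_sub_C r) hg' dg
    simpa using this
  · have hmon : ((X - C r) ^ e * rootProd μ p).Monic := ((monic_X_sub_C r).pow e).mul (rootProd_monic _ _)
    have := degree_cofactor ((monic_X_sub_C r).mul hmon) hn hN
    rw [(monic_X_sub_C r).natDegree_mul hmon, ((monic_X_sub_C r).pow e).natDegree_mul
        (rootProd_monic _ _), rootProd_natDegree] at this
    simp at this
    rw [hm]
    convert this using 2
  · rw [mul_add]
    have : f = C l * g + (f - C l * g) := by ring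
    rw [this, hn, hg']; ring

lemma mkB {d e k : ℕ} {μ : Fin k → ℕ} {m : ℕ} {f g : ℂ[X]} (df : f.degree < (d + 1 : ℕ))
    (dg : g.degree < (d + 1 : ℕ)) (r l : ℂ) (p : Fin k → ℂ) (hg : X - C r ∣ g)
    (h : (X - C r) * ((X - C r) ^ e * rootProd μ p) ∣ f - C l * g) (hm : m = d - (e + ∑ i, μ i)) :
    EvB d e μ m f g := by
  refine mkB' (N := d + 1) dg r l p hg h ?_ (by omega)
  refine (degree_sub_le _ _).trans_lt (max_lt df ?_)
  exact (degree_C_mul_le' _ _).trans_lt dg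

/-- order 2 contact from the Wronskian. -/
lemma key2 {f g : ℂ[X]} {p : ℂ} (hg : g.eval p ≠ 0) {l : ℂ} (hl : f.eval p = l * g.eval p)
    (hW : (wronskian f g).eval p = 0) : (X - C p) ^ 2 ∣ f - C l * g := by
  rw [pow_dvd_iff_tc]
  have h0 : tc (f - C l * g) 0 p = 0 := by rw [tc_zero]; simp [hl]
  rw [← wr_sub f g l, ← tc_zero, wr_tc0] at hW
  simp only [DD, h0, tc_zero g] at hW
  have h1 : tc (f - C l * g) 1 p = 0 := by simpa [hg] using hW
  intro i hi
  interval_cases i <;> assumption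

lemma key3 {f g : ℂ[X]} {p : ℂ} (hg : g.eval p ≠ 0) {l : ℂ} (hl : f.eval p = l * g.eval p)
    (hW : (X - C p) ^ 2 ∣ wronskian f g) : (X - C p) ^ 3 ∣ f - C l * g := by
  rw [pow_dvd_iff_tc] at hW
  have hW0 := hW 0 (by norm_num)
  have hW1 := hW 1 (by norm_num)
  have := key2 hg hl (by rw [← tc_zero]; exact hW0)
  rw [pow_dvd_iff_tc] at this
  have h0 := this 0 (by norm_num)
  have h1 := this 1 (by norm_num)
  rw [← wr_sub f g l, wr_tc1] at hW1
  simp only [DD, h0, tc_zero g] at hW1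
  have h2 : tc (f - C l * g) 2 p = 0 := by simpa [hg] using hW1
  rw [pow_dvd_iff_tc]
  intro i hi
  interval_cases i <;> assumption

lemma DD_sub (f g : ℂ[X]) (l : ℂ) (i j : ℕ) (c : ℂ) : DD (f - C l * g) g i j c = DD f g i j c := by
  simp only [DD, tc_sub, tc_C_mul]; ring

lemma key4 {f g : ℂ[X]} {p : ℂ} (hg : g.eval p ≠ 0) {l : ℂ} (hl : f.eval p = l * g.eval p)
    (hW : (X - C p) ^ 2 ∣ wronskian f g) (hE : EE f g p = 0) : (X - C p) ^ 4 ∣ f - C l * g := by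
  have := key3 hg hl hW
  rw [pow_dvd_iff_tc] at this
  have h0 := this 0 (by norm_num)
  have h1 := this 1 (by norm_num)
  have h2 := this 2 (by norm_num)
  rw [EE, ← DD_sub f g l, ← DD_sub f g l] at hE
  simp only [DD, h0, h1, h2, tc_zero g] at hE
  have h2 : tc (f - C l * g) 3 p = 0 := by simpa [hg] using hE
  rw [pow_dvd_iff_tc]
  intro i hi
  interval_cases i <;> assumption
end
end Part4

section Part5
open Polynomial
noncomputable section

section wr
variable {L : Type*} [Field L] [CharZero L] {d : ℕ}

lemma wr_natDegree {f g : L[X]} (hd : 3 ≤ d) (df : f.natDegree ≤ d) (dg : g.natDegree ≤ d)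
    (gd : g.coeff d ≠ 0) : (wronskian f g).natDegree ≤ 2 * d - 2 ∧
      (wronskian f g).coeff (2 * d - 2) = f.coeff (d - 1) * g.coeff d - f.coeff d * g.coeff (d - 1) ∧
      ∃ l, l * g.coeff d = f.coeff d ∧ (f - C l * g).natDegree ≤ d - 1 ∧
      ((wronskian f g).coeff (2 * d - 2) = 0 → (f - C l * g).natDegree ≤ d - 2 ∧
        (wronskian f g).coeff (2 * d - 3) = 2 * (f - C l * g).coeff (d - 2) * g.coeff d) := by
  set l := f.coeff d / g.coeff d with hl
  have hl' : l * g.coeff d = f.coeff d := by rw [hl]; field_simp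
  set h := f - C l * g with hh
  have h1 : h.natDegree ≤ d - 1 := by
    rw [natDegree_le_iff_coeff_eq_zero]
    intro n hn
    rcases (show n = d ∨ d < n by omega) with rfl | hn
    · simp [hh, hl']
    · simp [hh, coeff_eq_zero_of_natDegree_lt (df.trans_lt hn),
        coeff_eq_zero_of_natDegree_lt (dg.trans_lt hn)]
  have hW : wronskian f g = wronskian h g := (wr_sub f g l).symm
  have dg' : (derivative g).natDegree ≤ d - 1 := (natDegree_derivative_le g).trans (by omega)
  have dh' : (derivative h).natDegree ≤ d - 2 := (natDegree_derivative_le h).trans (by omega)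
  have hc : (wronskian f g).coeff (2 * d - 2) = h.coeff (d - 1) * g.coeff d := by
    rw [hW, wronskian, coeff_sub]
    conv_lhs => rw [show 2 * d - 2 = (d - 1) + (d - 1) by omega]
    rw [coeff_mul_add_eq_of_natDegree_le h1 dg', show d - 1 + (d - 1) = (d - 2) + d by omega,
      coeff_mul_add_eq_of_natDegree_le dh' dg, coeff_derivative, coeff_derivative]
    have e1 : ((d - 1 : ℕ) : L) = d - 1 := by rw [Nat.cast_sub (by omega)]; simp
    have e2 : ((d - 2 : ℕ) : L) = d - 2 := by rw [Nat.cast_sub (by omega)]; simp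
    rw [show d - 1 + 1 = d by omega, show d - 2 + 1 = d - 1 by omega, e1, e2]; ring
  refine ⟨?_, ?_, l, hl', h1, ?_⟩
  · rw [hW, wronskian]
    refine (natDegree_sub_le _ _).trans (max_le ?_ ?_)
    · exact natDegree_mul_le.trans (by omega)
    · exact natDegree_mul_le.trans (by omega)
  · rw [hc, hh, ← hl']; simp; ring
  · intro h0
    have h2 : h.natDegree ≤ d - 2 := by
      rw [natDegree_le_iff_coeff_eq_zero]
      intro n hn
      rcases (show n = d - 1 ∨ d - 1 < n by omega) with rfl | hn
      · rw [hc] at h0; simpa [gd] using h0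
      · exact coeff_eq_zero_of_natDegree_lt (h1.trans_lt hn)
    refine ⟨h2, ?_⟩
    have dh'' : (derivative h).natDegree ≤ d - 3 := (natDegree_derivative_le h).trans (by omega)
    rw [hW, wronskian, coeff_sub]
    conv_lhs => rw [show 2 * d - 3 = (d - 2) + (d - 1) by omega]
    rw [coeff_mul_add_eq_of_natDegree_le h2 dg', show d - 2 + (d - 1) = (d - 3) + d by omega,
      coeff_mul_add_eq_of_natDegree_le dh'' dg, coeff_derivative, coeff_derivative]
    have e1 : ((d - 1 : ℕ) : L) = d - 1 := by rw [Nat.cast_sub (by omega)]; simp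
    have e2 : ((d - 3 : ℕ) : L) = d - 3 := by rw [Nat.cast_sub (by omega)]; simp
    rw [show d - 1 + 1 = d by omega, show d - 3 + 1 = d - 2 by omega, e1, e2]; ring
end wr

def IsNode (f g : ℂ[X]) : Prop :=
  ∃ l p q : ℂ, p ≠ q ∧ (X - C p) ^ 2 * (X - C q) ^ 2 ∣ f - C l * g

def IsBase (f g : ℂ[X]) (r : ℂ) : Prop := f.eval r = 0 ∧ g.eval r = 0

structure LocC (d : ℕ) (f g : ℂ[X]) : Prop where
  gd : g.coeff d ≠ 0
  df : f.natDegree ≤ d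
  dg : g.natDegree ≤ d
  deg : 2 * d - 3 ≤ (wronskian f g).natDegree
  W0 : wronskian f g ≠ 0
  R3 : ∀ z, (X - C z) ^ 2 ∣ wronskian f g → EE f g z ≠ 0
  R4 : (wronskian f g).coeff (2 * d - 2) = 0 → ∀ z, (wronskian f g).eval z = 0 →
    f.coeff d * g.eval z - g.coeff d * f.eval z ≠ 0

/-- Data at a node. -/
structure LocN (f g f1 g1 : ℂ[X]) (l p q : ℂ) : Prop where
  ne : p ≠ q
  dvd : (X - C p) ^ 2 * (X - C q) ^ 2 ∣ f - C l * g
  nb : ∀ r, ¬ IsBase f g r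
  Wp : (wronskian f g).eval p = 0
  Wq : (wronskian f g).eval q = 0
  sp : ¬ (X - C p) ^ 2 ∣ wronskian f g
  sq : ¬ (X - C q) ^ 2 ∣ wronskian f g
  other : ∀ p' q', p' ≠ q' → (wronskian f g).eval p' = 0 → (wronskian f g).eval q' = 0 →
    AA f g p' q' = 0 → (p' = p ∧ q' = q) ∨ (p' = q ∧ q' = p)
  h1 : AA (f1 - C l * g1) g p q ≠ 0

structure LocB (d : ℕ) (f g f1 g1 : ℂ[X]) (r : ℂ) : Prop where
  base : IsBase f g r
  uniq : ∀ r', IsBase f g r' → r' = r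
  gt : tc g 1 r ≠ 0
  dvd : (X - C r) ^ 2 ∣ wronskian f g
  ndvd : ¬ (X - C r) ^ 3 ∣ wronskian f g
  deg : (wronskian f g).coeff (2 * d - 2) ≠ 0
  z : ∀ z, z ≠ r → (wronskian f g).eval z = 0 → tc f 1 r * g.eval z - f.eval z * tc g 1 r ≠ 0
  other : ∀ p q, p ≠ q → p ≠ r → q ≠ r → (wronskian f g).eval p = 0 → (wronskian f g).eval q = 0 →
    AA f g p q ≠ 0
  J : f1.eval r * tc g 1 r - tc f 1 r * g1.eval r ≠ 0

lemma natDegree_le_of_degree_lt {f : ℂ[X]} {d : ℕ} (h : f.degree < (d + 1 : ℕ)) :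
    f.natDegree ≤ d := by
  rcases eq_or_ne f 0 with rfl | hf
  · simp
  · have := (natDegree_lt_iff_degree_lt hf).2 h; omega

lemma degree_lt_of_natDegree_le {f : ℂ[X]} {d : ℕ} (h : f.natDegree ≤ d) :
    f.degree < (d + 1 : ℕ) := by
  refine degree_le_natDegree.trans_lt ?_
  exact_mod_cast Nat.lt_succ_of_le h

section
variable {d : ℕ} {f g : ℂ[X]}

lemma rp22 (p q : ℂ) : rootProd ![2, 2] ![p, q] = (X - C p) ^ 2 * (X - C q) ^ 2 := by
  simp [rootProd, Fin.prod_univ_two]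

lemma A_zero (df : f.degree < (d + 1 : ℕ)) (dg : g.degree < (d + 1 : ℕ))
    (G22 : ¬ EvG d ![2, 2] (d - 3) f g) {p q : ℂ} (hpq : p ≠ q) (hp : (wronskian f g).eval p = 0)
    (hq : (wronskian f g).eval q = 0) (hA : AA f g p q = 0) (bp : ¬ IsBase f g p)
    (bq : ¬ IsBase f g q) : ∃ l, (X - C p) ^ 2 * (X - C q) ^ 2 ∣ f - C l * g := by
  have W1 : ∀ z, g.eval z = 0 → f.eval z ≠ 0 → (wronskian f g).eval z = 0 → (X - C z) ^ 2 ∣ g := by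
    intro z h1 h2 h3
    rw [pow_dvd_iff_tc]
    have h4 : tc g 1 z = 0 := by
      rw [← tc_zero, wr_tc0, DD, tc_zero g, h1, tc_zero f] at h3
      simpa [h2] using h3
    rw [← tc_zero] at h1
    intro i hi
    interval_cases i <;> assumption
  by_cases gp : g.eval p = 0
  · have fp : f.eval p ≠ 0 := fun h => bp ⟨h, gp⟩
    have gq : g.eval q = 0 := by
      rw [AA, gp] at hA; simpa [fp] using hA
    have fq : f.eval q ≠ 0 := fun h => bq ⟨h, gq⟩
    refine (G22 (mkG df dg ![p, q] ?_ (by simp))).elim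
    rw [rp22]
    exact (cop hpq 2 2).mul_dvd (W1 p gp fp hp) (W1 q gq fq hq)
  · by_cases gq : g.eval q = 0
    · have : f.eval q = 0 := by rw [AA, gq] at hA; simpa [gp] using hA
      exact (bq ⟨this, gq⟩).elim
    refine ⟨f.eval p / g.eval p, (cop hpq 2 2).mul_dvd (key2 gp (by field_simp) hp)
      (key2 gq ?_ hq)⟩
    rw [AA] at hA
    field_simp
    linear_combination -hA

namespace Mov
variable (hd : 3 ≤ d) (M : Mov d f g)
include M

lemma h_ne (l : ℂ) : f - C l * g ≠ 0 := fun h =>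
  M.L03 (mkL' (N := d - 2) M.dg l ![] (by rw [h]; exact dvd_zero _) (by rw [h]; simp) (by simp))

lemma hdeg (l : ℂ) : (f - C l * g).degree < (d + 1 : ℕ) :=
  (degree_sub_le _ _).trans_lt (max_lt M.df ((degree_C_mul_le' _ _).trans_lt M.dg))

lemma deg_pos {l : ℂ} {P : ℂ[X]} (h : P ∣ f - C l * g) : P.natDegree ≤ d :=
  (natDegree_le_of_dvd h (M.h_ne l)).trans (natDegree_le_of_degree_lt (M.hdeg l))

lemma node_deg {l p q : ℂ} (h : (X - C p) ^ 2 * (X - C q) ^ 2 ∣ f - C l * g) : 4 ≤ d := by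
  have := M.deg_pos h
  rwa [← rp22, rootProd_natDegree] at this

lemma base_gt {r : ℂ} (h : IsBase f g r) : tc g 1 r ≠ 0 := by
  intro h1
  refine M.B6 (mkC M.df M.dg ![r] ?_ ?_ (by simp) (by simp))
  · simpa [rootProd, dvd_iff_isRoot] using h.1
  · simp only [rootProd, Fin.prod_univ_one, Fin.isValue, Matrix.cons_val_fin_one]
    rw [pow_dvd_iff_tc]
    intro i hi
    interval_cases i
    · rw [tc_zero]; exact h.2
    · exact h1

lemma base_uniq {r r' : ℂ} (h : IsBase f g r) (h' : IsBase f g r') : r' = r := by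
  by_contra hne
  refine M.B5 (mkC M.df M.dg ![r', r] ?_ ?_ (by simp) (by simp))
  · simp only [rootProd, Fin.prod_univ_two, Fin.isValue, Matrix.cons_val_zero,
      Matrix.cons_val_one]
    exact (cop hne 1 1).mul_dvd (by simpa [dvd_iff_isRoot] using h'.1)
      (by simpa [dvd_iff_isRoot] using h.1)
  · simp only [rootProd, Fin.prod_univ_two, Fin.isValue, Matrix.cons_val_zero,
      Matrix.cons_val_one]
    exact (cop hne 1 1).mul_dvd (by simpa [dvd_iff_isRoot] using h'.2)
      (by simpa [dvd_iff_isRoot] using h.2)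

lemma base_not_node {r l p q : ℂ} (hb : IsBase f g r) (hpq : p ≠ q)
    (h : (X - C p) ^ 2 * (X - C q) ^ 2 ∣ f - C l * g) : False := by
  have hg : X - C r ∣ g := dvd_iff_isRoot.2 hb.2
  have h4 := M.node_deg h
  have aux : ∀ p q : ℂ, p ≠ q → (X - C p) ^ 2 * (X - C q) ^ 2 ∣ f - C l * g → r = p → False := by
    rintro p q hpq h rfl
    refine M.B12 (mkB M.df M.dg r l ![q] hg ?_ (by simp))
    convert h using 1
    simp [rootProd]; ring
  by_cases h1 : r = p
  · exact aux p q hpq h h1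
  by_cases h2 : r = q
  · exact aux q p hpq.symm (by rwa [mul_comm]) h2
  refine M.B022 h4 (mkB M.df M.dg r l ![p, q] hg ?_ (by simp))
  have hr : X - C r ∣ f - C l * g := by
    rw [dvd_iff_isRoot]; simp [hb.1, hb.2]
  have c1 : IsCoprime (X - C r) ((X - C p) ^ 2 * (X - C q) ^ 2) := by
    have := (cop h1 1 2).mul_right (cop h2 1 2); simpa using this
  rw [pow_zero, one_mul, rp22]
  exact c1.mul_dvd hr h

lemma EE_ne {z : ℂ} (h : (X - C z) ^ 2 ∣ wronskian f g) : EE f g z ≠ 0 := by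
  intro hE
  by_cases hb : IsBase f g z
  · have g1 := M.base_gt hb
    set l := tc f 1 z / tc g 1 z with hl
    have f0 : tc f 0 z = 0 := by rw [tc_zero]; exact hb.1
    have g0 : tc g 0 z = 0 := by rw [tc_zero]; exact hb.2
    refine M.B2 (mkB M.df M.dg z l ![] (dvd_iff_isRoot.2 hb.2) ?_ (by simp))
    have : (X - C z) ^ 3 ∣ f - C l * g := by
      have h0 : tc (f - C l * g) 0 z = 0 := by simp [tc_sub, tc_C_mul, f0, g0]
      have h1 : tc (f - C l * g) 1 z = 0 := by
        simp [tc_sub, tc_C_mul, hl]; field_simp; simp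
      have h2 : tc (f - C l * g) 2 z = 0 := by
        rw [EE, ← DD_sub f g l, ← DD_sub f g l, DD, DD, h0, h1, g0] at hE
        simpa [g1] using hE
      rw [pow_dvd_iff_tc]
      intro i hi
      interval_cases i <;> assumption
    convert this using 1
    simp [rootProd]; ring
  by_cases gz : g.eval z = 0
  · have fz : f.eval z ≠ 0 := fun h => hb ⟨h, gz⟩
    rw [pow_dvd_iff_tc] at h
    have e0 := h 0 (by norm_num)
    have e1 := h 1 (by norm_num)
    rw [wr_tc0, DD, tc_zero g, gz, tc_zero f] at e0
    rw [wr_tc1, DD, tc_zero g, gz, tc_zero f] at e1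
    have g1 : tc g 1 z = 0 := by simpa [fz] using e0
    have g2 : tc g 2 z = 0 := by simpa [fz] using e1
    rw [← tc_zero] at gz
    refine M.G3 (mkG M.df M.dg ![z] ?_ (by simp))
    simp only [rootProd, Fin.prod_univ_one, Fin.isValue, Matrix.cons_val_fin_one]
    rw [pow_dvd_iff_tc]
    intro i hi
    interval_cases i <;> assumption
  · refine M.L4 (mkL M.df M.dg (f.eval z / g.eval z) ![z] ?_ (by simp))
    simp only [rootProd, Fin.prod_univ_one, Fin.isValue, Matrix.cons_val_fin_one]
    exact key4 gz (by field_simp) h hE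

include hd in
lemma base_deg {r : ℂ} (hb : IsBase f g r) : (wronskian f g).coeff (2 * d - 2) ≠ 0 := by
  intro h0
  obtain ⟨-, -, l, hl, -, h2⟩ := wr_natDegree hd (natDegree_le_of_degree_lt M.df)
    (natDegree_le_of_degree_lt M.dg) M.gd
  obtain ⟨h2, -⟩ := h2 h0
  refine M.B02 (mkB' (N := d - 1) M.dg r l ![] (dvd_iff_isRoot.2 hb.2) ?_ ?_ (by simp; omega))
  · simp only [rootProd]
    simp [dvd_iff_isRoot, hb.1, hb.2]
  · have := degree_lt_of_natDegree_le h2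
    rwa [show d - 2 + 1 = d - 1 by omega] at this

include hd in
lemma locC : LocC d f g := by
  have df := natDegree_le_of_degree_lt M.df
  have dg := natDegree_le_of_degree_lt M.dg
  obtain ⟨-, -, l, hl, -, h2⟩ := wr_natDegree hd df dg M.gd
  have key : 2 * d - 3 ≤ (wronskian f g).natDegree := by
    by_cases h0 : (wronskian f g).coeff (2 * d - 2) = 0
    · obtain ⟨h2, h3⟩ := h2 h0
      refine le_natDegree_of_ne_zero ?_
      rw [h3]
      refine mul_ne_zero (mul_ne_zero two_ne_zero ?_) M.gd
      intro h4
      refine M.L03 (mkL' (N := d - 2) M.dg l ![] (by simp [rootProd]) ?_ (by simp))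
      have : (f - C l * g).natDegree ≤ d - 3 := by
        rw [natDegree_le_iff_coeff_eq_zero]
        intro n hn
        rcases (show n = d - 2 ∨ d - 2 < n by omega) with rfl | hn
        · exact h4
        · exact coeff_eq_zero_of_natDegree_lt (h2.trans_lt hn)
      have := degree_lt_of_natDegree_le this
      rwa [show d - 3 + 1 = d - 2 by omega] at this
    · exact le_trans (by omega) (le_natDegree_of_ne_zero h0)
  refine ⟨M.gd, df, dg, key, ?_, fun z hz => M.EE_ne hz, ?_⟩
  · intro h; rw [h] at key; simp at key; omega
  · intro h0 z hz hA
    obtain ⟨h2, -⟩ := h2 h0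
    have e : f.eval z = l * g.eval z := by
      have : g.coeff d * (l * g.eval z - f.eval z) = 0 := by
        linear_combination hA + g.eval z * hl
      have := (mul_eq_zero.1 this).resolve_left M.gd
      linear_combination -this
    by_cases gz : g.eval z = 0
    · exact M.base_deg hd (r := z) ⟨by rw [e, gz, mul_zero], gz⟩ h0
    refine M.L22 (mkL' (N := d - 1) M.dg l ![z] ?_ ?_ (by simp; omega))
    · simp only [rootProd, Fin.prod_univ_one, Fin.isValue, Matrix.cons_val_fin_one]
      exact key2 gz e hz
    · have := degree_lt_of_natDegree_le h2
      rwa [show d - 2 + 1 = d - 1 by omega] at this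
end Mov
end
end
end Part5

section Part6
open Polynomial
noncomputable section
section
variable {d : ℕ} {f g : ℂ[X]}

lemma wr_dvd_of_sq {l p : ℂ} (h : (X - C p) ^ 2 ∣ f - C l * g) : (wronskian f g).eval p = 0 := by
  rw [pow_dvd_iff_tc] at h
  rw [← wr_sub f g l, ← tc_zero, wr_tc0, DD, h 0 (by norm_num), h 1 (by norm_num)]; simp

lemma eval_of_dvd {l p : ℂ} {n : ℕ} (hn : n ≠ 0) (h : (X - C p) ^ n ∣ f - C l * g) :
    f.eval p = l * g.eval p := by
  have := (dvd_pow_self _ hn).trans h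
  rw [dvd_iff_isRoot] at this
  simp at this
  linear_combination this

namespace Mov
variable (hd : 3 ≤ d) (M : Mov d f g)
include M

lemma n_deg {l p q : ℂ} {n : ℂ[X]} (h : f - C l * g = (X - C p) ^ 2 * (X - C q) ^ 2 * n) :
    n.degree < (d - 3 : ℕ) := by
  rw [← rp22] at h
  have := degree_cofactor (rootProd_monic _ _) h (M.hdeg l)
  rw [rootProd_natDegree] at this
  have e : d + 1 - ∑ i, (![2, 2] : Fin 2 → ℕ) i = d - 3 := by simp
  rwa [e] at this

lemma node_sp {l p q : ℂ} (hpq : p ≠ q) (h : (X - C p) ^ 2 * (X - C q) ^ 2 ∣ f - C l * g) :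
    ¬ (X - C p) ^ 2 ∣ wronskian f g := by
  intro hW
  have e := eval_of_dvd (p := p) two_ne_zero ((dvd_mul_right _ _).trans h)
  have gp : g.eval p ≠ 0 := fun gp => M.base_not_node (r := p) ⟨by rw [e, gp, mul_zero], gp⟩ hpq h
  have := (cop hpq 3 2).mul_dvd (key3 gp e hW) ((dvd_mul_left _ _).trans h)
  refine M.L32 (M.node_deg h) (mkL M.df M.dg l ![p, q] ?_ (by simp))
  simpa [rootProd, Fin.prod_univ_two] using this

lemma node_three {l p q r : ℂ} (hpq : p ≠ q) (hpr : p ≠ r) (hqr : q ≠ r)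
    (h : (X - C p) ^ 2 * (X - C q) ^ 2 ∣ f - C l * g) (h2 : (X - C r) ^ 2 ∣ f - C l * g) : False := by
  have h3 : (X - C p) ^ 2 * (X - C q) ^ 2 * (X - C r) ^ 2 ∣ f - C l * g :=
    ((cop hpr 2 2).mul_left (cop hqr 2 2)).mul_dvd h h2
  have h4 : rootProd ![2, 2, 2] ![p, q, r] ∣ f - C l * g := by
    simpa [rootProd, Fin.prod_univ_three] using h3
  have h5 := M.deg_pos h4
  rw [rootProd_natDegree] at h5
  simp [Fin.sum_univ_three] at h5
  exact M.L222 (by omega) (mkL M.df M.dg l _ h4 (by simp [Fin.sum_univ_three]))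

lemma node_h1 {f1 g1 : ℂ[X]} (df1 : f1.degree < d) (dg1 : g1.degree < d)
    (T : ¬ EvTN d f g f1 g1) {l p q : ℂ} (hpq : p ≠ q) (gp : g.eval p ≠ 0)
    (h : (X - C p) ^ 2 * (X - C q) ^ 2 ∣ f - C l * g) : AA (f1 - C l * g1) g p q ≠ 0 := by
  have hd4 := M.node_deg h
  intro hA
  set h1 := f1 - C l * g1 with hh1
  set ρ := h1.eval p / g.eval p with hρ
  have e1 : h1.eval p = ρ * g.eval p := by rw [hρ]; field_simp
  have e2 : h1.eval q = ρ * g.eval q := by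
    rw [AA, e1] at hA
    have : g.eval p * (ρ * g.eval q - h1.eval q) = 0 := by linear_combination hA
    have := (mul_eq_zero.1 this).resolve_left gp
    linear_combination -this
  set m := (X - C p) * (X - C q) with hm
  have mm : m.Monic := (monic_X_sub_C p).mul (monic_X_sub_C q)
  have md : m.natDegree = 2 := by
    rw [hm, (monic_X_sub_C p).natDegree_mul (monic_X_sub_C q)]; simp
  set R := h1 - C ρ * (g - C (g.coeff d) * X ^ (d - 2) * m) with hR
  have hdvd : m ∣ R := by
    have := (cop hpq 1 1).mul_dvd (z := R) (by simp [dvd_iff_isRoot, hR, hm, e1])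
      (by simp [dvd_iff_isRoot, hR, hm, e2])
    simpa using this
  have hdeg : R.degree < d := by
    have k1 : h1.degree < d := (degree_sub_le _ _).trans_lt
      (max_lt df1 ((degree_C_mul_le' _ _).trans_lt dg1))
    have k2 : (g - C (g.coeff d) * X ^ (d - 2) * m).degree < ((d : ℕ) : WithBot ℕ) := by
      have n1 : (g - C (g.coeff d) * X ^ (d - 2) * m).natDegree ≤ d - 1 := by
        rw [natDegree_le_iff_coeff_eq_zero]
        intro n hn
        rw [mul_assoc, coeff_sub, coeff_C_mul]
        rcases (show n = d ∨ d < n by omega) with rfl | hn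
        · have : (X ^ (n - 2) * m).coeff n = 1 := by
            conv_lhs => rw [show n = 2 + (n - 2) by omega]
            rw [show 2 + (n - 2) - 2 = n - 2 by omega, coeff_X_pow_mul, ← md]
            exact mm.coeff_natDegree
          rw [this]; simp
        · have : (X ^ (d - 2) * m).coeff n = 0 := by
            apply coeff_eq_zero_of_natDegree_lt
            refine natDegree_mul_le.trans_lt ?_
            rw [md, natDegree_X_pow]; omega
          rw [this, coeff_eq_zero_of_natDegree_lt
            ((natDegree_le_of_degree_lt M.dg).trans_lt hn)]; simp
      have := degree_lt_of_natDegree_le n1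
      rwa [show d - 1 + 1 = d by omega] at this
    exact (degree_sub_le _ _).trans_lt (max_lt k1 ((degree_C_mul_le' _ _).trans_lt k2))
  obtain ⟨n1, hn1⟩ := hdvd
  obtain ⟨n, hn⟩ := h
  refine T ⟨M.dg, dg1, l, ρ, p, q, n, n1, ?_, ?_, ?_, ?_⟩
  · exact M.n_deg hn
  · have := degree_cofactor mm hn1 hdeg
    rwa [md] at this
  · rw [mul_pow, ← hn]; ring
  · rw [← hm, ← hn1, hR, hh1]; ring

lemma locN {f1 g1 : ℂ[X]} (df1 : f1.degree < d) (dg1 : g1.degree < d)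
    (T : ¬ EvTN d f g f1 g1) {l p q : ℂ} (hpq : p ≠ q)
    (h : (X - C p) ^ 2 * (X - C q) ^ 2 ∣ f - C l * g) : LocN f g f1 g1 l p q := by
  have hd4 := M.node_deg h
  have hp : (X - C p) ^ 2 ∣ f - C l * g := (dvd_mul_right _ _).trans h
  have hq : (X - C q) ^ 2 ∣ f - C l * g := (dvd_mul_left _ _).trans h
  have h' : (X - C q) ^ 2 * (X - C p) ^ 2 ∣ f - C l * g :=
    by rw [mul_comm ((X - C q) ^ 2)]; exact h
  have ep := eval_of_dvd two_ne_zero hp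
  have eq := eval_of_dvd two_ne_zero hq
  have gp : g.eval p ≠ 0 := fun gp => M.base_not_node (r := p) ⟨by rw [ep, gp, mul_zero], gp⟩ hpq h
  have gq : g.eval q ≠ 0 := fun gq => M.base_not_node (r := q) ⟨by rw [eq, gq, mul_zero], gq⟩ hpq h
  refine ⟨hpq, h, fun r hr => M.base_not_node hr hpq h, wr_dvd_of_sq hp, wr_dvd_of_sq hq,
    M.node_sp hpq h, M.node_sp hpq.symm h', ?_, ?_⟩
  · intro p' q' hpq' hp' hq' hA
    obtain ⟨l', hl'⟩ := A_zero M.df M.dg M.G22 hpq' hp' hq' hA (fun hr => M.base_not_node hr hpq h)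
      (fun hr => M.base_not_node hr hpq h)
    by_cases hll : l' = l
    · subst hll
      have a1 : (X - C p') ^ 2 ∣ f - C l' * g := (dvd_mul_right _ _).trans hl'
      have a2 : (X - C q') ^ 2 ∣ f - C l' * g := (dvd_mul_left _ _).trans hl'
      have b1 : p' = p ∨ p' = q := by
        by_contra hc
        push Not at hc
        exact M.node_three hpq hc.1.symm hc.2.symm h a1
      have b2 : q' = p ∨ q' = q := by
        by_contra hc
        push Not at hc
        exact M.node_three hpq hc.1.symm hc.2.symm h a2
      rcases b1 with b1 | b1 <;> rcases b2 with b2 | b2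
      · exact (hpq' (b1.trans b2.symm)).elim
      · exact .inl ⟨b1, b2⟩
      · exact .inr ⟨b1, b2⟩
      · exact (hpq' (b1.trans b2.symm)).elim
    · exfalso
      obtain ⟨n, hn⟩ := h
      obtain ⟨n', hn'⟩ := hl'
      have hs : l' - l ≠ 0 := sub_ne_zero.2 hll
      refine M.NN ⟨(l' - l)⁻¹, l, ![p, q], ![p', q'], n, n', M.n_deg hn, M.n_deg hn', ?_,
        by rw [rp22, ← hn]; ring⟩
      · rw [rp22, rp22, ← hn, ← hn']
        have : f - C l * g - (f - C l' * g) = C (l' - l) * g := by rw [C_sub]; ring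
        rw [this, ← mul_assoc, ← C_mul, inv_mul_cancel₀ hs]; simp
  · exact M.node_h1 df1 dg1 T hpq gp h

include hd in
lemma locB {f1 g1 : ℂ[X]} (df1 : f1.degree < d) (dg1 : g1.degree < d)
    (T : ¬ EvTB d f g f1 g1) {r : ℂ} (hb : IsBase f g r) : LocB d f g f1 g1 r := by
  have g1ne := M.base_gt hb
  have f0 : tc f 0 r = 0 := by rw [tc_zero]; exact hb.1
  have g0 : tc g 0 r = 0 := by rw [tc_zero]; exact hb.2
  have hdvd : (X - C r) ^ 2 ∣ wronskian f g := by
    rw [pow_dvd_iff_tc]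
    intro i hi
    interval_cases i
    · rw [wr_tc0]; simp [DD, f0, g0]
    · rw [wr_tc1]; simp [DD, f0, g0]
  set l := tc f 1 r / tc g 1 r with hl
  have el : tc f 1 r = l * tc g 1 r := by rw [hl]; field_simp
  have hr2 : (X - C r) ^ 2 ∣ f - C l * g := by
    rw [pow_dvd_iff_tc]
    intro i hi
    interval_cases i
    · simp [tc_sub, tc_C_mul, f0, g0]
    · simp [tc_sub, tc_C_mul, el]
  have hg : X - C r ∣ g := dvd_iff_isRoot.2 hb.2
  refine ⟨hb, fun r' h => M.base_uniq hb h, g1ne, hdvd, ?_, M.base_deg hd hb, ?_, ?_, ?_⟩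
  · intro h3
    apply M.EE_ne hdvd
    rw [pow_dvd_iff_tc] at h3
    have := h3 2 (by norm_num)
    rw [wr_tc2] at this
    have h4 : DD f g 0 3 r = 0 := by simp [DD, f0, g0]
    rw [EE]; rw [h4] at this ⊢
    linear_combination this
  · intro z hz hW hc
    have gz : g.eval z ≠ 0 := by
      intro gz
      refine hz (M.base_uniq hb ⟨?_, gz⟩)
      rw [gz] at hc
      simpa [g1ne] using hc
    have e : f.eval z = l * g.eval z := by
      have : tc g 1 r * (l * g.eval z - f.eval z) = 0 := by
        rw [el] at hc; linear_combination hc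
      have := (mul_eq_zero.1 this).resolve_left g1ne
      linear_combination -this
    refine M.B12 (mkB M.df M.dg r l ![z] hg ?_ (by simp))
    have := (cop hz.symm 2 2).mul_dvd hr2 (key2 gz e hW)
    convert this using 1
    simp [rootProd]; ring
  · intro p q hpq hp hq Wp Wq hA
    obtain ⟨l', hl'⟩ := A_zero M.df M.dg M.G22 hpq Wp Wq hA (fun h => hp (M.base_uniq hb h))
      (fun h => hq (M.base_uniq hb h))
    exact M.base_not_node hb hpq hl'
  · intro hJ
    have hh : X - C r ∣ f1 - C l * g1 := by
      rw [dvd_iff_isRoot]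
      have : tc g 1 r * (f1.eval r - l * g1.eval r) = 0 := by rw [el] at hJ; linear_combination hJ
      have := (mul_eq_zero.1 this).resolve_left g1ne
      simpa using this
    obtain ⟨n1, hn1⟩ := hh
    obtain ⟨g', hg'⟩ := hg
    obtain ⟨n, hn⟩ := hr2
    have k1 : (f1 - C l * g1).degree < d := (degree_sub_le _ _).trans_lt
        (max_lt df1 ((degree_C_mul_le' _ _).trans_lt dg1))
    refine T ⟨dg1, r, l, g', n, n1, ?_, ?_, ?_, hg', ?_, by rw [← hn1]; ring⟩
    · simpa using degree_cofactor (monic_X_sub_C r) hg' M.dg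
    · have := degree_cofactor ((monic_X_sub_C r).pow 2) hn (M.hdeg l)
      simpa using this
    · simpa using degree_cofactor (monic_X_sub_C r) hn1 k1
    · have : f = C l * g + (f - C l * g) := by ring
      rw [this, hn]
      conv_lhs => rw [hg']
      ring

lemma regular (hn : ¬ IsNode f g) (hb : ∀ r, ¬ IsBase f g r) {p q : ℂ} (hpq : p ≠ q)
    (Wp : (wronskian f g).eval p = 0) (Wq : (wronskian f g).eval q = 0) : AA f g p q ≠ 0 := by
  intro hA
  obtain ⟨l', hl'⟩ := A_zero M.df M.dg M.G22 hpq Wp Wq hA (hb p) (hb q)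
  exact hn ⟨l', p, q, hpq, hl'⟩
end Mov

/-- Conditions at the line at infinity. -/
structure LocI (d : ℕ) (f g : ℂ[X]) : Prop where
  gd : g.coeff d ≠ 0
  df : f.natDegree ≤ d
  dg : g.natDegree ≤ d
  lc : (wronskian f g).coeff (2 * d - 2) ≠ 0
  simple : ∀ z, ¬ (X - C z) ^ 2 ∣ wronskian f g
  nb : ∀ r, ¬ IsBase f g r
  A : ∀ p q, p ≠ q → (wronskian f g).eval p = 0 → (wronskian f g).eval q = 0 → AA f g p q ≠ 0

lemma GInf.locI (hd : 3 ≤ d) (M : GInf d f g) : LocI d f g := by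
  have df := natDegree_le_of_degree_lt M.df
  have dg := natDegree_le_of_degree_lt M.dg
  have nb : ∀ r, ¬ IsBase f g r := by
    intro r hr
    refine M.base (mkC M.df M.dg ![r] ?_ ?_ (by simp) (by simp))
    · simpa [rootProd, dvd_iff_isRoot] using hr.1
    · simpa [rootProd, dvd_iff_isRoot] using hr.2
  refine ⟨M.gd, df, dg, ?_, ?_, nb, ?_⟩
  · intro h0
    obtain ⟨-, -, l, hl, -, h2⟩ := wr_natDegree hd df dg M.gd
    obtain ⟨h2, -⟩ := h2 h0
    refine M.L02 (mkL' (N := d - 1) M.dg l ![] (by simp [rootProd]) ?_ (by simp))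
    have := degree_lt_of_natDegree_le h2
    rwa [show d - 2 + 1 = d - 1 by omega] at this
  · intro z h
    by_cases gz : g.eval z = 0
    · have fz : f.eval z ≠ 0 := fun h => nb z ⟨h, gz⟩
      rw [pow_dvd_iff_tc] at h
      have e0 := h 0 (by norm_num)
      have e1 := h 1 (by norm_num)
      rw [wr_tc0, DD, tc_zero g, gz, tc_zero f] at e0
      rw [wr_tc1, DD, tc_zero g, gz, tc_zero f] at e1
      have g1 : tc g 1 z = 0 := by simpa [fz] using e0
      have g2 : tc g 2 z = 0 := by simpa [fz] using e1
      rw [← tc_zero] at gz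
      refine M.G3 (mkG M.df M.dg ![z] ?_ (by simp))
      simp only [rootProd, Fin.prod_univ_one, Matrix.cons_val_fin_one]
      rw [pow_dvd_iff_tc]
      intro i hi
      interval_cases i <;> assumption
    · refine M.L3 (mkL M.df M.dg (f.eval z / g.eval z) ![z] ?_ (by simp))
      simp only [rootProd, Fin.prod_univ_one, Matrix.cons_val_fin_one]
      exact key3 gz (by field_simp) h
  · intro p q hpq Wp Wq hA
    obtain ⟨l', hl'⟩ := A_zero M.df M.dg M.G22 hpq Wp Wq hA (nb p) (nb q)
    refine M.L22 (mkL M.df M.dg l' ![p, q] (by rwa [rp22]) (by simp))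
end
end
end Part6

section Part7
open Polynomial
noncomputable section

def Gen (d : ℕ) (P : ℂ[X][X] → ℂ[X][X] → Prop) : Prop :=
  ∃ Q : MvPolynomial (JJ d ⊕ JJ d) ℂ, Q ≠ 0 ∧ ∀ φ γ, InV d φ → InV d γ →
    MvPolynomial.eval (Sum.elim (cf d φ) (cf d γ)) Q ≠ 0 → P φ γ

lemma Gen.and {d : ℕ} {P P' : ℂ[X][X] → ℂ[X][X] → Prop} (h : Gen d P) (h' : Gen d P') :
    Gen d (fun φ γ => P φ γ ∧ P' φ γ) := by
  obtain ⟨Q, hQ, H⟩ := h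
  obtain ⟨Q', hQ', H'⟩ := h'
  refine ⟨Q * Q', mul_ne_zero hQ hQ', fun φ γ h1 h2 h3 => ?_⟩
  rw [map_mul] at h3
  exact ⟨H φ γ h1 h2 (left_ne_zero_of_mul h3), H' φ γ h1 h2 (right_ne_zero_of_mul h3)⟩

lemma Gen.imp {d : ℕ} {c : Prop} {P : ℂ[X][X] → ℂ[X][X] → Prop} (h : c → Gen d P) :
    Gen d (fun φ γ => c → P φ γ) := by
  by_cases hc : c
  · obtain ⟨Q, hQ, H⟩ := h hc
    exact ⟨Q, hQ, fun φ γ h1 h2 h3 _ => H φ γ h1 h2 h3⟩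
  · exact ⟨1, one_ne_zero, fun φ γ h1 h2 h3 h => (hc h).elim⟩

lemma gen4 {d : ℕ} {Ev} (h : Thin4 (4 * d) Ev) :
    Gen d (fun φ γ => ∀ a, ¬ Ev (sl a φ) (sl a γ) (sl1 d a φ) (sl1 d a γ)) := by
  obtain ⟨Q, hQ, H⟩ := gen_moving h
  exact ⟨Q, hQ, fun φ γ h1 h2 h3 a h4 => h3 (H φ γ h1 h2 a h4)⟩

lemma sl_coeff (a : ℂ) (φ : ℂ[X][X]) (j : ℕ) : (sl a φ).coeff j = (φ.coeff j).eval a := by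
  simp [sl]

lemma InV.sl1_degree {d : ℕ} {φ : ℂ[X][X]} (h : InV d φ) (a : ℂ) : (sl1 d a φ).degree < d := by
  rw [degree_lt_iff_coeff_zero]
  intro m hm
  rw [sl1_coeff h]
  have := h.natDegree_coeff m
  have : derivative (φ.coeff m) = 0 := by
    rw [eq_C_of_natDegree_le_zero (p := φ.coeff m) (by omega)]; simp
  rw [this]; simp

lemma InV.sl_degree {d : ℕ} {φ : ℂ[X][X]} (h : InV d φ) (a : ℂ) :
    (sl a φ).degree < (d + 1 : ℕ) := by
  rw [degree_lt_iff_coeff_zero]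
  intro m hm
  rw [sl_coeff, h.coeff_eq_zero (by omega)]; simp

lemma slInf_degree {d : ℕ} (φ : ℂ[X][X]) : (slInf d φ).degree < (d + 1 : ℕ) := by
  rw [slInf]
  refine (degree_sum_le _ _).trans_lt ?_
  rw [Finset.sup_lt_iff (WithBot.bot_lt_coe _)]
  intro j hj
  refine (degree_C_mul_X_pow_le _ _).trans_lt ?_
  rw [Finset.mem_range] at hj
  exact_mod_cast hj

lemma gen2 {d : ℕ} {Ev} (h : Thin (2 * d) Ev) :
    Gen d (fun φ γ => ∀ a, ¬ Ev (sl a φ) (sl a γ)) := by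
  obtain ⟨Q, hQ, H⟩ := gen4 h.thin4
  exact ⟨Q, hQ, fun φ γ h1 h2 h3 a h4 => H φ γ h1 h2 h3 a ⟨h4, h1.sl1_degree a, h2.sl1_degree a⟩⟩

lemma genI {d : ℕ} {Ev} (h : Thin (2 * d + 1) Ev) :
    Gen d (fun φ γ => ¬ Ev (slInf d φ) (slInf d γ)) := by
  obtain ⟨Q, hQ, H⟩ := gen_fixed h
  exact ⟨Q, hQ, fun φ γ h1 h2 h3 h4 => h3 (H φ γ h4)⟩

lemma gen_gd {d : ℕ} : Gen d (fun _ γ => (γ.coeff d).coeff 0 ≠ 0) := by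
  refine ⟨MvPolynomial.X (.inr ⟨⟨d, by omega⟩, ⟨0, by simp⟩⟩), MvPolynomial.X_ne_zero _, ?_⟩
  intro φ γ h1 h2 h3
  simpa [cf] using h3

structure Good (d : ℕ) (φ γ : ℂ[X][X]) : Prop where
  gd : (γ.coeff d).coeff 0 ≠ 0
  mov : ∀ a, Mov d (sl a φ) (sl a γ)
  tn : ∀ a, ¬ EvTN d (sl a φ) (sl a γ) (sl1 d a φ) (sl1 d a γ)
  tb : ∀ a, ¬ EvTB d (sl a φ) (sl a γ) (sl1 d a φ) (sl1 d a γ)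
  inf : GInf d (slInf d φ) (slInf d γ)

theorem gen_good {d : ℕ} (hd : 3 ≤ d) : Gen d (Good d) := by
  have L4 := gen2 (d := d) (thinL (d := d) ![4] (m := d - 3) (by omega))
  have L32 := Gen.imp (c := 4 ≤ d) fun _ => gen2 (d := d) (thinL (d := d) ![3, 2] (m := d - 4) (by omega))
  have L222 := Gen.imp (c := 5 ≤ d) fun _ => gen2 (d := d) (thinL (d := d) ![2, 2, 2] (m := d - 5) (by omega))
  have L22 := gen2 (d := d) (thinL (d := d) ![2] (m := d - 3) (by omega))
  have L03 := gen2 (d := d) (thinL (d := d) ![] (m := d - 2) (by omega))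
  have B2 := gen2 (d := d) (thinB (d := d) (e := 2) ![] (m := d - 2) (by omega))
  have B022 := Gen.imp (c := 4 ≤ d) fun _ => gen2 (d := d) (thinB (d := d) (e := 0) ![2, 2] (m := d - 4) (by omega))
  have B12 := gen2 (d := d) (thinB (d := d) (e := 1) ![2] (m := d - 3) (by omega))
  have B02 := gen2 (d := d) (thinB (d := d) (e := 0) ![] (m := d - 2) (by omega))
  have B5 := gen2 (d := d) (thinC ![1, 1] ![1, 1] (m := d - 1) (m' := d - 1) (by omega))
  have B6 := gen2 (d := d) (thinC ![1] ![2] (m := d) (m' := d - 1) (by omega))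
  have G3 := gen2 (d := d) (thinG (d := d) ![3] (m := d - 2) (by omega))
  have G22 := gen2 (d := d) (thinG (d := d) ![2, 2] (m := d - 3) (by omega))
  have NN := gen2 (d := d) (thinN ![2, 2] (m := d - 3) (by omega))
  have ib := genI (d := d) (thinC ![1] ![1] (m := d) (m' := d) (by omega))
  have iL22 := genI (d := d) (thinL (d := d) ![2, 2] (m := d - 3) (by omega))
  have iL02 := genI (d := d) (thinL (d := d) ![] (m := d - 1) (by omega))
  have iL3 := genI (d := d) (thinL (d := d) ![3] (m := d - 2) (by omega))
  have iG3 := genI (d := d) (thinG (d := d) ![3] (m := d - 2) (by omega))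
  have iG22 := genI (d := d) (thinG (d := d) ![2, 2] (m := d - 3) (by omega))
  obtain ⟨Q, hQ, H⟩ := gen_gd.and <| L4.and <| L32.and <| L222.and <| L22.and <| L03.and <| B2.and <|
    B022.and <| B12.and <| B02.and <| B5.and <| B6.and <| G3.and <| G22.and <| NN.and <|
    ib.and <| iL22.and <| iL02.and <| iL3.and <| iG3.and <| iG22.and <|
    (gen4 (thinTN hd)).and (gen4 (thinTB hd))
  refine ⟨Q, hQ, fun φ γ h1 h2 h3 => ?_⟩
  obtain ⟨g, a1, a2, a3, a4, a5, a6, a7, a8, a9, a10, a11, a12, a13, a14, b1, b2, b3, b4, b5, b6, c1, c2⟩ :=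
    H φ γ h1 h2 h3
  have hC : γ.coeff d = C ((γ.coeff d).coeff 0) :=
    eq_C_of_natDegree_le_zero (by have := h2.natDegree_coeff d; omega)
  refine ⟨g, fun a => ⟨h1.sl_degree a, h2.sl_degree a, ?_, a1 a, fun h => a2 h a, fun h => a3 h a,
    a4 a, a5 a, a6 a, fun h => a7 h a, a8 a, a9 a, a10 a, a11 a, a12 a, a13 a, a14 a⟩, c1, c2,
    ⟨slInf_degree _, slInf_degree _, ?_, b1, b2, b3, b4, b5, b6⟩⟩
  · rw [sl_coeff, hC]; simpa using g
  · rw [slInf_coeff d γ le_rfl]; simpa using g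
end
end Part7

section Part8
open Polynomial
noncomputable section

section maps
variable {R k : Type*} [CommRing R] [CommRing k] (π : R →+* k)

lemma tc_map (F : R[X]) (i : ℕ) (c : R) : tc (F.map π) i (π c) = π (tc F i c) := by
  simp only [tc]
  rw [← map_taylor, coeff_map]
lemma eval_map' (F : R[X]) (c : R) : (F.map π).eval (π c) = π (F.eval c) := by
  rw [eval_map, eval₂_hom]
lemma AA_map (F G : R[X]) (p q : R) : AA (F.map π) (G.map π) (π p) (π q) = π (AA F G p q) := by
  simp only [AA, eval_map', map_sub, map_mul]
lemma EE_map (F G : R[X]) (p : R) : EE (F.map π) (G.map π) (π p) = π (EE F G p) := by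
  simp only [EE, DD, tc_map, map_sub, map_mul, map_add]
lemma wr_map (F G : R[X]) : wronskian (F.map π) (G.map π) = (wronskian F G).map π := by
  simp [wronskian, derivative_map]
lemma AA_sub (F G : R[X]) (l p q : R) : AA (F - C l * G) G p q = AA F G p q := by
  simp only [AA, eval_sub, eval_mul, eval_C]; ring

/-- Taylor expansion to order `n`. -/
lemma taylor_rem (F : R[X]) (n : ℕ) (c y : R) : ∃ Q, F.eval (c + y) =
    (∑ i ∈ Finset.range n, tc F i c * y ^ i) + y ^ n * Q := by
  have h1 : F.eval (c + y) = (taylor c F).eval y := by rw [taylor_eval, add_comm]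
  rw [h1]
  have : X ^ n ∣ taylor c F - ∑ i ∈ Finset.range n, C (tc F i c) * X ^ i := by
    rw [X_pow_dvd_iff]
    intro m hm
    simp only [coeff_sub, finsetSum_coeff, coeff_C_mul, coeff_X_pow, mul_ite, mul_one, mul_zero]
    rw [Finset.sum_ite_eq (Finset.range n) m, if_pos (by simpa using hm)]
    simp [tc]
  obtain ⟨q, hq⟩ := this
  refine ⟨q.eval y, ?_⟩
  have := congrArg (eval y) hq
  simp only [eval_sub, eval_finset_sum, eval_mul, eval_C, eval_pow, eval_X] at this
  linear_combination this
end maps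

section loc
variable {R k : Type*} [CommRing R] [IsDomain R] [Field k] [CharZero k] (π : R →+* k) (j : ℂ →+* R)

include π in
lemma locP2 {F G : R[X]} {c1 c2 : R} (hne : c1 ≠ c2) (h1 : (wronskian F G).eval c1 = 0)
    (h2 : (wronskian F G).eval c2 = 0) (hc : π c1 = π c2) (hE : π (EE F G c1) ≠ 0) :
    ∃ u, 2 * AA F G c1 c2 = (c2 - c1) ^ 3 * u ∧ π u ≠ 0 := by
  set y := c2 - c1 with hy
  have hy0 : y ≠ 0 := sub_ne_zero.2 hne.symm
  have e : c2 = c1 + y := by rw [hy]; ring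
  have py : π y = 0 := by rw [hy, map_sub, hc, sub_self]
  obtain ⟨QF, hF⟩ := taylor_rem F 4 c1 y
  obtain ⟨QG, hG⟩ := taylor_rem G 4 c1 y
  obtain ⟨QW, hW⟩ := taylor_rem (wronskian F G) 3 c1 y
  rw [← e] at hF hG hW
  simp only [Finset.sum_range_succ, Finset.sum_range_zero, zero_add, pow_zero, mul_one, pow_one,
    wr_tc0, wr_tc1, wr_tc2] at hF hG hW
  rw [← tc_zero, wr_tc0] at h1
  rw [h2, h1] at hW
  have hW' : 2 * DD F G 0 2 c1 + (3 * DD F G 0 3 c1 + DD F G 1 2 c1) * y + y ^ 2 * QW = 0 := by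
    have : y * (2 * DD F G 0 2 c1 + (3 * DD F G 0 3 c1 + DD F G 1 2 c1) * y + y ^ 2 * QW) = 0 := by
      linear_combination -hW
    exact (mul_eq_zero.1 this).resolve_left hy0
  refine ⟨-EE F G c1 + y * (-QW + 2 * (tc F 0 c1 * QG - tc G 0 c1 * QF)), ?_, ?_⟩
  · rw [AA, ← tc_zero F c1, ← tc_zero G c1, hF, hG]
    simp only [EE]
    simp only [DD] at h1 hW' ⊢
    linear_combination 2 * y * h1 + y ^ 2 * hW'
  · simpa [py] using hE

variable {f g f1 g1 : ℂ[X]} {F G F1 G1 : R[X]} {s : R}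
  (hs : π s = 0) (hF : F = f.map j + C s * F1) (hG : G = g.map j + C s * G1)
  (hF1 : F1.map π = f1.map (π.comp j)) (hG1 : G1.map π = g1.map (π.comp j))

include hs hF in
lemma redF : F.map π = f.map (π.comp j) := by
  rw [hF]; simp [hs, Polynomial.map_map]

include hs hF in
lemma pi_evalF {c : R} {z : ℂ} (hc : π c = π (j z)) : π (F.eval c) = π (j (f.eval z)) := by
  rw [← eval_map', redF π j hs hF, hc]
  exact eval_map' (π.comp j) f z

include hF hG in
lemma wr_split : wronskian F G = (wronskian f g).map j + C s *
    (wronskian (f.map j) G1 + wronskian F1 (g.map j) + C s * wronskian F1 G1) := by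
  rw [hF, hG, ← wr_map]
  simp [wronskian]; ring

include hF hG in
lemma wr_eval0 {c : R} (h : (wronskian F G).eval c = 0) : ((wronskian f g).map j).eval c =
    - (s * (wronskian (f.map j) G1 + wronskian F1 (g.map j) + C s * wronskian F1 G1).eval c) := by
  rw [wr_split j hF hG] at h
  simp only [eval_add, eval_mul, eval_C] at h ⊢
  linear_combination h

lemma pi_map {c : R} {z : ℂ} (hc : π c = π (j z)) (P : ℂ[X]) : π ((P.map j).eval c) = π (j (P.eval z)) := by
  rw [← eval_map', hc, eval_map', eval_map']

variable (hloc : ∀ x : R, π x ≠ 0 → IsUnit x)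

include hloc hF hG in
lemma node_close {p : ℂ} (hp : (wronskian f g).eval p = 0)
    (sp : ¬ (X - C p) ^ 2 ∣ wronskian f g) {c : R} (hc : π c = π (j p))
    (hW : (wronskian F G).eval c = 0) : ∃ e, c - j p = s * e := by
  have h0 := wr_eval0 j hF hG hW
  obtain ⟨V, hV⟩ := dvd_iff_isRoot.2 hp
  have hVp : V.eval p ≠ 0 := by
    intro h
    obtain ⟨V', hV'⟩ := dvd_iff_isRoot.2 h
    exact sp ⟨V', by rw [hV, hV']; ring⟩
  have hu : IsUnit ((V.map j).eval c) := by
    apply hloc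
    rw [pi_map π j hc]
    exact (map_ne_zero (π.comp j)).2 hVp
  obtain ⟨u, hu⟩ := hu.exists_right_inv
  rw [hV] at h0
  simp only [Polynomial.map_mul, Polynomial.map_sub, map_X, map_C, eval_mul, eval_sub, eval_X, eval_C] at h0
  refine ⟨-(wronskian (f.map j) G1 + wronskian F1 (g.map j) + C s * wronskian F1 G1).eval c * u, ?_⟩
  linear_combination u * h0 - (c - j p) * hu

include hloc hF hG hs hF1 hG1 in
lemma locNode {l p q : ℂ} (L : LocN f g f1 g1 l p q) {c1 c2 : R} (hc1 : π c1 = π (j p))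
    (hc2 : π c2 = π (j q)) (hW1 : (wronskian F G).eval c1 = 0) (hW2 : (wronskian F G).eval c2 = 0) :
    ∃ u, AA F G c1 c2 = s * u ∧ π u ≠ 0 := by
  obtain ⟨e1, he1⟩ := node_close π j hF hG hloc L.Wp L.sp hc1 hW1
  obtain ⟨e2, he2⟩ := node_close π j hF hG hloc L.Wq L.sq hc2 hW2
  obtain ⟨n, hn⟩ := L.dvd
  have key : ∀ c, F.eval c - j l * G.eval c = (c - j p) ^ 2 * (c - j q) ^ 2 * (n.map j).eval c
      + s * (F1.eval c - j l * G1.eval c) := by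
    intro c
    have := congrArg (fun P => (P.map j).eval c) hn
    simp only [Polynomial.map_mul, Polynomial.map_sub, Polynomial.map_pow, map_X, map_C, eval_mul,
      eval_sub, eval_X, eval_C, eval_pow] at this
    rw [hF, hG]
    simp only [eval_add, eval_mul, eval_C]
    linear_combination this
  set n1 := (n.map j).eval c1
  set n2 := (n.map j).eval c2
  refine ⟨(s * e1 ^ 2 * (c1 - j q) ^ 2 * n1 + (F1.eval c1 - j l * G1.eval c1)) * G.eval c2 -
    (s * e2 ^ 2 * (c2 - j p) ^ 2 * n2 + (F1.eval c2 - j l * G1.eval c2)) * G.eval c1, ?_, ?_⟩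
  · have k1 := key c1
    have k2 := key c2
    rw [he1] at k1
    rw [he2] at k2
    rw [AA]
    linear_combination G.eval c2 * k1 - G.eval c1 * k2
  · have := L.h1
    rw [← map_ne_zero (π.comp j), ← AA_map, AA] at this
    simp only [Polynomial.map_sub, Polynomial.map_mul, map_C, ← hF1, ← hG1, eval_sub, eval_mul,
      eval_C] at this
    rw [← redF π j hs hG] at this
    simp only [RingHom.comp_apply, ← hc1, ← hc2, eval_map'] at this
    simpa [hs] using this

include hloc hF hG hs hF1 hG1 in
lemma locBase {d : ℕ} {r : ℂ} (L : LocB d f g f1 g1 r) {c : R} (hc : π c = π (j r))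
    (hW : (wronskian F G).eval c = 0) : ∃ u, s = (c - j r) ^ 2 * u ∧ π u ≠ 0 := by
  have h0 := wr_eval0 j hF hG hW
  obtain ⟨V, hV⟩ := L.dvd
  have hVp : V.eval r ≠ 0 := by
    intro h
    obtain ⟨V', hV'⟩ := dvd_iff_isRoot.2 h
    exact L.ndvd ⟨V', by rw [hV, hV']; ring⟩
  set W1 := wronskian (f.map j) G1 + wronskian F1 (g.map j) + C s * wronskian F1 G1 with hW1
  have hJ : π (W1.eval c) ≠ 0 := by
    have e : W1.map π = (wronskian f g1 + wronskian f1 g).map (π.comp j) := by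
      simp only [hW1, Polynomial.map_add, Polynomial.map_mul, map_C, hs, ← wr_map, hF1, hG1,
        Polynomial.map_map]
      simp
    rw [← eval_map', e, hc]
    have e2 := eval_map' (π.comp j) (wronskian f g1 + wronskian f1 g) r
    rw [RingHom.comp_apply] at e2
    rw [e2, _root_.map_ne_zero]
    have := L.J
    rw [tc_one, tc_one] at this
    simp only [wronskian, eval_add, eval_sub, eval_mul, L.base.1, L.base.2]
    convert this using 1; ring
  obtain ⟨u, hu⟩ := (hloc _ hJ).exists_right_inv
  rw [hV] at h0
  simp only [Polynomial.map_mul, Polynomial.map_sub, Polynomial.map_pow, map_X, map_C, eval_mul,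
    eval_sub, eval_X, eval_C, eval_pow] at h0
  refine ⟨-(V.map j).eval c * u, ?_, ?_⟩
  · linear_combination (-s) * hu + u * h0
  · rw [map_mul, map_neg]
    refine mul_ne_zero (neg_ne_zero.2 ?_) ?_
    · rw [pi_map π j hc]
      exact (map_ne_zero (π.comp j)).2 hVp
    · have := congrArg π hu
      rw [map_mul, map_one] at this
      exact right_ne_zero_of_mul_eq_one this

lemma base_split {r : ℂ} (hr : f.eval r = 0) (c : R) : ∃ f' : ℂ[X], f'.eval r = tc f 1 r ∧
    (f.map j).eval c = (c - j r) * (f'.map j).eval c := by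
  obtain ⟨f', hf'⟩ := dvd_iff_isRoot.2 hr
  refine ⟨f', ?_, ?_⟩
  · rw [tc_one, hf']; simp
  · conv_lhs => rw [hf']
    simp

include hloc hF hG hs hF1 hG1 in
lemma locBasePair {d : ℕ} {r : ℂ} (L : LocB d f g f1 g1 r) {c q : R} (hc : π c = π (j r))
    (hW : (wronskian F G).eval c = 0) {z : ℂ} (hz : z ≠ r) (hq : π q = π (j z))
    (hWz : (wronskian f g).eval z = 0) : ∃ u, AA F G c q = (c - j r) * u ∧ π u ≠ 0 := by
  obtain ⟨u, hu, -⟩ := locBase π j hs hF hG hF1 hG1 hloc L hc hW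
  obtain ⟨f', hf', ef⟩ := base_split j L.base.1 c
  obtain ⟨g', hg', eg⟩ := base_split j L.base.2 c
  refine ⟨((f'.map j).eval c + (c - j r) * u * F1.eval c) * G.eval q -
    F.eval q * ((g'.map j).eval c + (c - j r) * u * G1.eval c), ?_, ?_⟩
  · have e1 : F.eval c = (c - j r) * ((f'.map j).eval c + (c - j r) * u * F1.eval c) := by
      conv_lhs => rw [hF]
      simp only [eval_add, eval_mul, eval_C]; rw [ef]
      linear_combination F1.eval c * hu
    have e2 : G.eval c = (c - j r) * ((g'.map j).eval c + (c - j r) * u * G1.eval c) := by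
      conv_lhs => rw [hG]
      simp only [eval_add, eval_mul, eval_C]; rw [eg]
      linear_combination G1.eval c * hu
    rw [AA, e1, e2]; ring
  · simp only [map_sub, map_mul, map_add, pi_map π j hc, pi_evalF π j hs hF hq,
      pi_evalF π j hs hG hq, hc, hf', hg']
    have := (map_ne_zero (π.comp j)).2 (L.z z hz hWz)
    simpa using this

include hF hG hs hF1 hG1 in
lemma locBaseRes {d : ℕ} {r : ℂ} (L : LocB d f g f1 g1 r) {b : R} (hb : π b = π (j r))
    (hGb : G.eval b = 0) : ∃ u w, u * F.eval b = s * w ∧ π u ≠ 0 ∧ π w ≠ 0 := by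
  obtain ⟨f', hf', ef⟩ := base_split j L.base.1 b
  obtain ⟨g', hg', eg⟩ := base_split j L.base.2 b
  refine ⟨(g'.map j).eval b, (g'.map j).eval b * F1.eval b - (f'.map j).eval b * G1.eval b, ?_, ?_, ?_⟩
  · rw [hG] at hGb
    rw [hF]
    simp only [eval_add, eval_mul, eval_C] at hGb ⊢
    rw [ef]; rw [eg] at hGb
    linear_combination (f'.map j).eval b * hGb
  · rw [pi_map π j hb, hg']
    exact (map_ne_zero (π.comp j)).2 L.gt
  · have e1 : π (F1.eval b) = π (j (f1.eval r)) := by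
      rw [← eval_map', hF1, hb]; exact eval_map' (π.comp j) f1 r
    have e2 : π (G1.eval b) = π (j (g1.eval r)) := by
      rw [← eval_map', hG1, hb]; exact eval_map' (π.comp j) g1 r
    simp only [map_sub, map_mul, pi_map π j hb, hf', hg', e1, e2]
    have := (map_ne_zero (π.comp j)).2 L.J
    simp only [RingHom.comp_apply, map_sub, map_mul] at this
    convert this using 1; ring
end loc
end
end Part8

section Part9
open Polynomial
noncomputable section

namespace VR
variable {Ω : Type*} [Field Ω] (A : ValuationSubring Ω)

abbrev res : A →+* IsLocalRing.ResidueField A := IsLocalRing.residue A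

lemma v_eq_one {x : A} (h : res A x ≠ 0) : A.valuation (x : Ω) = 1 := by
  rw [← A.valuation_eq_one_iff]; exact (IsLocalRing.residue_ne_zero_iff_isUnit x).1 h

lemma v_lt_one {x : A} (h : res A x = 0) : A.valuation (x : Ω) < 1 := by
  rw [← A.valuation_lt_one_iff]; exact (IsLocalRing.residue_eq_zero_iff x).1 h

lemma hloc (x : A) (h : res A x ≠ 0) : IsUnit x := (IsLocalRing.residue_ne_zero_iff_isUnit x).1 h

open Classical in
/-- residue of an element (zero outside the ring) -/
def rr (c : Ω) : IsLocalRing.ResidueField A := if h : c ∈ A then res A ⟨c, h⟩ else 0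

open Classical in
def ww (c : Ω) : A.ValueGroup := if c ∈ A then 1 else A.valuation c

open Classical in
def ell (c : Ω) : A[X] := if h : c ∈ A then X - C ⟨c, h⟩ else
  1 - C ⟨c⁻¹, (A.mem_or_inv_mem c).resolve_left h⟩ * X

open Classical in
def ec (c : Ω) : Ω := if c ∈ A then 1 else -c

lemma ell_ec (c : Ω) : X - C c = C (ec A c) * (ell A c).map A.subtype := by
  by_cases h : c ∈ A
  · simp [ell, ec, h]
  · have hc : c ≠ 0 := by rintro rfl; exact h A.zero_mem
    simp only [ell, ec, h, if_false, dif_neg, not_false_eq_true]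
    simp only [Polynomial.map_sub, Polynomial.map_one, Polynomial.map_mul, map_C, map_X]
    rw [mul_sub, ← mul_assoc, ← C_mul]
    simp [hc]
    ring

lemma v_ec (c : Ω) : A.valuation (ec A c) = ww A c := by
  by_cases h : c ∈ A <;> simp [ec, ww, h, Valuation.map_neg]

lemma inv_lt {c : Ω} (h : c ∉ A) (h' : c⁻¹ ∈ A) : res A ⟨c⁻¹, h'⟩ = 0 := by
  by_contra hr
  have := v_eq_one A hr
  rw [← A.valuation_le_one_iff] at h
  simp at this
  exact h this.le

open Classical in
lemma ell_res (T : Multiset Ω) : ((T.map (ell A)).prod).map (res A) =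
    ((T.filter (· ∈ A)).map (fun c => X - C (rr A c))).prod := by
  induction T using Multiset.induction_on with
  | empty => simp
  | cons c T ih =>
    rw [Multiset.map_cons, Multiset.prod_cons, Polynomial.map_mul, ih]
    by_cases h : c ∈ A
    · rw [Multiset.filter_cons_of_pos _ h, Multiset.map_cons, Multiset.prod_cons]
      congr 1
      simp [ell, rr, h]
    · rw [Multiset.filter_cons_of_neg _ h]
      have : (ell A c).map (res A) = 1 := by
        have h' := (A.mem_or_inv_mem c).resolve_left h
        simp only [ell, h, dif_neg, not_false_eq_true, Polynomial.map_sub, Polynomial.map_one,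
          Polynomial.map_mul, map_C, map_X, inv_lt A h h']
        simp
      rw [this, one_mul]

lemma gauss {P W : A[X]} {u : Ω} (h : W.map A.subtype = C u * P.map A.subtype)
    (hP : P.map (res A) ≠ 0) (hW : W.map (res A) ≠ 0) :
    ∃ u' : A, (u' : Ω) = u ∧ res A u' ≠ 0 ∧ W = C u' * P := by
  have inj : Function.Injective (Polynomial.map A.subtype) := map_injective _ Subtype.val_injective
  by_cases hu : u ∈ A
  · have e : W = C ⟨u, hu⟩ * P := by
      apply inj; rw [h]; simp
    refine ⟨⟨u, hu⟩, rfl, ?_, e⟩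
    intro h0
    rw [e] at hW
    simp [h0] at hW
  · exfalso
    have h' := (A.mem_or_inv_mem u).resolve_left hu
    have hu0 : u ≠ 0 := by rintro rfl; exact hu A.zero_mem
    have e : P = C ⟨u⁻¹, h'⟩ * W := by
      apply inj
      simp only [Polynomial.map_mul, map_C, h]
      rw [← mul_assoc, ← C_mul]
      simp [hu0]
    rw [e] at hP
    simp [inv_lt A hu h'] at hP

open Classical in
lemma root_lemma {W : A[X]} {T : Multiset Ω} {lc : Ω}
    (h : W.map A.subtype = C lc * (T.map (fun c => X - C c)).prod) (hW : W.map (res A) ≠ 0) :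
    A.valuation lc * (T.map (ww A)).prod = 1 ∧ ∃ u, u ≠ 0 ∧ W.map (res A) =
      C u * ((T.filter (· ∈ A)).map (fun c => X - C (rr A c))).prod := by
  have e : ∀ T : Multiset Ω, (T.map (fun c => X - C c)).prod =
      C (T.map (ec A)).prod * ((T.map (ell A)).prod).map A.subtype := by
    intro T
    induction T using Multiset.induction_on with
    | empty => simp
    | cons c T ih =>
      simp only [Multiset.map_cons, Multiset.prod_cons, Polynomial.map_mul, C_mul]
      rw [ih, ell_ec A c]; ring
  rw [e, ← mul_assoc, ← C_mul] at h
  have hP : ((T.map (ell A)).prod).map (res A) ≠ 0 := by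
    rw [ell_res]
    exact (monic_multiset_prod_of_monic _ _ fun c _ => monic_X_sub_C _).ne_zero
  obtain ⟨u, hu, hu0, hWu⟩ := gauss A h hP hW
  constructor
  · have h1 := v_eq_one A hu0
    rw [hu, map_mul] at h1
    rw [← h1]
    congr 1
    rw [map_multiset_prod, Multiset.map_map]
    congr 1
    apply Multiset.map_congr rfl
    intro c _
    exact (v_ec A c).symm
  · refine ⟨res A u, hu0, ?_⟩
    rw [hWu, Polynomial.map_mul, map_C, ell_res]

open Classical in
structure Roots (ι : ℂ →+* IsLocalRing.ResidueField A) (T : Multiset Ω) (lc : Ω) (w0 : ℂ[X]) : Prop where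
  v : A.valuation lc * (T.map (ww A)).prod = 1
  card : (T.filter (· ∈ A)).card = w0.natDegree
  ex : ∀ c ∈ T, c ∈ A → ∃ z, w0.eval z = 0 ∧ rr A c = ι z
  mult : ∀ z, ((T.filter (· ∈ A)).filter (fun c => rr A c = ι z)).card = w0.rootMultiplicity z

open Classical in
lemma roots {ι : ℂ →+* IsLocalRing.ResidueField A} {W : A[X]} {T : Multiset Ω} {lc : Ω}
    (h : W.map A.subtype = C lc * (T.map (fun c => X - C c)).prod) {w0 : ℂ[X]} (hw : w0 ≠ 0)
    (hW : W.map (res A) = w0.map ι) : Roots A ι T lc w0 := by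
  have hW0 : W.map (res A) ≠ 0 := by
    rw [hW]; exact (Polynomial.map_ne_zero_iff ι.injective).2 hw
  obtain ⟨h1, u, hu, h2⟩ := root_lemma A h hW0
  have hr : (w0.map ι).roots = (T.filter (· ∈ A)).map (rr A) := by
    rw [← hW, h2, roots_C_mul _ hu, ← roots_multiset_prod_X_sub_C ((T.filter (· ∈ A)).map (rr A)),
      Multiset.map_map]
    rfl
  have hs := (IsAlgClosed.splits w0).roots_map ι
  refine ⟨h1, ?_, ?_, ?_⟩
  · have := congrArg Multiset.card hr
    rw [hs, Multiset.card_map, Multiset.card_map] at this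
    rw [← this]
    exact IsAlgClosed.card_roots_eq_natDegree
  · intro c hc hcA
    have : rr A c ∈ (w0.map ι).roots := by
      rw [hr]; exact Multiset.mem_map_of_mem _ (Multiset.mem_filter.2 ⟨hc, hcA⟩)
    rw [hs, Multiset.mem_map] at this
    obtain ⟨z, hz, e⟩ := this
    exact ⟨z, (mem_roots'.1 hz).2, e.symm⟩
  · intro z
    rw [eq_rootMultiplicity_map ι.injective z, ← count_roots, hr, Multiset.count_map]
    congr 1
    apply Multiset.filter_congr
    intro c _
    exact eq_comm
end VR
end
end Part9

section Part10
open Polynomial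
noncomputable section

namespace VR
open Classical

variable {Ω : Type*} [Field Ω]

lemma prod_offDiag_fst {α M : Type*} [CommGroupWithZero M] (S : Finset α) (f : α → M)
    (hf : ∀ c ∈ S, f c ≠ 0) : ∏ x ∈ S.offDiag, f x.1 = (∏ c ∈ S, f c) ^ (S.card - 1) := by
  have h0 : ∏ c ∈ S, f c ≠ 0 := Finset.prod_ne_zero_iff.2 hf
  rcases S.eq_empty_or_nonempty with rfl | hne
  · simp
  have h1 : ∏ x ∈ S ×ˢ S, f x.1 = (∏ c ∈ S, f c) ^ S.card := by
    rw [Finset.prod_product]; simp [Finset.prod_pow]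
  have h2 : ∏ x ∈ S ×ˢ S, f x.1 = (∏ c ∈ S, f c) * ∏ x ∈ S.offDiag, f x.1 := by
    rw [← Finset.diag_union_offDiag, Finset.prod_union (Finset.disjoint_diag_offDiag S)]
    congr 1
    rw [Finset.prod_diag]
  have h3 : (∏ c ∈ S, f c) ^ S.card = (∏ c ∈ S, f c) * (∏ c ∈ S, f c) ^ (S.card - 1) := by
    rw [← pow_succ']
    congr 1
    have := hne.card_pos; omega
  rw [h1, h3] at h2
  exact (mul_left_cancel₀ h0 h2).symm

lemma prod_offDiag_swap {α M : Type*} [CommMonoid M] (S : Finset α) (f : α → α → M) :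
    ∏ x ∈ S.offDiag, f x.2 x.1 = ∏ x ∈ S.offDiag, f x.1 x.2 := by
  refine Finset.prod_bij' (fun x _ => x.swap) (fun x _ => x.swap) ?_ ?_ ?_ ?_ ?_
  all_goals simp +contextual [Finset.mem_offDiag, eq_comm]

/-- The invariant. -/
def Theta (d : ℕ) (F G : Polynomial Ω) (S : Finset Ω) (lc : Ω) : Ω :=
  lc ^ ((d - 3) * (2 * (2 * d - 3))) * ∏ x ∈ S.offDiag, AA F G x.1 x.2 / (x.1 - x.2) ^ 3

variable (A : ValuationSubring Ω)

lemma ww_ne (c : Ω) : ww A c ≠ 0 := by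
  by_cases h : c ∈ A
  · simp [ww, h]
  · simp only [ww, h, if_false]
    rw [Valuation.ne_zero_iff]
    rintro rfl; exact h A.zero_mem

lemma v_Theta {d : ℕ} {F G : Polynomial Ω} {S : Finset Ω} {lc : Ω} (hS : S.card = 2 * d - 2)
    (hlc : A.valuation lc * ∏ c ∈ S, ww A c = 1) (ε : Ω → Ω → A.ValueGroup)
    (h : ∀ p ∈ S, ∀ q ∈ S, p ≠ q → A.valuation (AA F G p q) =
      A.valuation (p - q) ^ 3 * (ww A p * ww A q) ^ (d - 3) * ε p q) :
    A.valuation (Theta d F G S lc) = ∏ x ∈ S.offDiag, ε x.1 x.2 := by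
  have e1 : ∏ x ∈ S.offDiag, A.valuation (AA F G x.1 x.2 / (x.1 - x.2) ^ 3) =
      (∏ x ∈ S.offDiag, ww A x.1 * ww A x.2) ^ (d - 3) * ∏ x ∈ S.offDiag, ε x.1 x.2 := by
    rw [← Finset.prod_pow, ← Finset.prod_mul_distrib]
    refine Finset.prod_congr rfl fun x hx => ?_
    rw [Finset.mem_offDiag] at hx
    have hne : A.valuation (x.1 - x.2) ≠ 0 := by
      rw [Valuation.ne_zero_iff, sub_ne_zero]; exact hx.2.2
    rw [map_div₀, h _ hx.1 _ hx.2.1 hx.2.2, map_pow]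
    field_simp
  have e2 : ∏ x ∈ S.offDiag, ww A x.1 * ww A x.2 = (∏ c ∈ S, ww A c) ^ (2 * (2 * d - 3)) := by
    rw [Finset.prod_mul_distrib, prod_offDiag_swap S (fun p _ => ww A p),
      prod_offDiag_fst S _ (fun c _ => ww_ne A c), ← pow_add, hS]
    congr 1; omega
  rw [Theta, map_mul, map_prod, e1, e2, map_pow, ← mul_assoc, mul_comm (d - 3), pow_mul, ← mul_pow,
    ← mul_pow, hlc, one_pow, one_pow, one_mul]

variable {A}

structure LP (A : ValuationSubring Ω) (j : ℂ →+* A) (d : ℕ) (f g : ℂ[X]) (F G : A[X])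
    (S : Finset Ω) (lc : Ω) : Prop where
  hd : 3 ≤ d
  hF : F.map (res A) = f.map ((res A).comp j)
  hG : G.map (res A) = g.map ((res A).comp j)
  dF : F.natDegree ≤ d
  dG : G.natDegree ≤ d
  card : S.card = 2 * d - 2
  fac : (wronskian F G).map A.subtype = C lc * ∏ c ∈ S, (X - C c)
  L : LocC d f g

namespace LP
variable {j : ℂ →+* A} {d : ℕ} {f g : ℂ[X]} {F G : A[X]} {S : Finset Ω} {lc : Ω}
  (H : LP A j d f g F G S lc)
include H

lemma roots : Roots A ((res A).comp j) S.val lc (wronskian f g) := by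
  refine VR.roots A H.fac H.L.W0 ?_
  rw [← wr_map, ← wr_map, H.hF, H.hG]

lemma charZero : CharZero (IsLocalRing.ResidueField A) :=
  charZero_of_injective_ringHom ((res A).comp j).injective

lemma root {c : Ω} (hc : c ∈ S) (h : c ∈ A) : (wronskian F G).eval ⟨c, h⟩ = 0 := by
  apply Subtype.val_injective
  have := eval_map' A.subtype (wronskian F G) ⟨c, h⟩
  rw [H.fac] at this
  change A.subtype _ = 0
  rw [← this]
  simp only [eval_mul, eval_prod, eval_sub, eval_X, eval_C]
  rw [Finset.prod_eq_zero hc]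
  · simp
  · simp

lemma vlc : A.valuation lc * ∏ c ∈ S, ww A c = 1 := H.roots.v

lemma pEval (z : ℂ) {c : A} (hc : res A c = res A (j z)) (P : A[X]) (p : ℂ[X])
    (h : P.map (res A) = p.map ((res A).comp j)) : res A (P.eval c) = res A (j (p.eval z)) := by
  rw [← eval_map', h, hc]; exact eval_map' ((res A).comp j) p z

lemma pEE (z : ℂ) {c : A} (hc : res A c = res A (j z)) :
    res A (EE F G c) = res A (j (EE f g z)) := by
  rw [← EE_map, H.hF, H.hG, hc]; exact EE_map ((res A).comp j) f g z

lemma pAA {z w : ℂ} {c c' : A} (hc : res A c = res A (j z)) (hc' : res A c' = res A (j w)) :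
    res A (AA F G c c') = res A (j (AA f g z w)) := by
  rw [← AA_map, H.hF, H.hG, hc, hc']; exact AA_map ((res A).comp j) f g z w

lemma pair_unit {p q : Ω} (hp : p ∈ A) (hq : q ∈ A) {z w : ℂ} (hz : rr A p = res A (j z))
    (hw : rr A q = res A (j w)) (hzw : z ≠ w) (hA : AA f g z w ≠ 0) :
    A.valuation (AA (F.map A.subtype) (G.map A.subtype) p q) =
      A.valuation (p - q) ^ 3 * (ww A p * ww A q) ^ (d - 3) := by
  rw [rr, dif_pos hp] at hz
  rw [rr, dif_pos hq] at hw
  have e1 : AA (F.map A.subtype) (G.map A.subtype) p q = ((AA F G ⟨p, hp⟩ ⟨q, hq⟩ : A) : Ω) :=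
    AA_map A.subtype F G ⟨p, hp⟩ ⟨q, hq⟩
  have h1 : A.valuation (AA (F.map A.subtype) (G.map A.subtype) p q) = 1 := by
    rw [e1]
    apply v_eq_one
    rw [H.pAA hz hw]
    exact (map_ne_zero ((res A).comp j)).2 hA
  have h2 : A.valuation (p - q) = 1 := by
    have : A.valuation ((⟨p, hp⟩ - ⟨q, hq⟩ : A) : Ω) = 1 := by
      apply v_eq_one
      rw [map_sub, hz, hw, ← map_sub, ← map_sub]
      exact (map_ne_zero ((res A).comp j)).2 (sub_ne_zero.2 hzw)
    exact this
  rw [h1, h2]; simp [ww, hp, hq]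

lemma pair_same {p q : Ω} (hpS : p ∈ S) (hqS : q ∈ S) (hpq : p ≠ q) (hp : p ∈ A) (hq : q ∈ A) {z : ℂ}
    (hz : rr A p = res A (j z)) (hw : rr A q = res A (j z)) :
    A.valuation (AA (F.map A.subtype) (G.map A.subtype) p q) =
      A.valuation (p - q) ^ 3 * (ww A p * ww A q) ^ (d - 3) := by
  have hm : 2 ≤ (wronskian f g).rootMultiplicity z := by
    rw [← H.roots.mult z]
    have : Finset.card {p, q} ≤ (Finset.filter (fun c => rr A c = res A (j z)) (S.filter (· ∈ A))).card := by
      apply Finset.card_le_card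
      intro c hc
      simp only [Finset.mem_insert, Finset.mem_singleton] at hc
      rcases hc with rfl | rfl <;> simp [*]
    rw [Finset.card_pair hpq] at this
    exact this
  have hE := H.L.R3 z ((le_rootMultiplicity_iff H.L.W0).1 hm)
  rw [rr, dif_pos hp] at hz
  rw [rr, dif_pos hq] at hw
  have := H.charZero
  obtain ⟨u, hu, hu0⟩ := locP2 (res A) (F := F) (G := G) (c1 := ⟨p, hp⟩) (c2 := ⟨q, hq⟩)
    (by simpa using hpq) (H.root hpS hp) (H.root hqS hq) (hz.trans hw.symm)
    (by rw [H.pEE z hz]; exact (map_ne_zero ((res A).comp j)).2 hE)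
  have e1 : AA (F.map A.subtype) (G.map A.subtype) p q = ((AA F G ⟨p, hp⟩ ⟨q, hq⟩ : A) : Ω) :=
    AA_map A.subtype F G ⟨p, hp⟩ ⟨q, hq⟩
  have h2 : A.valuation ((2 : A) : Ω) = 1 := by
    apply v_eq_one; rw [map_ofNat]; exact two_ne_zero
  have := congrArg (fun x : A => A.valuation (x : Ω)) hu
  simp only [MulMemClass.coe_mul, map_mul, h2, v_eq_one A hu0, one_mul, mul_one] at this
  rw [e1, this]
  simp [ww, hp, hq]
  exact A.valuation.map_sub_swap q p

omit H in
lemma eval_big {p : Ω} (hp : p ∉ A) (hp' : p⁻¹ ∈ A) (F : A[X]) (dF : F.natDegree ≤ d) :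
    (F.map A.subtype).eval p = (((reflect d F).eval ⟨p⁻¹, hp'⟩ : A) : Ω) * p ^ d := by
  have hp0 : p ≠ 0 := by rintro rfl; exact hp A.zero_mem
  letI : Invertible p := invertibleOfNonzero hp0
  have := eval₂_reflect_mul_pow A.subtype p d F dF
  rw [eval_map, ← this]
  congr 1
  rw [invOf_eq_inv]
  exact eval₂_hom A.subtype (⟨p⁻¹, hp'⟩ : A)

omit H in
lemma eval_big_res {p : Ω} (hp : p ∉ A) (hp' : p⁻¹ ∈ A) (F : A[X]) :
    res A ((reflect d F).eval ⟨p⁻¹, hp'⟩) = res A (F.coeff d) := by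
  rw [← eval_map', inv_lt A hp hp', ← coeff_zero_eq_eval_zero, coeff_map, coeff_reflect]
  simp

lemma out_unique {p q : Ω} (hpS : p ∈ S) (hqS : q ∈ S) (hpq : p ≠ q) (hp : p ∉ A) :
    q ∈ A ∧ (wronskian f g).coeff (2 * d - 2) = 0 := by
  have hc : (S.filter (· ∈ A)).card = (wronskian f g).natDegree := H.roots.card
  have hd := H.L.deg
  have hS := H.card
  have h3 := H.hd
  have h1 : (S.filter (· ∈ A)).card + (S.filter (· ∉ A)).card = S.card :=
    Finset.card_filter_add_card_filter_not ..
  constructor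
  · by_contra hq
    have : Finset.card {p, q} ≤ (S.filter (· ∉ A)).card := by
      apply Finset.card_le_card
      intro c hc
      simp only [Finset.mem_insert, Finset.mem_singleton] at hc
      rcases hc with rfl | rfl <;> simp [*]
    rw [Finset.card_pair hpq] at this
    omega
  · apply coeff_eq_zero_of_natDegree_lt
    have : Finset.card {p} ≤ (S.filter (· ∉ A)).card := by
      apply Finset.card_le_card
      intro c hc
      simp only [Finset.mem_singleton] at hc
      rcases hc with rfl; simp [*]
    rw [Finset.card_singleton] at this
    omega

lemma pair_out {p q : Ω} (hpS : p ∈ S) (hqS : q ∈ S) (hpq : p ≠ q) (hp : p ∉ A) :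
    A.valuation (AA (F.map A.subtype) (G.map A.subtype) p q) =
      A.valuation (p - q) ^ 3 * (ww A p * ww A q) ^ (d - 3) := by
  obtain ⟨hq, h0⟩ := H.out_unique hpS hqS hpq hp
  have hp' := (A.mem_or_inv_mem p).resolve_left hp
  obtain ⟨z, hz, hzr⟩ := H.roots.ex q hqS hq
  rw [rr, dif_pos hq] at hzr
  have hR := H.L.R4 h0 z hz
  have e1 : AA (F.map A.subtype) (G.map A.subtype) p q =
      (((reflect d F).eval ⟨p⁻¹, hp'⟩ * G.eval ⟨q, hq⟩ - F.eval ⟨q, hq⟩ * (reflect d G).eval ⟨p⁻¹, hp'⟩ : A) : Ω)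
        * p ^ d := by
    rw [AA, eval_big hp hp' F H.dF, eval_big hp hp' G H.dG]
    have a1 : (F.map A.subtype).eval q = ((F.eval ⟨q, hq⟩ : A) : Ω) := eval_map' A.subtype F ⟨q, hq⟩
    have a2 : (G.map A.subtype).eval q = ((G.eval ⟨q, hq⟩ : A) : Ω) := eval_map' A.subtype G ⟨q, hq⟩
    rw [a1, a2]
    push_cast
    ring
  have fd : res A (F.coeff d) = res A (j (f.coeff d)) := by
    rw [← coeff_map, H.hF, coeff_map]; rfl
  have gd : res A (G.coeff d) = res A (j (g.coeff d)) := by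
    rw [← coeff_map, H.hG, coeff_map]; rfl
  have v1 : A.valuation (AA (F.map A.subtype) (G.map A.subtype) p q) = A.valuation p ^ d := by
    rw [e1, map_mul, v_eq_one, one_mul, map_pow]
    rw [map_sub, map_mul, map_mul, eval_big_res hp hp' F, eval_big_res hp hp' G,
      H.pEval z hzr F f H.hF, H.pEval z hzr G g H.hG, fd, gd]
    have := (map_ne_zero ((res A).comp j)).2 hR
    simp only [RingHom.comp_apply, map_sub, map_mul] at this
    rwa [mul_comm (res A (j (eval z f)))]
  have hlt : A.valuation q < A.valuation p := by
    have h1 := A.valuation_le_one ⟨q, hq⟩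
    refine lt_of_le_of_lt h1 ?_
    rw [← not_le, A.valuation_le_one_iff]; exact hp
  have v2 : A.valuation (p - q) = A.valuation p := Valuation.map_sub_eq_of_lt_left _ hlt
  rw [v1, v2]
  simp only [ww, hp, hq, if_true, if_false, mul_one]
  rw [← pow_add]; congr 1; have := H.hd; omega

omit H in
lemma AA_swap (F G : Polynomial Ω) (p q : Ω) : A.valuation (AA F G p q) = A.valuation (AA F G q p) := by
  rw [← Valuation.map_neg]; congr 1; simp only [AA]; ring

lemma pair_gen {p q : Ω} (hpS : p ∈ S) (hqS : q ∈ S) (hpq : p ≠ q)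
    (h : p ∈ A → q ∈ A → ∀ z w, z ≠ w → rr A p = res A (j z) → rr A q = res A (j w) →
      (wronskian f g).eval z = 0 → (wronskian f g).eval w = 0 → AA f g z w ≠ 0) :
    A.valuation (AA (F.map A.subtype) (G.map A.subtype) p q) =
      A.valuation (p - q) ^ 3 * (ww A p * ww A q) ^ (d - 3) := by
  by_cases hp : p ∈ A
  · by_cases hq : q ∈ A
    · obtain ⟨z, hz, hzr⟩ := H.roots.ex p hpS hp
      obtain ⟨w, hw, hwr⟩ := H.roots.ex q hqS hq
      by_cases hzw : z = w
      · subst hzw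
        exact H.pair_same hpS hqS hpq hp hq hzr hwr
      · exact H.pair_unit hp hq hzr hwr hzw (h hp hq z w hzw hzr hwr hz hw)
    · rw [AA_swap, Valuation.map_sub_swap, mul_comm (ww A p)]
      exact H.pair_out hqS hpS hpq.symm hq
  · exact H.pair_out hpS hqS hpq hp

/-- Regular place. -/
lemma theta_regular (h : ∀ z w, z ≠ w → (wronskian f g).eval z = 0 → (wronskian f g).eval w = 0 →
    AA f g z w ≠ 0) : A.valuation (Theta d (F.map A.subtype) (G.map A.subtype) S lc) = 1 := by
  rw [v_Theta A H.card H.vlc (fun _ _ => 1)]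
  · simp
  · intro p hp q hq hpq
    rw [H.pair_gen hp hq hpq (fun _ _ z w h1 _ _ h2 h3 => h z w h1 h2 h3), mul_one]
end LP
end VR
end
end Part10

section Part11
open Polynomial
noncomputable section

namespace VR
open Classical

variable {Ω : Type*} [Field Ω] {A : ValuationSubring Ω}

/-- Place data together with the first order deformation. -/
structure LD (A : ValuationSubring Ω) (j : ℂ →+* A) (f g f1 g1 : ℂ[X]) (F G F1 G1 : A[X])
    (s : A) : Prop where
  hs : res A s = 0
  eF : F = f.map j + C s * F1
  eG : G = g.map j + C s * G1
  hF1 : F1.map (res A) = f1.map ((res A).comp j)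
  hG1 : G1.map (res A) = g1.map ((res A).comp j)

section
variable {j : ℂ →+* A} {d : ℕ} {f g f1 g1 : ℂ[X]} {F G F1 G1 : A[X]} {S : Finset Ω} {lc : Ω} {s : A}

lemma LP.uniq (H : LP A j d f g F G S lc) {z : ℂ} (h1 : (wronskian f g).eval z = 0)
    (h2 : ¬ (X - C z) ^ 2 ∣ wronskian f g) : ∃ c ∈ S, c ∈ A ∧ rr A c = res A (j z) ∧
      ∀ c' ∈ S, c' ∈ A → rr A c' = res A (j z) → c' = c := by
  have hm : (wronskian f g).rootMultiplicity z = 1 := by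
    apply le_antisymm
    · by_contra h
      exact h2 ((le_rootMultiplicity_iff H.L.W0).1 (by omega))
    · exact (rootMultiplicity_pos H.L.W0).2 h1
  have hc : (Finset.filter (fun c => rr A c = res A (j z)) (S.filter (· ∈ A))).card = 1 := by
    rw [← hm, ← H.roots.mult z]; rfl
  obtain ⟨c, hc⟩ := Finset.card_eq_one.1 hc
  have hm : ∀ c', c' ∈ (Finset.filter (fun c => rr A c = res A (j z)) (S.filter (· ∈ A))) ↔ c' = c := by
    intro c'; rw [hc, Finset.mem_singleton]
  simp only [Finset.mem_filter] at hm
  have h0 := (hm c).2 rfl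
  exact ⟨c, h0.1.1, h0.1.2, h0.2, fun c' a b e => (hm c').1 ⟨⟨a, b⟩, e⟩⟩

lemma v_sub (j : ℂ →+* A) {p q : Ω} (hp : p ∈ A) (hq : q ∈ A) {z w : ℂ} (hz : rr A p = res A (j z))
    (hw : rr A q = res A (j w)) (hzw : z ≠ w) : A.valuation (p - q) = 1 := by
  rw [rr, dif_pos hp] at hz
  rw [rr, dif_pos hq] at hw
  have : A.valuation ((⟨p, hp⟩ - ⟨q, hq⟩ : A) : Ω) = 1 := by
    apply v_eq_one
    rw [map_sub, hz, hw, ← map_sub, ← map_sub]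
    exact (map_ne_zero ((res A).comp j)).2 (sub_ne_zero.2 hzw)
  exact this

lemma LP.theta_node (H : LP A j d f g F G S lc) (D : LD A j f g f1 g1 F G F1 G1 s) {l p q : ℂ}
    (L : LocN f g f1 g1 l p q) :
    A.valuation (Theta d (F.map A.subtype) (G.map A.subtype) S lc) = A.valuation (s : Ω) ^ 2 := by
  obtain ⟨c1, m1, a1, r1, u1⟩ := H.uniq L.Wp L.sp
  obtain ⟨c2, m2, a2, r2, u2⟩ := H.uniq L.Wq L.sq
  have inj := ((res A).comp j).injective
  have hne : c1 ≠ c2 := by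
    rintro rfl
    exact L.ne (inj (r1.symm.trans r2))
  have key : A.valuation (AA (F.map A.subtype) (G.map A.subtype) c1 c2) =
      A.valuation (c1 - c2) ^ 3 * (ww A c1 * ww A c2) ^ (d - 3) * A.valuation (s : Ω) := by
    rw [v_sub j a1 a2 r1 r2 L.ne]
    have := H.charZero
    have r1' := r1
    have r2' := r2
    rw [rr, dif_pos a1] at r1'
    rw [rr, dif_pos a2] at r2'
    obtain ⟨u, hu, hu0⟩ := locNode (res A) j D.hs D.eF D.eG D.hF1 D.hG1 (hloc A) L r1' r2'
      (H.root m1 a1) (H.root m2 a2)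
    have e1 : AA (F.map A.subtype) (G.map A.subtype) c1 c2 = ((AA F G ⟨c1, a1⟩ ⟨c2, a2⟩ : A) : Ω) :=
      AA_map A.subtype F G ⟨c1, a1⟩ ⟨c2, a2⟩
    rw [e1, hu]
    simp only [MulMemClass.coe_mul, map_mul, v_eq_one A hu0]
    simp [ww, a1, a2]
  rw [v_Theta A H.card H.vlc (fun a b => if (a, b) ∈ ({(c1, c2), (c2, c1)} : Finset (Ω × Ω)) then
    A.valuation (s : Ω) else 1)]
  · rw [Finset.prod_ite, Finset.prod_const, Finset.prod_const_one, mul_one]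
    congr 1
    have : S.offDiag.filter (fun x => (x.1, x.2) ∈ ({(c1, c2), (c2, c1)} : Finset (Ω × Ω))) =
        {(c1, c2), (c2, c1)} := by
      ext ⟨a, b⟩
      simp only [Finset.mem_filter, Finset.mem_offDiag, Finset.mem_insert, Finset.mem_singleton,
        Prod.mk.injEq]
      constructor
      · exact fun h => h.2
      · rintro (⟨rfl, rfl⟩ | ⟨rfl, rfl⟩)
        · exact ⟨⟨m1, m2, hne⟩, Or.inl ⟨rfl, rfl⟩⟩
        · exact ⟨⟨m2, m1, hne.symm⟩, Or.inr ⟨rfl, rfl⟩⟩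
    rw [this, Finset.card_pair]
    intro h
    exact hne (congrArg Prod.fst h)
  · intro a ha b hb hab
    split_ifs with hc
    · simp only [Finset.mem_insert, Finset.mem_singleton, Prod.mk.injEq] at hc
      rcases hc with ⟨rfl, rfl⟩ | ⟨rfl, rfl⟩
      · exact key
      · rw [LP.AA_swap, Valuation.map_sub_swap, mul_comm (ww A a), key]
    · rw [mul_one]
      refine H.pair_gen ha hb hab fun haA hbA z w hzw hz hw Wz Ww h0 => hc ?_
      simp only [Finset.mem_insert, Finset.mem_singleton, Prod.mk.injEq]
      rcases L.other z w hzw Wz Ww h0 with ⟨rfl, rfl⟩ | ⟨rfl, rfl⟩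
      · exact Or.inl ⟨u1 a ha haA hz, u2 b hb hbA hw⟩
      · exact Or.inr ⟨u2 a ha haA hz, u1 b hb hbA hw⟩

lemma LP.theta_base (H : LP A j d f g F G S lc) (D : LD A j f g f1 g1 F G F1 G1 s) {r : ℂ}
    (L : LocB d f g f1 g1 r) :
    A.valuation (Theta d (F.map A.subtype) (G.map A.subtype) S lc) = A.valuation (s : Ω) ^ (4 * d - 8) := by
  have := H.charZero
  have h3 := H.hd
  have hA : ∀ c ∈ S, c ∈ A := by
    intro c hc
    by_contra hcA
    obtain ⟨q, hq, hqc⟩ := Finset.exists_mem_ne (show 1 < S.card by rw [H.card]; omega) c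
    exact L.deg (H.out_unique hc hq hqc.symm hcA).2
  have inj := ((res A).comp j).injective
  set B : Ω → Prop := fun c => rr A c = res A (j r) with hB
  set h : Ω → Ω → A.ValueGroup := fun p q => if B p ∧ ¬ B q then A.valuation (p - (j r : A)) else 1 with hh
  have base : ∀ c ∈ S, B c → A.valuation (c - (j r : A)) ^ 2 = A.valuation (s : Ω) := by
    intro c hc hcB
    have hcA := hA c hc
    have hcB' := hcB
    simp only [hB] at hcB'
    rw [rr, dif_pos hcA] at hcB'
    obtain ⟨u, hu, hu0⟩ := locBase (res A) j D.hs D.eF D.eG D.hF1 D.hG1 (hloc A) L hcB' (H.root hc hcA)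
    have := congrArg (fun x : A => A.valuation (x : Ω)) hu
    simp only [MulMemClass.coe_mul, map_mul, v_eq_one A hu0, mul_one] at this
    rw [this]
    push_cast
    rw [map_pow]
  have pair : ∀ p ∈ S, ∀ q ∈ S, B p → ¬ B q → A.valuation (AA (F.map A.subtype) (G.map A.subtype) p q) =
      A.valuation (p - q) ^ 3 * (ww A p * ww A q) ^ (d - 3) * A.valuation (p - (j r : A)) := by
    intro p hp q hq hBp hBq
    have hpA := hA p hp
    have hqA := hA q hq
    obtain ⟨z, Wz, hz⟩ := H.roots.ex q hq hqA
    have hzr : z ≠ r := by rintro rfl; exact hBq hz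
    rw [v_sub j hpA hqA hBp hz hzr.symm]
    have r1' := hBp
    have r2' := hz
    simp only [hB] at r1'
    rw [rr, dif_pos hpA] at r1'
    rw [rr, dif_pos hqA] at r2'
    obtain ⟨u, hu, hu0⟩ := locBasePair (res A) j D.hs D.eF D.eG D.hF1 D.hG1 (hloc A) L r1'
      (H.root hp hpA) hzr r2' Wz
    have e1 : AA (F.map A.subtype) (G.map A.subtype) p q = ((AA F G ⟨p, hpA⟩ ⟨q, hqA⟩ : A) : Ω) :=
      AA_map A.subtype F G ⟨p, hpA⟩ ⟨q, hqA⟩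
    rw [e1, hu]
    simp only [MulMemClass.coe_mul, map_mul, v_eq_one A hu0]
    simp [ww, hpA, hqA]
  rw [v_Theta A H.card H.vlc (fun a b => h a b * h b a)]
  · rw [Finset.prod_mul_distrib, prod_offDiag_swap S h, ← sq, ← Finset.prod_pow]
    have : ∀ x ∈ S.offDiag, h x.1 x.2 ^ 2 = if B x.1 ∧ ¬ B x.2 then A.valuation (s : Ω) else 1 := by
      intro x hx
      rw [Finset.mem_offDiag] at hx
      simp only [hh]
      split_ifs with hc
      · exact base _ hx.1 hc.1
      · exact one_pow _
    rw [Finset.prod_congr rfl this, Finset.prod_ite, Finset.prod_const, Finset.prod_const_one, mul_one]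
    congr 1
    have : S.offDiag.filter (fun x => B x.1 ∧ ¬ B x.2) = (S.filter B) ×ˢ (S.filter (fun c => ¬ B c)) := by
      ext ⟨a, b⟩
      simp only [Finset.mem_filter, Finset.mem_offDiag, Finset.mem_product]
      constructor
      · tauto
      · rintro ⟨⟨h1, h2⟩, h3, h4⟩
        refine ⟨⟨h1, h3, ?_⟩, h2, h4⟩
        rintro rfl; exact h4 h2
    rw [this, Finset.card_product]
    have hm : (wronskian f g).rootMultiplicity r = 2 := by
      apply le_antisymm
      · by_contra h
        exact L.ndvd ((le_rootMultiplicity_iff H.L.W0).1 (by omega))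
      · exact (le_rootMultiplicity_iff H.L.W0).2 L.dvd
    have c1 : (S.filter B).card = 2 := by
      rw [← hm, ← H.roots.mult r]
      have : S.filter B = Finset.filter (fun c => rr A c = res A (j r)) (S.filter (· ∈ A)) := by
        ext c
        simp only [Finset.mem_filter]
        constructor
        · exact fun h => ⟨⟨h.1, hA c h.1⟩, h.2⟩
        · exact fun h => ⟨h.1.1, h.2⟩
      rw [this]; rfl
    have h1 : (S.filter B).card + (S.filter (fun c => ¬ B c)).card = S.card :=
      Finset.card_filter_add_card_filter_not ..
    have := H.card
    rw [c1]
    omega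
  · intro p hp q hq hpq
    by_cases hBp : B p <;> by_cases hBq : B q
    · simp only [hh, hBp, hBq, not_true, and_false, if_false, mul_one]
      exact H.pair_same hp hq hpq (hA p hp) (hA q hq) hBp hBq
    · simp only [hh, hBp, hBq, not_true, and_false, if_false, mul_one, not_false_eq_true, and_true, if_true]
      exact pair p hp q hq hBp hBq
    · simp only [hh, hBp, hBq, not_true, and_false, if_false, one_mul, not_false_eq_true, and_true, if_true]
      rw [LP.AA_swap, Valuation.map_sub_swap, mul_comm (ww A p)]
      exact pair q hq p hp hBq hBp
    · simp only [hh, hBp, hBq, false_and, if_false, mul_one]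
      refine H.pair_gen hp hq hpq fun _ _ z w hzw hz hw Wz Ww => L.other z w hzw ?_ ?_ Wz Ww
      · rintro rfl; exact hBp hz
      · rintro rfl; exact hBq hw

/-- Root data for the resultant. -/
structure RD (A : ValuationSubring Ω) (j : ℂ →+* A) (d : ℕ) (f g : ℂ[X]) (F G : A[X])
    (T : Multiset Ω) (lg : Ω) : Prop where
  hF : F.map (res A) = f.map ((res A).comp j)
  hG : G.map (res A) = g.map ((res A).comp j)
  gd : g.coeff d ≠ 0
  dg : g.natDegree ≤ d
  card : T.card = d
  fac : G.map A.subtype = C lg * (T.map (fun c => X - C c)).prod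

def rho (d : ℕ) (F : Polynomial Ω) (T : Multiset Ω) (lg : Ω) : Ω :=
  lg ^ d * (T.map (fun c => F.eval c)).prod

namespace RD
variable {T : Multiset Ω} {lg : Ω} (H : RD A j d f g F G T lg)
include H

lemma g0 : g ≠ 0 := by rintro rfl; exact H.gd (by simp)

lemma roots : Roots A ((res A).comp j) T lg g := VR.roots A H.fac H.g0 H.hG

lemma mem : ∀ c ∈ T, c ∈ A := by
  have h := H.roots.card
  have hd : g.natDegree = d := le_antisymm H.dg (le_natDegree_of_ne_zero H.gd)
  rw [hd, ← H.card] at h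
  have := Multiset.eq_of_le_of_card_le (Multiset.filter_le (· ∈ A) T) h.ge
  exact Multiset.filter_eq_self.1 this

lemma vlg : A.valuation lg = 1 := by
  have h := H.roots.v
  rwa [Multiset.prod_eq_one, mul_one] at h
  intro x hx
  obtain ⟨c, hc, rfl⟩ := Multiset.mem_map.1 hx
  simp [ww, H.mem c hc]

lemma root {c : Ω} (hc : c ∈ T) (h : c ∈ A) : G.eval ⟨c, h⟩ = 0 := by
  apply Subtype.val_injective
  have := eval_map' A.subtype G ⟨c, h⟩
  rw [H.fac] at this
  change A.subtype _ = 0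
  rw [← this]
  rw [eval_mul, eval_multiset_prod, Multiset.prod_eq_zero, mul_zero]
  rw [Multiset.map_map]
  exact Multiset.mem_map.2 ⟨c, hc, by simp⟩

lemma v_rho : A.valuation (rho d (F.map A.subtype) T lg) =
    (T.map (fun c => A.valuation ((F.map A.subtype).eval c))).prod := by
  rw [rho, map_mul, map_pow, H.vlg, one_pow, one_mul, map_multiset_prod, Multiset.map_map]
  rfl

lemma v_one {c : Ω} (hc : c ∈ T) {z : ℂ} (hz : rr A c = res A (j z)) (h : f.eval z ≠ 0) :
    A.valuation ((F.map A.subtype).eval c) = 1 := by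
  have hcA := H.mem c hc
  rw [rr, dif_pos hcA] at hz
  have e : (F.map A.subtype).eval c = ((F.eval ⟨c, hcA⟩ : A) : Ω) := eval_map' A.subtype F ⟨c, hcA⟩
  rw [e]
  apply v_eq_one
  rw [← eval_map', H.hF, hz]
  have := eval_map' ((res A).comp j) f z
  simp only [RingHom.comp_apply] at this
  rw [this]
  exact (map_ne_zero ((res A).comp j)).2 h

lemma rho_regular (h : ∀ r, ¬ IsBase f g r) : A.valuation (rho d (F.map A.subtype) T lg) = 1 := by
  rw [H.v_rho]
  apply Multiset.prod_eq_one
  intro x hx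
  obtain ⟨c, hc, rfl⟩ := Multiset.mem_map.1 hx
  obtain ⟨z, hz, hr⟩ := H.roots.ex c hc (H.mem c hc)
  exact H.v_one hc hr (fun h' => h z ⟨h', hz⟩)

omit H in
lemma prod_ite_const {α M : Type*} [CommMonoid M] (T : Multiset α) (P : α → Prop) (x : M) :
    (T.map (fun c => if P c then x else 1)).prod = x ^ (T.filter P).card := by
  induction T using Multiset.induction_on with
  | empty => simp
  | cons c T ih =>
    by_cases h : P c <;> simp [h, ih, pow_succ']

lemma rho_base (D : LD A j f g f1 g1 F G F1 G1 s) {r : ℂ} (L : LocB d f g f1 g1 r) :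
    A.valuation (rho d (F.map A.subtype) T lg) = A.valuation (s : Ω) := by
  have inj := ((res A).comp j).injective
  have : CharZero (IsLocalRing.ResidueField A) :=
    charZero_of_injective_ringHom ((res A).comp j).injective
  rw [H.v_rho]
  have hm : g.rootMultiplicity r = 1 := by
    apply le_antisymm
    · by_contra h
      obtain ⟨w, hw⟩ := (le_rootMultiplicity_iff H.g0 (a := r) (n := 2)).1 (by omega)
      apply L.gt
      rw [tc_one, hw]
      simp [derivative_mul, derivative_pow]
    · exact (rootMultiplicity_pos H.g0).2 L.base.2
  have e : ∀ c ∈ T, A.valuation ((F.map A.subtype).eval c) =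
      if rr A c = res A (j r) then A.valuation (s : Ω) else 1 := by
    intro c hc
    have hcA := H.mem c hc
    split_ifs with hr
    · rw [rr, dif_pos hcA] at hr
      obtain ⟨u, w, hu, hu0, hw0⟩ := locBaseRes (res A) j D.hs D.eF D.eG D.hF1 D.hG1 L hr
        (H.root hc hcA)
      have e : (F.map A.subtype).eval c = ((F.eval ⟨c, hcA⟩ : A) : Ω) := eval_map' A.subtype F ⟨c, hcA⟩
      have := congrArg (fun x : A => A.valuation (x : Ω)) hu
      simp only [MulMemClass.coe_mul, map_mul, v_eq_one A hu0, v_eq_one A hw0, one_mul, mul_one] at this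
      rw [e, this]
    · obtain ⟨z, hz, hr'⟩ := H.roots.ex c hc hcA
      refine H.v_one hc hr' fun h => hr ?_
      rw [← L.uniq z ⟨h, hz⟩]; exact hr'
  rw [Multiset.map_congr rfl e, prod_ite_const]
  have := H.roots.mult r
  rw [Multiset.filter_eq_self.2 H.mem, hm] at this
  have t : (T.filter (fun c => rr A c = res A (j r))).card = 1 := this
  rw [t, pow_one]
end RD
end
end VR
end
end Part11

section Part12
open Polynomial
noncomputable section

namespace VR
open Classical

variable {Ω : Type*} [Field Ω]

lemma place_exists {ψ : ℂ[X] →+* Ω} (hψ : Function.Injective ψ) (a : ℂ) :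
    ∃ A : ValuationSubring Ω, (∀ p, ψ p ∈ A) ∧ A.valuation (ψ (X - C a)) < 1 := by
  set I : Ideal ψ.range := (Ideal.span {X - C a}).map ψ.rangeRestrict with hI
  have hne : I ≠ ⊤ := by
    rw [Ne, Ideal.eq_top_iff_one]
    intro h
    obtain ⟨p, hp, h1⟩ := (Ideal.mem_map_iff_of_surjective _ ψ.rangeRestrict_surjective).1 h
    have : p = 1 := by
      apply hψ
      have := congrArg Subtype.val h1
      simpa using this
    rw [this, Ideal.mem_span_singleton] at hp
    exact not_isUnit_X_sub_C a (isUnit_of_dvd_one hp)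
  obtain ⟨B, h1, h2⟩ := Ideal.image_subset_nonunits_valuationSubring I hne
  refine ⟨B, fun p => h1 ⟨p, rfl⟩, ?_⟩
  rw [← ValuationSubring.mem_nonunits_iff]
  apply h2
  exact ⟨ψ.rangeRestrict (X - C a), Ideal.mem_map_of_mem _ (Ideal.mem_span_singleton_self _), rfl⟩

/-- A valuation ring containing the image of `ψ` and dominating the point `a`. -/
structure Pl (ψ : ℂ[X] →+* Ω) (a : ℂ) (A : ValuationSubring Ω) : Prop where
  mem : ∀ p, ψ p ∈ A
  lt : A.valuation (ψ (X - C a)) < 1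

namespace Pl
variable {ψ : ℂ[X] →+* Ω} {a : ℂ} {A : ValuationSubring Ω} (P : Pl ψ a A)

def cod : ℂ[X] →+* A := ψ.codRestrict A.toSubring P.mem

def jj : ℂ →+* A := P.cod.comp C

def ss : A := P.cod (X - C a)

lemma coe_cod (p : ℂ[X]) : ((P.cod p : A) : Ω) = ψ p := rfl

lemma res_ss : res A P.ss = 0 := by
  rw [IsLocalRing.residue_eq_zero_iff, A.valuation_lt_one_iff]
  exact P.lt

lemma res_cod (p : ℂ[X]) : res A (P.cod p) = res A (P.jj (p.eval a)) := by
  obtain ⟨q, hq⟩ := X_sub_C_dvd_sub_C_eval (p := p) (a := a)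
  have e : p = C (p.eval a) + (X - C a) * q := by rw [← hq]; ring
  conv_lhs => rw [e]
  rw [map_add, map_mul, map_add, map_mul]
  have := P.res_ss
  rw [ss] at this
  rw [this, zero_mul, add_zero]
  rfl

include P in
lemma v_unit (p : ℂ[X]) (h : p.eval a ≠ 0) : A.valuation (ψ p) = 1 := by
  rw [← P.coe_cod]
  apply v_eq_one
  rw [P.res_cod]
  exact (map_ne_zero ((res A).comp P.jj)).2 h

include P in
lemma v_pow {p : ℂ[X]} (hp : p ≠ 0) : A.valuation (ψ p) = A.valuation (ψ (X - C a)) ^ p.rootMultiplicity a := by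
  obtain ⟨q, hq, hn⟩ := exists_eq_pow_rootMultiplicity_mul_and_not_dvd p hp a
  have : q.eval a ≠ 0 := fun h => hn (dvd_iff_isRoot.2 h)
  conv_lhs => rw [hq]
  rw [map_mul, map_mul, P.v_unit q this, mul_one, map_pow, map_pow]

lemma hF (φ : ℂ[X][X]) : (φ.map P.cod).map (res A) = (sl a φ).map ((res A).comp P.jj) := by
  ext n
  simp only [coeff_map, P.res_cod, sl, RingHom.comp_apply, coe_evalRingHom]

lemma map_sub (φ : ℂ[X][X]) : (φ.map P.cod).map A.subtype = φ.map ψ := by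
  rw [Polynomial.map_map]; rfl

/-- remainder -/
def R1 (d : ℕ) (φ : ℂ[X][X]) : A[X] := ((sl1 d a φ).map P.jj) + C P.ss *
  ∑ i : JJ2 d, C (P.jj (((Polynomial.taylor a) (φ.coeff ↑i.fst)).coeff (↑i.snd + 2)) * P.ss ^ ((i.2 : ℕ)))
    * X ^ (i.1 : ℕ)

lemma eF {d : ℕ} {φ : ℂ[X][X]} (h : InV d φ) :
    φ.map P.cod = (sl a φ).map P.jj + C P.ss * P.R1 d φ := by
  conv_lhs => rw [expand_eq h a]
  rw [Polynomial.map_add, Polynomial.map_add, Polynomial.map_mul, map_C, Polynomial.map_map,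
    Polynomial.map_map, R1, mul_add, add_assoc, expand2, Polynomial.map_sum]
  congr 2
  rw [Finset.mul_sum, Finset.mul_sum]
  refine Finset.sum_congr rfl fun i _ => ?_
  rw [Polynomial.map_mul, map_C, Polynomial.map_pow, map_X, map_mul, map_pow, ← mul_assoc, ← mul_assoc,
    ← C_mul, ← C_mul]
  congr 2
  simp only [jj, ss, RingHom.comp_apply]
  ring

lemma hF1 (d : ℕ) (φ : ℂ[X][X]) : (P.R1 d φ).map (res A) = (sl1 d a φ).map ((res A).comp P.jj) := by
  rw [R1, Polynomial.map_add, Polynomial.map_mul, map_C, P.res_ss, Polynomial.map_map]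
  simp

lemma ld {d : ℕ} {φ γ : ℂ[X][X]} (h : InV d φ) (h' : InV d γ) :
    LD A P.jj (sl a φ) (sl a γ) (sl1 d a φ) (sl1 d a γ) (φ.map P.cod) (γ.map P.cod) (P.R1 d φ)
      (P.R1 d γ) P.ss :=
  ⟨P.res_ss, P.eF h, P.eF h', P.hF1 d φ, P.hF1 d γ⟩
end Pl

/-- Global data. -/
structure GD (ψ : ℂ[X] →+* Ω) (d : ℕ) (φ γ : ℂ[X][X]) (S : Finset Ω) (lc : Ω) (T : Multiset Ω) (lg : Ω) : Prop where
  inj : Function.Injective ψ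
  hd : 3 ≤ d
  hφ : InV d φ
  hγ : InV d γ
  good : Good d φ γ
  card : S.card = 2 * d - 2
  fac : (wronskian (φ.map ψ) (γ.map ψ)) = C lc * ∏ c ∈ S, (X - C c)
  cardT : T.card = d
  facT : γ.map ψ = C lg * (T.map (fun c => X - C c)).prod

namespace GD
variable {ψ : ℂ[X] →+* Ω} {d : ℕ} {φ γ : ℂ[X][X]} {S : Finset Ω} {lc : Ω} {T : Multiset Ω} {lg : Ω}
  (H : GD ψ d φ γ S lc T lg) {a : ℂ} {A : ValuationSubring Ω} (P : Pl ψ a A)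
include H

lemma lp : LP A P.jj d (sl a φ) (sl a γ) (φ.map P.cod) (γ.map P.cod) S lc where
  hd := H.hd
  hF := P.hF φ
  hG := P.hF γ
  dF := natDegree_map_le.trans H.hφ.natDegree_le
  dG := natDegree_map_le.trans H.hγ.natDegree_le
  card := H.card
  fac := by rw [← wr_map, P.map_sub, P.map_sub, H.fac]
  L := (H.good.mov a).locC H.hd

lemma rd : RD A P.jj d (sl a φ) (sl a γ) (φ.map P.cod) (γ.map P.cod) T lg where
  hF := P.hF φ
  hG := P.hF γ
  gd := ((H.good.mov a).locC H.hd).gd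
  dg := ((H.good.mov a).locC H.hd).dg
  card := H.cardT
  fac := by rw [P.map_sub, H.facT]

include P in
lemma fin_node (h : IsNode (sl a φ) (sl a γ)) :
    A.valuation (Theta d (φ.map ψ) (γ.map ψ) S lc) = A.valuation (ψ (X - C a)) ^ 2 ∧
    A.valuation (rho d (φ.map ψ) T lg) = 1 := by
  obtain ⟨l, p, q, hpq, h⟩ := h
  have L := (H.good.mov a).locN (H.hφ.sl1_degree a) (H.hγ.sl1_degree a) (H.good.tn a) hpq h
  have h1 := (H.lp P).theta_node (P.ld H.hφ H.hγ) L
  have h2 := (H.rd P).rho_regular L.nb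
  rw [P.map_sub] at h1 h2
  rw [P.map_sub] at h1
  exact ⟨h1, h2⟩

include P in
lemma fin_not_node (h : ¬ IsNode (sl a φ) (sl a γ)) :
    A.valuation (Theta d (φ.map ψ) (γ.map ψ) S lc) =
      A.valuation (rho d (φ.map ψ) T lg) ^ (4 * d - 8) ∧ A.valuation (rho d (φ.map ψ) T lg) ≠ 0 := by
  by_cases hb : ∃ r, IsBase (sl a φ) (sl a γ) r
  · obtain ⟨r, hr⟩ := hb
    have L := (H.good.mov a).locB H.hd (H.hφ.sl1_degree a) (H.hγ.sl1_degree a) (H.good.tb a) hr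
    have h1 := (H.lp P).theta_base (P.ld H.hφ H.hγ) L
    have h2 := (H.rd P).rho_base (P.ld H.hφ H.hγ) L
    rw [P.map_sub] at h1 h2
    rw [P.map_sub] at h1
    rw [h1, h2]
    refine ⟨rfl, ?_⟩
    rw [Valuation.ne_zero_iff]
    exact (_root_.map_ne_zero_iff ψ H.inj).2 (X_sub_C_ne_zero a)
  · push Not at hb
    have h1 := (H.lp P).theta_regular (fun z w hzw hz hw => (H.good.mov a).regular h hb hzw hz hw)
    have h2 := (H.rd P).rho_regular hb
    rw [P.map_sub] at h1 h2
    rw [P.map_sub] at h1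
    rw [h1, h2]
    simp
end GD
end VR
end
end Part12

section Part13
open Polynomial
noncomputable section

lemma LocI.locC {d : ℕ} {f g : ℂ[X]} (L : LocI d f g) : LocC d f g where
  gd := L.gd
  df := L.df
  dg := L.dg
  deg := by have := le_natDegree_of_ne_zero L.lc; omega
  W0 := by intro h; exact L.lc (by rw [h, coeff_zero])
  R3 := fun z h => absurd h (L.simple z)
  R4 := fun h => absurd h L.lc

namespace VR
open Classical

variable {Ω : Type*} [Field Ω]

def flp (d : ℕ) (φ : ℂ[X][X]) : ℂ[X][X] :=
  ∑ j ∈ Finset.range (d + 1), C (reflect (d - j) (φ.coeff j)) * X ^ j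

lemma flp_coeff (d : ℕ) (φ : ℂ[X][X]) (j : ℕ) : (flp d φ).coeff j =
    if j ≤ d then reflect (d - j) (φ.coeff j) else 0 := by
  simp [flp, finset_sum_coeff, coeff_C_mul, coeff_X_pow, Nat.lt_succ_iff]

lemma flp_natDegree (d : ℕ) (φ : ℂ[X][X]) : (flp d φ).natDegree ≤ d := by
  rw [natDegree_le_iff_coeff_eq_zero]
  intro j hj
  rw [flp_coeff, if_neg (by omega)]

lemma sl_flp (d : ℕ) (φ : ℂ[X][X]) : sl 0 (flp d φ) = slInf d φ := by
  ext j
  rw [sl, coeff_map, flp_coeff]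
  split_ifs with h
  · rw [slInf_coeff d φ h, coe_evalRingHom, ← coeff_zero_eq_eval_zero, coeff_reflect]
    simp
  · rw [map_zero, coeff_eq_zero_of_degree_lt]
    refine (slInf_degree φ).trans_le ?_
    exact_mod_cast (by omega : d + 1 ≤ j)

variable (α : ℂ[X] →+* Ω)

def pinf : ℂ[X] →+* Ω := eval₂RingHom (α.comp C) (α X)⁻¹

lemma pinf_X : pinf α X = (α X)⁻¹ := by simp [pinf]

lemma al_eval (p : ℂ[X]) : eval₂ (α.comp C) (α X) p = α p := by
  have : eval₂RingHom (α.comp C) (α X) = α := by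
    apply ringHom_ext <;> simp
  exact RingHom.congr_fun this p

variable {α} (hα : Function.Injective α)
include hα

lemma x_ne : α X ≠ 0 := (_root_.map_ne_zero_iff α hα).2 X_ne_zero

lemma pinf_reflect {p : ℂ[X]} {n : ℕ} (h : p.natDegree ≤ n) :
    pinf α (reflect n p) * (α X) ^ n = α p := by
  letI : Invertible (α X) := invertibleOfNonzero (x_ne hα)
  have := eval₂_reflect_mul_pow (α.comp C) (α X) n p h
  rw [al_eval, invOf_eq_inv] at this
  exact this

lemma pinf_inj : Function.Injective (pinf α) := by
  rw [injective_iff_map_eq_zero]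
  intro p hp
  have := pinf_reflect hα (p := reflect p.natDegree p) (n := p.natDegree)
    (by
      rw [natDegree_le_iff_coeff_eq_zero]
      intro j hj
      rw [coeff_reflect, revAt_eq_self_of_lt hj]
      exact coeff_eq_zero_of_natDegree_lt hj)
  have hinv : reflect p.natDegree (reflect p.natDegree p) = p := by
    ext j; simp [coeff_reflect]
  rw [hinv, hp, zero_mul] at this
  have h0 : reflect p.natDegree p = 0 := hα (by rw [← this, map_zero])
  exact (reflect_eq_zero_iff).1 h0

lemma map_flp {d : ℕ} {φ : ℂ[X][X]} (h : InV d φ) : (flp d φ).map (pinf α) =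
    C ((α X)⁻¹ ^ d) * (φ.map α).comp (C (α X) * X) := by
  ext j
  have hx := x_ne hα
  rw [coeff_map, flp_coeff, coeff_C_mul, comp_C_mul_X_coeff, coeff_map]
  split_ifs with hj
  · have := pinf_reflect hα (h.natDegree_coeff j)
    rw [← this]
    obtain ⟨e, rfl⟩ : ∃ e, d = e + j := ⟨d - j, by omega⟩
    simp only [Nat.add_sub_cancel, inv_pow, pow_add]
    field_simp
  · rw [h.coeff_eq_zero (by omega)]; simp

omit hα in
lemma wr_comp (f g : Polynomial Ω) (k x : Ω) : wronskian (C k * f.comp (C x * X)) (C k * g.comp (C x * X)) =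
    C (k ^ 2 * x) * (wronskian f g).comp (C x * X) := by
  simp only [wronskian, derivative_mul, derivative_C, derivative_comp, derivative_X, sub_comp, mul_comp, C_mul,
    C_pow]
  ring

omit hα in
lemma prod_comp {x : Ω} (hx : x ≠ 0) (T : Multiset Ω) :
    ((T.map (fun c => X - C c)).prod).comp (C x * X) =
      C (x ^ T.card) * ((T.map (· * x⁻¹)).map (fun c => X - C c)).prod := by
  induction T using Multiset.induction_on with
  | empty => simp
  | cons c T ih =>
    simp only [Multiset.map_cons, Multiset.prod_cons, mul_comp, ih, Multiset.card_cons, pow_succ, C_mul,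
      sub_comp, X_comp, C_comp]
    have : C x * X - C c = C x * (X - C (c * x⁻¹)) := by
      rw [mul_sub, ← C_mul, mul_comm c, mul_inv_cancel_left₀ hx]
    rw [C_mul] at this
    rw [this]; ring

lemma v_inf {A : ValuationSubring Ω} (P : Pl (pinf α) 0 A) {p : ℂ[X]} (hp : p ≠ 0) :
    A.valuation (α p) = A.valuation (α X) ^ p.natDegree := by
  rw [← pinf_reflect hα le_rfl, map_mul, map_pow, P.v_unit, one_mul]
  rw [← coeff_zero_eq_eval_zero, coeff_reflect]
  simpa using hp

lemma x_gt {A : ValuationSubring Ω} (P : Pl (pinf α) 0 A) : 1 < A.valuation (α X) := by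
  have h := P.lt
  rw [C_0, sub_zero, pinf_X, map_inv₀] at h
  exact (inv_lt_one₀ (zero_lt_iff.2 ((Valuation.ne_zero_iff _).2 (x_ne hα)))).1 h

section
variable {d : ℕ} {φ γ : ℂ[X][X]} (hd : 3 ≤ d) (hφ : InV d φ) (hγ : InV d γ) (good : Good d φ γ)
include hd hφ hγ good

lemma inf_fac {T : Multiset Ω} {lc : Ω}
    (h : wronskian (φ.map α) (γ.map α) = C lc * (T.map (fun c => X - C c)).prod) :
    wronskian ((flp d φ).map (pinf α)) ((flp d γ).map (pinf α)) =
      C ((α X)⁻¹ ^ (2 * d) * (α X) * (α X) ^ T.card * lc) *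
        ((T.map (· * (α X)⁻¹)).map (fun c => X - C c)).prod := by
  rw [map_flp hα hφ, map_flp hα hγ, wr_comp, h, mul_comp, C_comp, prod_comp (x_ne hα)]
  simp only [C_mul, C_pow]
  ring

lemma inf_roots {A : ValuationSubring Ω} (P : Pl (pinf α) 0 A) {T : Multiset Ω} {lc : Ω}
    (h : wronskian (φ.map α) (γ.map α) = C lc * (T.map (fun c => X - C c)).prod) :
    2 * d - 2 ≤ T.card ∧ (2 * d - 2 = T.card → T.Nodup) := by
  have L := good.inf.locI hd
  have h1 := inf_fac hα hd hφ hγ good h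
  rw [← P.map_sub, ← P.map_sub, wr_map] at h1
  have R := VR.roots A (ι := (res A).comp P.jj) h1 L.locC.W0 (by
    rw [← wr_map, ← wr_map, P.hF, P.hF, sl_flp, sl_flp])
  have hdeg := le_natDegree_of_ne_zero L.lc
  have hc := R.card
  have hle : Multiset.card (Multiset.filter (· ∈ A) (T.map (· * (α X)⁻¹))) ≤ T.card := by
    have := Multiset.card_le_card (Multiset.filter_le (· ∈ A) (T.map (· * (α X)⁻¹)))
    rwa [Multiset.card_map] at this
  refine ⟨by omega, fun hT => ?_⟩
  have hall : Multiset.filter (· ∈ A) (T.map (· * (α X)⁻¹)) = T.map (· * (α X)⁻¹) := by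
    apply Multiset.eq_of_le_of_card_le (Multiset.filter_le _ _)
    rw [Multiset.card_map]; omega
  apply Multiset.Nodup.of_map (· * (α X)⁻¹)
  rw [Multiset.nodup_iff_count_le_one]
  intro c
  by_cases hcm : c ∈ T.map (· * (α X)⁻¹)
  · have hcA := Multiset.filter_eq_self.1 hall c hcm
    obtain ⟨z, hz, hr⟩ := R.ex c hcm hcA
    have hm := R.mult z
    rw [hall] at hm
    have h1 : (wronskian (slInf d φ) (slInf d γ)).rootMultiplicity z ≤ 1 := by
      by_contra h
      exact L.simple z ((le_rootMultiplicity_iff L.locC.W0).1 (by omega))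
    rw [← hm] at h1
    refine le_trans ?_ h1
    rw [Multiset.count_eq_card_filter_eq]
    apply Multiset.card_le_card
    apply Multiset.monotone_filter_right
    rintro b rfl
    exact hr
  · rw [Multiset.count_eq_zero_of_notMem hcm]; omega

omit hα hd hφ hγ good in
lemma theta_scale {x : Ω} (hx : x ≠ 0) (f g : Polynomial Ω) {S : Finset Ω} (lc lc' : Ω) (h : lc' * x = lc)
    (hd : 3 ≤ d) : Theta d (C (x⁻¹ ^ d) * f.comp (C x * X)) (C (x⁻¹ ^ d) * g.comp (C x * X))
      (S.image (· * x⁻¹)) lc' * x ^ ((d - 3) * (2 * (2 * d - 3)) + (2 * d - 3) * S.offDiag.card) =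
      Theta d f g S lc := by
  have inj : Function.Injective (· * x⁻¹) := mul_left_injective₀ (inv_ne_zero hx)
  have e1 : (S.image (· * x⁻¹)).offDiag = S.offDiag.image (Prod.map (· * x⁻¹) (· * x⁻¹)) := by
    ext ⟨a, b⟩
    simp only [Finset.mem_offDiag, Finset.mem_image, Prod.exists, Prod.map_apply, Prod.mk.injEq]
    constructor
    · rintro ⟨⟨a, ha, rfl⟩, ⟨b, hb, rfl⟩, hab⟩
      exact ⟨a, b, ⟨ha, hb, fun h => hab (by rw [h])⟩, rfl, rfl⟩
    · rintro ⟨a, b, ⟨ha, hb, hab⟩, rfl, rfl⟩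
      exact ⟨⟨a, ha, rfl⟩, ⟨b, hb, rfl⟩, fun h => hab (inj h)⟩
  rw [Theta, Theta, e1, Finset.prod_image (fun _ _ _ _ h => inj.prodMap inj h), ← h, pow_add, mul_pow, pow_mul x (2 * d - 3),
    ← Finset.prod_const]
  rw [mul_mul_mul_comm, ← Finset.prod_mul_distrib]
  congr 1
  refine Finset.prod_congr rfl fun c hc => ?_
  have hne : c.1 - c.2 ≠ 0 := sub_ne_zero.2 (Finset.mem_offDiag.1 hc).2.2
  have e2 : ∀ c, x * (c * x⁻¹) = c := fun c => by field_simp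
  simp only [AA, Prod.map_fst, Prod.map_snd, eval_mul, eval_C, eval_comp, eval_X, e2, ← sub_mul]
  obtain ⟨e, rfl⟩ : ∃ e, d = e + 3 := ⟨d - 3, by omega⟩
  rw [show 2 * (e + 3) - 3 = 2 * e + 3 by omega]
  simp only [inv_pow]
  field_simp
  ring

omit hα hd hφ hγ good in
lemma rho_scale {x : Ω} (hx : x ≠ 0) (f : Polynomial Ω) {T : Multiset Ω} (lg : Ω) (hT : T.card = d) :
    rho d (C (x⁻¹ ^ d) * f.comp (C x * X)) (T.map (· * x⁻¹)) lg * x ^ (d * d) = rho d f T lg := by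
  rw [rho, rho, Multiset.map_map]
  have e2 : ∀ c, x * (c * x⁻¹) = c := fun c => by field_simp
  simp only [Function.comp_def, eval_mul, eval_C, eval_comp, eval_X, e2]
  rw [Multiset.prod_map_mul, Multiset.map_const', Multiset.prod_replicate, hT]
  rw [← pow_mul]
  have : x⁻¹ ^ (d * d) * x ^ (d * d) = 1 := by rw [← mul_pow, inv_mul_cancel₀ hx, one_pow]
  linear_combination (lg ^ d * (T.map fun c => f.eval c).prod) * this

end

variable {d : ℕ} {φ γ : ℂ[X][X]} {S : Finset Ω} {lc : Ω} {T : Multiset Ω} {lg : Ω}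
omit hα in
lemma GD.inf (H : GD α d φ γ S lc T lg) {A : ValuationSubring Ω} (P : Pl (pinf α) 0 A) :
    A.valuation (Theta d (φ.map α) (γ.map α) S lc) =
      A.valuation (α X) ^ ((d - 3) * (2 * (2 * d - 3)) + (2 * d - 3) * S.offDiag.card) ∧
    A.valuation (rho d (φ.map α) T lg) = A.valuation (α X) ^ (d * d) := by
  have hα := H.inj
  have hx := x_ne hα
  have L := H.good.inf.locI H.hd
  have inj : Function.Injective (· * (α X)⁻¹) := mul_left_injective₀ (inv_ne_zero hx)
  have h1 := inf_fac hα H.hd H.hφ H.hγ H.good (T := S.val) H.fac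
  have hdd := H.hd
  constructor
  · rw [← theta_scale hx (φ.map α) (γ.map α) lc
      ((α X)⁻¹ ^ (2 * d) * (α X) * (α X) ^ S.card * lc) ?_ H.hd]
    · rw [← map_flp hα H.hφ, ← map_flp hα H.hγ, map_mul, map_pow, ← P.map_sub, ← P.map_sub]
      rw [LP.theta_regular (j := P.jj) (f := slInf d φ) (g := slInf d γ), one_mul]
      · exact ⟨H.hd, by rw [P.hF, sl_flp], by rw [P.hF, sl_flp],
          natDegree_map_le.trans (flp_natDegree d φ), natDegree_map_le.trans (flp_natDegree d γ),
          by rw [Finset.card_image_of_injective _ inj, H.card], by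
            rw [← wr_map, P.map_sub, P.map_sub, h1, Finset.prod_image (fun _ _ _ _ h => inj h)]
            rw [Multiset.map_map]; rfl, L.locC⟩
      · exact L.A
    · rw [H.card]
      obtain ⟨e, rfl⟩ : ∃ e, d = e + 3 := ⟨d - 3, by omega⟩
      rw [show 2 * (e + 3) - 2 = 2 * e + 4 by omega]
      field_simp
      rw [one_div, inv_pow]
      field_simp
      ring
  · rw [← rho_scale hx (φ.map α) lg H.cardT, ← map_flp hα H.hφ, map_mul, map_pow, ← P.map_sub]
    rw [RD.rho_regular (j := P.jj) (f := slInf d φ) (g := slInf d γ) (G := (flp d γ).map P.cod), one_mul]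
    · exact ⟨by rw [P.hF, sl_flp], by rw [P.hF, sl_flp], L.gd, L.dg, by rw [Multiset.card_map, H.cardT], by
        rw [P.map_sub, map_flp hα H.hγ, H.facT, mul_comp, C_comp, prod_comp hx, H.cardT, ← mul_assoc,
          ← mul_assoc, ← C_mul, ← C_mul]
        congr 2
        rw [inv_pow]
        field_simp⟩
    · exact L.nb
end VR
end
end Part13

section Part14
open Polynomial
noncomputable section

namespace VR
open Classical

lemma gd_exists {Ω : Type*} [Field Ω] [IsAlgClosed Ω] [CharZero Ω] {α : ℂ[X] →+* Ω}
    (hα : Function.Injective α) {d : ℕ} {φ γ : ℂ[X][X]} (hd : 3 ≤ d) (hφ : InV d φ) (hγ : InV d γ)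
    (good : Good d φ γ) : GD α d φ γ (wronskian (φ.map α) (γ.map α)).roots.toFinset
      (wronskian (φ.map α) (γ.map α)).leadingCoeff (γ.map α).roots (γ.map α).leadingCoeff := by
  have hγd : (γ.map α).coeff d ≠ 0 := by
    rw [coeff_map, _root_.map_ne_zero_iff α hα]
    intro h
    exact good.gd (by rw [h, coeff_zero])
  have df : (φ.map α).natDegree ≤ d := natDegree_map_le.trans hφ.natDegree_le
  have dg : (γ.map α).natDegree ≤ d := natDegree_map_le.trans hγ.natDegree_le
  have hdeg := (wr_natDegree hd df dg hγd).1
  have fac := (IsAlgClosed.splits (wronskian (φ.map α) (γ.map α))).eq_prod_roots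
  obtain ⟨A, h1, h2⟩ := place_exists (pinf_inj hα) 0
  obtain ⟨h3, h4⟩ := inf_roots hα hd hφ hγ good ⟨h1, h2⟩ fac
  have hc : (wronskian (φ.map α) (γ.map α)).roots.card = 2 * d - 2 :=
    le_antisymm ((card_roots' _).trans hdeg) h3
  have nd := h4 hc.symm
  refine ⟨hα, hd, hφ, hγ, good, ?_, ?_, ?_, (IsAlgClosed.splits _).eq_prod_roots⟩
  · rw [Multiset.toFinset_card_of_nodup nd, hc]
  · conv_lhs => rw [fac]
    rw [Finset.prod, Multiset.toFinset_val, Multiset.dedup_eq_self.2 nd]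
  · rw [IsAlgClosed.card_roots_eq_natDegree]
    exact le_antisymm dg (le_natDegree_of_ne_zero hγd)

section
variable {K Ω : Type*} [Field K] [Field Ω] [Algebra K Ω] (σ : Ω ≃ₐ[K] Ω)

lemma theta_inv {d : ℕ} {F G : Polynomial Ω} {S : Finset Ω} {lc : Ω} (hF : F.map (σ : Ω →+* Ω) = F)
    (hG : G.map (σ : Ω →+* Ω) = G) (hS : ∀ c, c ∈ S ↔ σ c ∈ S) (hlc : σ lc = lc) :
    σ (Theta d F G S lc) = Theta d F G S lc := by
  rw [Theta, map_mul, map_pow, hlc, map_prod]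
  congr 1
  refine Finset.prod_bij' (fun c _ => (σ c.1, σ c.2)) (fun c _ => (σ.symm c.1, σ.symm c.2)) ?_ ?_ ?_ ?_ ?_
  · intro c hc
    rw [Finset.mem_offDiag] at hc ⊢
    exact ⟨(hS _).1 hc.1, (hS _).1 hc.2.1, fun h => hc.2.2 (σ.injective h)⟩
  · intro c hc
    rw [Finset.mem_offDiag] at hc ⊢
    exact ⟨(hS _).2 (by simpa using hc.1), (hS _).2 (by simpa using hc.2.1), fun h => hc.2.2 (σ.symm.injective h)⟩
  · intro c _; simp
  · intro c _; simp
  · intro c _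
    have := AA_map (σ : Ω →+* Ω) F G c.1 c.2
    rw [hF, hG] at this
    rw [map_div₀, map_pow, map_sub]
    simp only [RingHom.coe_coe] at this
    rw [this]

lemma rho_inv {d : ℕ} {F : Polynomial Ω} {T : Multiset Ω} {lg : Ω} (hF : F.map (σ : Ω →+* Ω) = F)
    (hT : T.map σ = T) (hlg : σ lg = lg) : σ (rho d F T lg) = rho d F T lg := by
  rw [rho, map_mul, map_pow, hlg, map_multiset_prod, Multiset.map_map]
  congr 2
  conv_rhs => rw [← hT]
  rw [Multiset.map_map]
  apply Multiset.map_congr rfl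
  intro c _
  have := eval_map' (σ : Ω →+* Ω) F c
  rw [hF] at this
  exact this.symm
end

abbrev KK := FractionRing ℂ[X]
abbrev OO := AlgebraicClosure KK
def al : ℂ[X] →+* OO := (algebraMap KK OO).comp (algebraMap ℂ[X] KK)

lemma al_inj : Function.Injective al :=
  (algebraMap KK OO).injective.comp (IsFractionRing.injective ℂ[X] KK)

lemma map_al (σ : OO ≃ₐ[KK] OO) (φ : ℂ[X][X]) : (φ.map al).map (σ : OO →+* OO) = φ.map al := by
  rw [Polynomial.map_map]
  congr 1
  ext <;> simp [al]

lemma exists_frac {d : ℕ} {φ γ : ℂ[X][X]} {S : Finset OO} {lc : OO} {T : Multiset OO} {lg : OO}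
    (hS : S = (wronskian (φ.map al) (γ.map al)).roots.toFinset)
    (hlc : lc = (wronskian (φ.map al) (γ.map al)).leadingCoeff) (hT : T = (γ.map al).roots)
    (hlg : lg = (γ.map al).leadingCoeff) (m : ℕ) (h1 : Theta d (φ.map al) (γ.map al) S lc ≠ 0)
    (h2 : rho d (φ.map al) T lg ≠ 0) : ∃ p q : ℂ[X], p ≠ 0 ∧ q ≠ 0 ∧
      al p * rho d (φ.map al) T lg ^ m = Theta d (φ.map al) (γ.map al) S lc * al q := by
  have hW : ∀ σ : OO ≃ₐ[KK] OO, (wronskian (φ.map al) (γ.map al)).map (σ : OO →+* OO) =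
      wronskian (φ.map al) (γ.map al) := by
    intro σ; rw [← wr_map, map_al, map_al]
  have lead : ∀ (σ : OO ≃ₐ[KK] OO) (p : Polynomial OO), p.map (σ : OO →+* OO) = p →
      σ p.leadingCoeff = p.leadingCoeff := by
    intro σ p hp
    have := congrArg (fun q => q.coeff p.natDegree) hp
    simp only [coeff_map] at this
    exact this
  have rts : ∀ (σ : OO ≃ₐ[KK] OO) (p : Polynomial OO), p.map (σ : OO →+* OO) = p →
      p.roots.map σ = p.roots := by
    intro σ p hp
    have := (IsAlgClosed.splits p).roots_map (σ : OO →+* OO)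
    rw [hp] at this
    exact this.symm
  have f1 : ∀ σ : OO ≃ₐ[KK] OO, σ (Theta d (φ.map al) (γ.map al) S lc) = Theta d (φ.map al) (γ.map al) S lc := by
    intro σ
    apply theta_inv σ (map_al σ φ) (map_al σ γ)
    · intro c
      rw [hS, Multiset.mem_toFinset, Multiset.mem_toFinset]
      conv_rhs => rw [← rts σ _ (hW σ)]
      rw [Multiset.mem_map_of_injective σ.injective]
    · rw [hlc]; exact lead σ _ (hW σ)
  have f2 : ∀ σ : OO ≃ₐ[KK] OO, σ (rho d (φ.map al) T lg) = rho d (φ.map al) T lg := by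
    intro σ
    apply rho_inv σ (map_al σ φ)
    · rw [hT]; exact rts σ _ (map_al σ γ)
    · rw [hlg]; exact lead σ _ (map_al σ γ)
  obtain ⟨θ, hθ⟩ := (InfiniteGalois.mem_range_algebraMap_iff_fixed (k := KK) _).2 f1
  obtain ⟨r, hr⟩ := (InfiniteGalois.mem_range_algebraMap_iff_fixed (k := KK) _).2 f2
  obtain ⟨p, q, hq, e⟩ := IsFractionRing.div_surjective (A := ℂ[X]) (θ / r ^ m)
  rw [← hθ] at h1
  rw [← hr] at h2
  have hθ0 : θ ≠ 0 := by rintro rfl; exact h1 (map_zero _)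
  have hr0 : r ≠ 0 := by rintro rfl; exact h2 (map_zero _)
  have hq0 : q ≠ 0 := nonZeroDivisors.ne_zero hq
  have hq1 : algebraMap ℂ[X] KK q ≠ 0 := (_root_.map_ne_zero_iff _ (IsFractionRing.injective ℂ[X] KK)).2 hq0
  refine ⟨p, q, ?_, hq0, ?_⟩
  · rintro rfl
    rw [map_zero, zero_div] at e
    exact (div_ne_zero hθ0 (pow_ne_zero m hr0)) e.symm
  · rw [← hθ, ← hr, al, RingHom.comp_apply, RingHom.comp_apply, ← map_pow, ← map_mul, ← map_mul]
    congr 1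
    field_simp at e
    rw [e, mul_comm]

theorem count {d : ℕ} {φ γ : ℂ[X][X]} (hd : 3 ≤ d) (hφ : InV d φ) (hγ : InV d γ) (good : Good d φ γ) :
    {a | IsNode (sl a φ) (sl a γ)}.Finite ∧
      (({a | IsNode (sl a φ) (sl a γ)}.ncard : ℤ) = 2 * d * (d - 2) * (d - 3)) := by
  have H := gd_exists al_inj hd hφ hγ good
  generalize hS : (wronskian (φ.map al) (γ.map al)).roots.toFinset = S at H
  generalize hlc : (wronskian (φ.map al) (γ.map al)).leadingCoeff = lc at H
  generalize hT : (γ.map al).roots = T at H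
  generalize hlg : (γ.map al).leadingCoeff = lg at H
  obtain ⟨A, m1, m2⟩ := place_exists (pinf_inj al_inj) 0
  have P : Pl (pinf al) 0 A := ⟨m1, m2⟩
  obtain ⟨i1, i2⟩ := H.inf P
  have xg := x_gt al_inj P
  have xn : A.valuation (al X) ≠ 0 := (zero_lt_one.trans xg).ne'
  have n1 : Theta d (φ.map al) (γ.map al) S lc ≠ 0 := by
    intro h; rw [h, map_zero] at i1; exact pow_ne_zero _ xn i1.symm
  have n2 : rho d (φ.map al) T lg ≠ 0 := by
    intro h; rw [h, map_zero] at i2; exact pow_ne_zero _ xn i2.symm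
  obtain ⟨p, q, hp, hq, e⟩ := exists_frac hS.symm hlc.symm hT.symm hlg.symm (4 * d - 8) n1 n2
  have hdeg : p.natDegree + d * d * (4 * d - 8) =
      ((d - 3) * (2 * (2 * d - 3)) + (2 * d - 3) * S.offDiag.card) + q.natDegree := by
    have := congrArg A.valuation e
    rw [map_mul, map_mul, map_pow, i1, i2, v_inf al_inj P hp, v_inf al_inj P hq, ← pow_mul, ← pow_add, ← pow_add]
      at this
    exact pow_right_injective₀ (zero_lt_one.trans xg) xg.ne' this
  clear i1 i2 xg xn P m1 m2 A
  have hmul : ∀ a, p.rootMultiplicity a = q.rootMultiplicity a + if IsNode (sl a φ) (sl a γ) then 2 else 0 := by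
    intro a
    obtain ⟨A, m1, m2⟩ := place_exists al_inj a
    have P : Pl al a A := ⟨m1, m2⟩
    have v0 : A.valuation (al (X - C a)) ≠ 0 :=
      (Valuation.ne_zero_iff _).2 ((_root_.map_ne_zero_iff al al_inj).2 (X_sub_C_ne_zero a))
    have inj := pow_right_injective₀ (zero_lt_iff.2 v0) m2.ne
    have := congrArg A.valuation e
    rw [map_mul, map_mul, map_pow, P.v_pow hp, P.v_pow hq] at this
    split_ifs with hn
    · obtain ⟨h1, h2⟩ := H.fin_node P hn
      rw [h1, h2, one_pow, mul_one, ← pow_add] at this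
      rw [inj this, add_comm]
    · obtain ⟨h1, h2⟩ := H.fin_not_node P hn
      rw [h1, mul_comm] at this
      exact inj (mul_left_cancel₀ (pow_ne_zero _ h2) this)
  have hsub : {a | IsNode (sl a φ) (sl a γ)} ⊆ p.roots.toFinset := by
    intro a ha
    have h1 := hmul a
    rw [if_pos (show IsNode (sl a φ) (sl a γ) from ha)] at h1
    simp only [Finset.mem_coe, Multiset.mem_toFinset, mem_roots hp]
    exact (rootMultiplicity_pos hp).1 (by omega)
  have hfin := (Finset.finite_toSet p.roots.toFinset).subset hsub
  refine ⟨hfin, ?_⟩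
  have dsum : ∀ (r : ℂ[X]) (U : Finset ℂ), r.roots.toFinset ⊆ U → r.natDegree = ∑ a ∈ U, r.rootMultiplicity a := by
    intro r U hU
    rw [← IsAlgClosed.card_roots_eq_natDegree, ← Multiset.sum_count_eq_card (s := U)
      (fun a ha => hU (Multiset.mem_toFinset.2 ha))]
    exact Finset.sum_congr rfl fun a _ => count_roots r
  have s1 := dsum p (p.roots.toFinset ∪ q.roots.toFinset) Finset.subset_union_left
  have s2 := dsum q (p.roots.toFinset ∪ q.roots.toFinset) Finset.subset_union_right
  have hcount : p.natDegree = q.natDegree + 2 * {a | IsNode (sl a φ) (sl a γ)}.ncard := by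
    rw [s1, s2, Finset.sum_congr rfl (fun a _ => hmul a), Finset.sum_add_distrib]
    congr 1
    rw [← Finset.sum_filter, Finset.sum_const, smul_eq_mul, mul_comm]
    congr 1
    rw [← Set.ncard_coe_finset]
    congr 1
    ext a
    simp only [Finset.coe_filter, Set.mem_setOf_eq]
    exact ⟨fun h => h.2, fun h => ⟨Finset.mem_union_left _ (by simpa using hsub h), h⟩⟩
  rw [Finset.offDiag_card, H.card] at hdeg
  generalize {a | IsNode (sl a φ) (sl a γ)}.ncard = N at hcount ⊢
  generalize p.natDegree = u at *
  generalize q.natDegree = w at *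
  obtain ⟨k, rfl⟩ : ∃ k, d = k + 3 := ⟨d - 3, by omega⟩
  subst hcount
  have t1 : 4 * (k + 3) - 8 = 4 * k + 4 := by omega
  have t2 : k + 3 - 3 = k := by omega
  have t3 : 2 * (k + 3) - 3 = 2 * k + 3 := by omega
  have t4 : (2 * (k + 3) - 2) * (2 * (k + 3) - 2) - (2 * (k + 3) - 2) = (2 * k + 4) * (2 * k + 3) := by
    rw [show 2 * (k + 3) - 2 = 2 * k + 4 by omega]
    rw [show (2 * k + 4) * (2 * k + 4) = (2 * k + 4) * (2 * k + 3) + (2 * k + 4) by ring]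
    omega
  rw [t1, t2, t3, t4] at hdeg
  zify at hdeg
  push_cast
  linarith
end VR
end
end Part14

section Part15a
open Polynomial
noncomputable section

lemma linePoly_eval (F : MvPolynomial (Fin 3) ℂ) (v w : Fin 3 → ℂ) (t : ℂ) :
    (linePoly F v w).eval t = MvPolynomial.eval (v + t • w) F := by
  rw [linePoly]
  induction F using MvPolynomial.induction_on with
  | C a => simp
  | add p q h1 h2 => simp only [map_add, eval_add, h1, h2]
  | mul_X p i h => simp only [map_mul, eval_mul, h, MvPolynomial.aeval_X, MvPolynomial.eval_X]; simp [mul_comm t]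

lemma linePoly_add (F G : MvPolynomial (Fin 3) ℂ) (v w) :
    linePoly (F + G) v w = linePoly F v w + linePoly G v w := map_add _ _ _
lemma linePoly_smul (c : ℂ) (F : MvPolynomial (Fin 3) ℂ) (v w) :
    linePoly (c • F) v w = C c * linePoly F v w := by
  rw [linePoly, map_smul, smul_eq_C_mul]; rfl

/-- Directional derivative. -/
def dirD (H : MvPolynomial (Fin 3) ℂ) (v y : Fin 3 → ℂ) : ℂ :=
  ∑ i, y i * MvPolynomial.eval v (MvPolynomial.pderiv i H)

lemma dirD_add (H) (v y z : Fin 3 → ℂ) : dirD H v (y + z) = dirD H v y + dirD H v z := by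
  simp [dirD, add_mul, Finset.sum_add_distrib]
lemma dirD_smul (H) (v y : Fin 3 → ℂ) (c : ℂ) : dirD H v (c • y) = c * dirD H v y := by
  simp [dirD, Finset.mul_sum, mul_assoc]

lemma dirD_self {H : MvPolynomial (Fin 3) ℂ} {d : ℕ} (hH : H.IsHomogeneous d) (v : Fin 3 → ℂ) :
    dirD H v v = d * MvPolynomial.eval v H := by
  have := congrArg (MvPolynomial.eval v) hH.sum_X_mul_pderiv
  simpa [dirD] using this

lemma linePoly_deriv (F : MvPolynomial (Fin 3) ℂ) (v w : Fin 3 → ℂ) (t : ℂ) :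
    (derivative (linePoly F v w)).eval t = dirD F (v + t • w) w := by
  have key : derivative (linePoly F v w) = ∑ i, C (w i) * linePoly (MvPolynomial.pderiv i F) v w := by
    simp only [linePoly]
    induction F using MvPolynomial.induction_on with
    | C a => simp [← algebraMap_eq]
    | add p q h1 h2 => simp only [map_add, h1, h2, mul_add, Finset.sum_add_distrib]
    | mul_X p i h =>
      have hA : derivative (C (v i) + X * C (w i)) = C (w i) := by simp
      have hB : ∀ j, MvPolynomial.pderiv j (p * MvPolynomial.X i) =
          MvPolynomial.pderiv j p * MvPolynomial.X i + p * (if j = i then 1 else 0) := by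
        intro j
        rw [Derivation.leibniz, MvPolynomial.pderiv_X]
        simp only [smul_eq_mul, Pi.single_apply, eq_comm]; ring
      rw [map_mul, derivative_mul, h, MvPolynomial.aeval_X, hA]
      simp only [hB, map_add, map_mul, MvPolynomial.aeval_X]
      generalize C (v i) + X * C (w i) = A
      generalize MvPolynomial.aeval (R := ℂ) (fun i => C (v i) + X * C (w i)) = ψ
      rw [Finset.sum_congr rfl (fun j _ => mul_add _ _ _), Finset.sum_add_distrib, Finset.sum_mul]
      congr 1
      · exact Finset.sum_congr rfl fun j _ => by ring
      · rw [Finset.sum_eq_single i]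
        · rw [if_pos rfl, map_one]; ring
        · intro b _ hb; simp [hb]
        · simp
  rw [key, eval_finset_sum, dirD]
  simp [linePoly_eval]

lemma hom_smul {H : MvPolynomial (Fin 3) ℂ} {d : ℕ} (hH : H.IsHomogeneous d) (c : ℂ) (v : Fin 3 → ℂ) :
    MvPolynomial.eval (c • v) H = c ^ d * MvPolynomial.eval v H := by
  rw [MvPolynomial.eval_eq', MvPolynomial.eval_eq', Finset.mul_sum]
  refine Finset.sum_congr rfl fun m hm => ?_
  have := hH (MvPolynomial.mem_support_iff.1 hm)
  rw [Finsupp.weight_apply, Finsupp.sum_fintype _ _ (by simp)] at this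
  simp only [smul_eq_mul, Pi.smul_apply, mul_pow, Finset.prod_mul_distrib, Pi.one_apply, mul_one] at this ⊢
  rw [Finset.prod_pow_eq_pow_sum, this]; ring

lemma dirD_hom {H : MvPolynomial (Fin 3) ℂ} {d : ℕ} (hH : H.IsHomogeneous d) (c : ℂ)
    (v y : Fin 3 → ℂ) : dirD H (c • v) y = c ^ (d - 1) * dirD H v y := by
  rw [dirD, dirD, Finset.mul_sum]
  exact Finset.sum_congr rfl fun i _ => by rw [hom_smul hH.pderiv]; ring

lemma linePoly_natDegree {H : MvPolynomial (Fin 3) ℂ} {d : ℕ} (hH : H.IsHomogeneous d)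
    (v w : Fin 3 → ℂ) : (linePoly H v w).natDegree ≤ d := by
  rw [linePoly, MvPolynomial.aeval_def, MvPolynomial.eval₂_eq']
  refine natDegree_sum_le_of_forall_le _ _ fun m hm => ?_
  have := hH (MvPolynomial.mem_support_iff.1 hm)
  rw [Finsupp.weight_apply, Finsupp.sum_fintype _ _ (by simp)] at this
  simp only [smul_eq_mul, Pi.one_apply, mul_one] at this
  refine (natDegree_C_mul_le _ _).trans ((natDegree_prod_le _ _).trans ?_)
  rw [← this]
  refine Finset.sum_le_sum fun i _ => ?_
  refine natDegree_pow_le.trans ?_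
  have : (C (v i) + X * C (w i)).natDegree ≤ 1 := by compute_degree
  nlinarith

lemma linePoly_reflect {H : MvPolynomial (Fin 3) ℂ} {d : ℕ} (hH : H.IsHomogeneous d)
    (v w : Fin 3 → ℂ) : linePoly H w v = reflect d (linePoly H v w) := by
  have inf : Set.Infinite {s : ℂ | s ≠ 0} := (Set.finite_singleton (0 : ℂ)).infinite_compl
  refine Polynomial.eq_of_infinite_eval_eq _ _ (inf.mono fun s hs => ?_)
  have hs : s ≠ 0 := hs
  letI : Invertible s⁻¹ := invertibleOfNonzero (inv_ne_zero hs)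
  have e := eval₂_reflect_mul_pow (RingHom.id ℂ) s⁻¹ d (linePoly H v w) (linePoly_natDegree hH v w)
  rw [invOf_eq_inv, inv_inv, ← eval, ← eval, linePoly_eval] at e
  show (linePoly H w v).eval s = eval s (reflect d (linePoly H v w))
  have e2 : w + s • v = s • (v + s⁻¹ • w) := by
    rw [smul_add, smul_smul, mul_inv_cancel₀ hs, one_smul, add_comm]
  rw [linePoly_eval, e2, hom_smul hH, ← e, inv_pow]
  have : s ^ d ≠ 0 := pow_ne_zero _ hs
  field_simp

lemma sq_dvd_iff (h : ℂ[X]) (p : ℂ) : (X - C p) ^ 2 ∣ h ↔ h.eval p = 0 ∧ (derivative h).eval p = 0 := by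
  rw [pow_dvd_iff_tc]
  constructor
  · intro H
    have h0 := H 0 (by norm_num); have h1 := H 1 (by norm_num)
    rw [tc, taylor_coeff_zero] at h0; rw [tc, taylor_coeff_one] at h1
    exact ⟨h0, h1⟩
  · rintro ⟨h0, h1⟩ i hi
    interval_cases i
    · rw [tc, taylor_coeff_zero, h0]
    · rw [tc, taylor_coeff_one, h1]

lemma contact_iff (H : MvPolynomial (Fin 3) ℂ) (v w : Fin 3 → ℂ) :
    ContactLE H v w 2 ↔ MvPolynomial.eval v H = 0 ∧ dirD H v w = 0 := by
  have := sq_dvd_iff (linePoly H v w) 0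
  rw [linePoly_eval, linePoly_deriv] at this
  simpa [ContactLE] using this
end
end Part15a

section Part15b
open Polynomial
noncomputable section

lemma InV.mul {m n : ℕ} {φ ψ : ℂ[X][X]} (h1 : InV m φ) (h2 : InV n ψ) : InV (m + n) (φ * ψ) := by
  intro j k hjk
  rw [coeff_mul, finsetSum_coeff]
  refine Finset.sum_eq_zero fun a ha => ?_
  rw [coeff_mul]
  refine Finset.sum_eq_zero fun b hb => ?_
  rw [Finset.HasAntidiagonal.mem_antidiagonal] at ha hb
  rcases lt_or_ge m (a.1 + b.1) with h | h
  · rw [h1 _ _ h, zero_mul]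
  · rw [h2 _ _ (by omega), mul_zero]

lemma slInf_coeff_gt (d : ℕ) (φ : ℂ[X][X]) {j : ℕ} (hj : d < j) : (slInf d φ).coeff j = 0 := by
  simp only [slInf, finsetSum_coeff, coeff_C_mul, coeff_X_pow, mul_ite, mul_one, mul_zero]
  rw [Finset.sum_ite_eq (Finset.range (d+1)) j, if_neg (by simp; omega)]

lemma slInf_mul {m n : ℕ} {φ ψ : ℂ[X][X]} (h1 : InV m φ) (h2 : InV n ψ) :
    slInf (m + n) (φ * ψ) = slInf m φ * slInf n ψ := by
  ext j
  rw [coeff_mul]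
  rcases lt_or_ge (m + n) j with h | h
  · rw [slInf_coeff_gt _ _ h]
    refine (Finset.sum_eq_zero fun a ha => ?_).symm
    rw [Finset.HasAntidiagonal.mem_antidiagonal] at ha
    rcases lt_or_ge m a.1 with h' | h'
    · rw [slInf_coeff_gt _ _ h', zero_mul]
    · rw [slInf_coeff_gt n _ (by omega), mul_zero]
  · rw [slInf_coeff _ _ h, coeff_mul, finsetSum_coeff]
    refine Finset.sum_congr rfl fun a ha => ?_
    rw [Finset.HasAntidiagonal.mem_antidiagonal] at ha
    rcases lt_or_ge m a.1 with h' | h'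
    · rw [slInf_coeff_gt _ _ h', h1.coeff_eq_zero h']; simp
    rcases lt_or_ge n a.2 with h'' | h''
    · rw [slInf_coeff_gt _ _ h'', h2.coeff_eq_zero h'']; simp
    rw [slInf_coeff _ _ h', slInf_coeff _ _ h'', show m + n - j = (m - a.1) + (n - a.2) by omega]
    exact coeff_mul_add_eq_of_natDegree_le (h1.natDegree_coeff _) (h2.natDegree_coeff _)

lemma InV.one : InV 0 1 := by
  intro j k h
  rw [coeff_one]
  split_ifs with hj
  · rw [coeff_one, if_neg (by omega)]
  · simp

lemma InV.pow {m : ℕ} {φ : ℂ[X][X]} (h : InV m φ) (n : ℕ) : InV (m * n) (φ ^ n) := by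
  induction n with
  | zero => simpa using InV.one
  | succ n ih => rw [pow_succ, Nat.mul_succ]; exact ih.mul h

lemma slInf_one : slInf 0 1 = 1 := by simp [slInf]

lemma slInf_pow {m : ℕ} {φ : ℂ[X][X]} (h : InV m φ) (n : ℕ) :
    slInf (m * n) (φ ^ n) = slInf m φ ^ n := by
  induction n with
  | zero => simpa using slInf_one
  | succ n ih => rw [pow_succ, Nat.mul_succ, slInf_mul (h.pow n) h, ih, pow_succ]

lemma InV.sum {d : ℕ} {ι : Type*} (s : Finset ι) {w : ι → ℂ[X][X]} (h : ∀ i ∈ s, InV d (w i)) :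
    InV d (∑ i ∈ s, w i) := by
  intro j k hjk
  rw [finsetSum_coeff, finsetSum_coeff]
  exact Finset.sum_eq_zero fun i hi => h i hi j k hjk

lemma slInf_sum {d : ℕ} {ι : Type*} (s : Finset ι) (w : ι → ℂ[X][X]) :
    slInf d (∑ i ∈ s, w i) = ∑ i ∈ s, slInf d (w i) := by
  ext j
  rw [finsetSum_coeff]
  rcases lt_or_ge d j with h | h
  · simp only [slInf_coeff_gt _ _ h, Finset.sum_const_zero]
  · simp only [slInf_coeff _ _ h, finsetSum_coeff]

def xf (x : Fin 3 → ℂ) (i : Fin 3) : ℂ[X][X] :=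
  C (C ((![1, 0, 0] : Fin 3 → ℂ) i) + X * C ((![0, 1, 0] : Fin 3 → ℂ) i)) + X * C (C (x i))

def ph (F : MvPolynomial (Fin 3) ℂ) (x : Fin 3 → ℂ) : ℂ[X][X] := MvPolynomial.aeval (xf x) F

lemma xf_InV (x i) : InV 1 (xf x i) := by
  intro j k h
  rcases j with _ | _ | j
  · obtain ⟨k, rfl⟩ : ∃ r, k = r + 2 := ⟨k - 2, by omega⟩
    rw [xf, coeff_add, coeff_C_zero, coeff_X_mul_zero, coeff_add, coeff_add, coeff_C_succ,
      coeff_X_mul, coeff_C_succ]; simp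
  · obtain ⟨k, rfl⟩ : ∃ r, k = r + 1 := ⟨k - 1, by omega⟩
    rw [xf, coeff_add, coeff_C_succ, coeff_X_mul, coeff_C_zero, zero_add, coeff_C_succ]
  · rw [xf, coeff_add, coeff_C_succ, coeff_X_mul, coeff_C_succ]; simp

lemma xf_slInf (x i) : slInf 1 (xf x i) = C ((![0, 1, 0] : Fin 3 → ℂ) i) + X * C (x i) := by
  have e0 : ((xf x i).coeff 0).coeff 1 = (![0, 1, 0] : Fin 3 → ℂ) i := by
    rw [xf, coeff_add, coeff_C_zero, coeff_X_mul_zero, add_zero, coeff_add, coeff_C_succ,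
      coeff_X_mul, coeff_C_zero, zero_add]
  have e1 : ((xf x i).coeff 1).coeff 0 = x i := by
    rw [xf, coeff_add, coeff_C_succ, coeff_X_mul, coeff_C_zero, zero_add, coeff_C_zero]
  rw [slInf, Finset.sum_range_succ, Finset.sum_range_succ, Finset.sum_range_zero, zero_add,
    Nat.sub_zero, Nat.sub_self, e0, e1, pow_zero, mul_one, pow_one]
  exact congrArg₂ _ rfl (mul_comm _ _)

lemma xf_map (x i) (a : ℂ) : (xf x i).map (evalRingHom a) = C ((![1, a, 0] : Fin 3 → ℂ) i) + X * C (x i) := by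
  rw [xf, Polynomial.map_add, Polynomial.map_mul, map_X, map_C, map_C, coe_evalRingHom, eval_add,
    eval_mul, eval_C, eval_C, eval_C, eval_X]
  refine congrArg₂ _ (congrArg _ ?_) rfl
  fin_cases i <;> simp

lemma ph_eq {F : MvPolynomial (Fin 3) ℂ} {d : ℕ} (hF : F.IsHomogeneous d) (x : Fin 3 → ℂ) :
    ph F x = ∑ m ∈ Finset.univ.finsuppAntidiag d, C (C (F.coeff m)) * ∏ i, xf x i ^ m i := by
  rw [ph, MvPolynomial.aeval_def, MvPolynomial.eval₂_eq']
  refine Finset.sum_subset ?_ ?_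
  · intro m hm
    have := hF (MvPolynomial.mem_support_iff.1 hm)
    rw [Finsupp.weight_apply, Finsupp.sum_fintype _ _ (by simp)] at this
    simp only [smul_eq_mul, Pi.one_apply, mul_one] at this
    rw [Finset.mem_finsuppAntidiag]
    exact ⟨this, Finset.subset_univ _⟩
  · intro m _ hm
    rw [MvPolynomial.notMem_support_iff.1 hm]; simp

lemma CCmul_InV {d : ℕ} {φ : ℂ[X][X]} (c : ℂ) (h : InV d φ) : InV d (C (C c) * φ) := by
  intro j k hjk; simp [h j k hjk]
lemma CCmul_slInf {d : ℕ} {φ : ℂ[X][X]} (c : ℂ) : slInf d (C (C c) * φ) = C c * slInf d φ := by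
  simp [slInf, Finset.mul_sum, mul_assoc]

lemma term_InV (x : Fin 3 → ℂ) {d : ℕ} {m : Fin 3 →₀ ℕ} (hm : m ∈ Finset.univ.finsuppAntidiag d) :
    InV d (∏ i, xf x i ^ m i) ∧
    slInf d (∏ i, xf x i ^ m i) = ∏ i, (C ((![0, 1, 0] : Fin 3 → ℂ) i) + X * C (x i)) ^ m i := by
  rw [Finset.mem_finsuppAntidiag] at hm
  have h : 1 * m 0 + 1 * m 1 + 1 * m 2 = d := by
    have := hm.1; rw [Fin.sum_univ_three] at this; omega
  rw [← h]
  simp only [Fin.prod_univ_three]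
  have i0 := (xf_InV x 0).pow (m 0)
  have i1 := (xf_InV x 1).pow (m 1)
  have i2 := (xf_InV x 2).pow (m 2)
  refine ⟨(i0.mul i1).mul i2, ?_⟩
  rw [slInf_mul (i0.mul i1) i2, slInf_mul i0 i1, slInf_pow (xf_InV x 0), slInf_pow (xf_InV x 1),
    slInf_pow (xf_InV x 2), xf_slInf, xf_slInf, xf_slInf]

lemma ph_InV {F : MvPolynomial (Fin 3) ℂ} {d : ℕ} (hF : F.IsHomogeneous d) (x : Fin 3 → ℂ) :
    InV d (ph F x) := by
  rw [ph_eq hF]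
  exact InV.sum _ fun m hm => CCmul_InV _ (term_InV x hm).1

lemma linePoly_eq {F : MvPolynomial (Fin 3) ℂ} {d : ℕ} (hF : F.IsHomogeneous d) (v w : Fin 3 → ℂ) :
    linePoly F v w = ∑ m ∈ Finset.univ.finsuppAntidiag d, C (F.coeff m) *
      ∏ i, (C (v i) + X * C (w i)) ^ m i := by
  rw [linePoly, MvPolynomial.aeval_def, MvPolynomial.eval₂_eq']
  refine Finset.sum_subset ?_ ?_
  · intro m hm
    have := hF (MvPolynomial.mem_support_iff.1 hm)
    rw [Finsupp.weight_apply, Finsupp.sum_fintype _ _ (by simp)] at this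
    simp only [smul_eq_mul, Pi.one_apply, mul_one] at this
    rw [Finset.mem_finsuppAntidiag]
    exact ⟨this, Finset.subset_univ _⟩
  · intro m _ hm
    rw [MvPolynomial.notMem_support_iff.1 hm]; simp

lemma ph_slInf {F : MvPolynomial (Fin 3) ℂ} {d : ℕ} (hF : F.IsHomogeneous d) (x : Fin 3 → ℂ) :
    slInf d (ph F x) = linePoly F ![0, 1, 0] x := by
  rw [ph_eq hF, slInf_sum, linePoly_eq hF]
  exact Finset.sum_congr rfl fun m hm => by rw [CCmul_slInf, (term_InV x hm).2]

lemma ph_sl {F : MvPolynomial (Fin 3) ℂ} {d : ℕ} (hF : F.IsHomogeneous d) (x : Fin 3 → ℂ) (a : ℂ) :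
    sl a (ph F x) = linePoly F ![1, a, 0] x := by
  rw [ph_eq hF, linePoly_eq hF, sl, Polynomial.map_sum]
  refine Finset.sum_congr rfl fun m _ => ?_
  rw [Polynomial.map_mul, Polynomial.map_prod]
  refine congrArg₂ _ ?_ ?_
  · rw [map_C, coe_evalRingHom, eval_C]
  · refine Finset.prod_congr rfl fun i _ => ?_
    rw [Polynomial.map_pow, xf_map]

lemma ph_poly (d : ℕ) {σ : Type*} {cF : (σ → ℂ) → (Fin 3 →₀ ℕ) → ℂ} {x : (σ → ℂ) → Fin 3 → ℂ}
    (h1 : ∀ m, PolyFn (fun z => cF z m)) (h2 : ∀ i, PolyFn (fun z => x z i)) :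
    PolyFnPP (fun z => ∑ m ∈ Finset.univ.finsuppAntidiag d, C (C (cF z m)) * ∏ i, xf (x z) i ^ m i) := by
  refine PolyFnPP.sum _ fun m _ => ?_
  refine (PolyFnPP.CC (PolyFnP.CC (h1 m))).mul (PolyFnPP.prod _ fun i _ => PolyFnPP.pow ?_ _)
  exact (PolyFnPP.const _).add ((PolyFnPP.const _).mul (PolyFnPP.CC (PolyFnP.CC (h2 i))))

/-- The form with prescribed coefficients. -/
def mkF (d : ℕ) (v : JJ d → ℂ) : MvPolynomial (Fin 3) ℂ :=
  ∑ i : JJ d, MvPolynomial.monomial (Finsupp.single 0 (d - i.1 - i.2) + Finsupp.single 1 (i.2 : ℕ) +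
    Finsupp.single 2 (i.1 : ℕ)) (v i)

lemma mkF_hom (d : ℕ) (v : JJ d → ℂ) : (mkF d v).IsHomogeneous d := by
  refine MvPolynomial.IsHomogeneous.sum _ _ _ fun i _ => ?_
  refine MvPolynomial.isHomogeneous_monomial _ ?_
  have := i.1.2; have := i.2.2
  rw [map_add, map_add, Finsupp.degree_single, Finsupp.degree_single, Finsupp.degree_single]
  omega

lemma mkF_cf (d : ℕ) (v : JJ d → ℂ) : cf d (ph (mkF d v) ![0, 0, 1]) = v := by
  have e : ph (mkF d v) ![0, 0, 1] = ∑ i : JJ d, C (C (v i) * X ^ (i.2 : ℕ)) * X ^ (i.1 : ℕ) := by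
    rw [ph, mkF, map_sum]
    refine Finset.sum_congr rfl fun i _ => ?_
    rw [MvPolynomial.aeval_monomial, Finsupp.prod_fintype _ _ (by simp), Fin.prod_univ_three]
    simp [xf, mul_assoc]
  funext ⟨j, k⟩
  simp only [e, cf, finsetSum_coeff, coeff_C_mul, coeff_X_pow]
  rw [Finset.sum_eq_single ⟨j, k⟩]
  · simp
  · rintro ⟨j', k'⟩ _ hne
    by_cases hj : (j : ℕ) = j'
    · obtain rfl := Fin.ext hj
      have : (k : ℕ) ≠ k' := fun h => hne (by rw [Fin.ext h])
      simp [this, coeff_X_pow]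
    · simp [hj]
  · simp
end
end Part15b

section Part15c
open Polynomial
noncomputable section

section core
variable {H : MvPolynomial (Fin 3) ℂ} {d : ℕ} (hH : H.IsHomogeneous d) (hd : 3 ≤ d)
  {u x v : Fin 3 → ℂ}

lemma pt_fin (hH : H.IsHomogeneous d) {α β : ℂ} (hv : v = α • u + β • x) (hα : α ≠ 0)
    (h0 : MvPolynomial.eval v H = 0) (h1 : dirD H v x = 0) :
    (X - C (β / α)) ^ 2 ∣ linePoly H u x := by
  have e : v = α • (u + (β / α) • x) := by
    rw [hv, smul_add, smul_smul, mul_div_cancel₀ _ hα]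
  rw [e, hom_smul hH] at h0
  rw [e, dirD_hom hH] at h1
  rw [sq_dvd_iff, linePoly_eval, linePoly_deriv]
  exact ⟨(mul_eq_zero.1 h0).resolve_left (pow_ne_zero _ hα),
    (mul_eq_zero.1 h1).resolve_left (pow_ne_zero _ hα)⟩

lemma pt_inf (hH : H.IsHomogeneous d) (hd : 3 ≤ d) {β : ℂ} (hv : v = β • x) (hβ : β ≠ 0)
    (h0 : MvPolynomial.eval v H = 0) (h1 : dirD H v u = 0) :
    (linePoly H u x).coeff d = 0 ∧ (linePoly H u x).coeff (d - 1) = 0 := by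
  rw [hv, hom_smul hH] at h0
  rw [hv, dirD_hom hH] at h1
  have hc : ContactLE H x u 2 := (contact_iff _ _ _).2
    ⟨(mul_eq_zero.1 h0).resolve_left (pow_ne_zero _ hβ),
    (mul_eq_zero.1 h1).resolve_left (pow_ne_zero _ hβ)⟩
  rw [ContactLE, X_pow_dvd_iff, linePoly_reflect hH] at hc
  have c0 := hc 0 (by norm_num)
  have c1 := hc 1 (by norm_num)
  rw [coeff_reflect, revAt_le (by omega)] at c0 c1
  exact ⟨by simpa using c0, c1⟩

lemma core_fwd (hH : H.IsHomogeneous d) (hd : 3 ≤ d) {v w : Fin 3 → ℂ}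
    (hv : v ∈ Submodule.span ℂ {u, x}) (hw : w ∈ Submodule.span ℂ {u, x})
    (li : LinearIndependent ℂ ![v, w]) (h1 : ContactLE H v w 2) (h2 : ContactLE H w v 2) :
    (∃ p q, p ≠ q ∧ (X - C p) ^ 2 * (X - C q) ^ 2 ∣ linePoly H u x) ∨
    (∃ p, (X - C p) ^ 2 ∣ linePoly H u x ∧ (linePoly H u x).coeff d = 0 ∧
      (linePoly H u x).coeff (d - 1) = 0) := by
  obtain ⟨α, β, ev⟩ := Submodule.mem_span_pair.1 hv
  obtain ⟨γ, δ, ew⟩ := Submodule.mem_span_pair.1 hw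
  rw [LinearIndependent.pair_iff] at li
  rw [contact_iff] at h1 h2
  have hD : α * δ - β * γ ≠ 0 := by
    intro h0
    have k1 := li δ (-β) (by
      rw [← ev, ← ew]
      have : δ • (α • u + β • x) + -β • (γ • u + δ • x) = (α * δ - β * γ) • u := by module
      rw [this, h0, zero_smul])
    have k2 := li γ (-α) (by
      rw [← ev, ← ew]
      have : γ • (α • u + β • x) + -α • (γ • u + δ • x) = (- (α * δ - β * γ)) • x := by module
      rw [this, h0, neg_zero, zero_smul])
    have hα : α = 0 := by simpa using k2.2
    have hβ : β = 0 := by simpa using k1.2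
    have := li 1 0 (by rw [← ev, hα, hβ]; simp)
    simpa using this.1
  have hx : (α * δ - β * γ) • x = α • w + (-γ) • v := by rw [← ev, ← ew]; module
  have hu : (α * δ - β * γ) • u = δ • v + (-β) • w := by rw [← ev, ← ew]; module
  have T : ∀ z, dirD H z v = 0 → dirD H z w = 0 → dirD H z x = 0 ∧ dirD H z u = 0 := by
    intro z z1 z2
    constructor
    · have := congrArg (dirD H z) hx
      rw [dirD_add, dirD_smul, dirD_smul, dirD_smul, z1, z2] at this
      simpa [hD] using this
    · have := congrArg (dirD H z) hu
      rw [dirD_add, dirD_smul, dirD_smul, dirD_smul, z1, z2] at this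
      simpa [hD] using this
  have Tv := T v (by rw [dirD_self hH, h1.1, mul_zero]) h1.2
  have Tw := T w h2.2 (by rw [dirD_self hH, h2.1, mul_zero])
  by_cases hα : α = 0
  · right
    have hβ : β ≠ 0 := by rintro rfl; simp [hα] at hD
    have hγ : γ ≠ 0 := by rintro rfl; simp [hα] at hD
    exact ⟨_, pt_fin hH ew.symm hγ h2.1 Tw.1,
      pt_inf hH hd (by rw [← ev, hα]; simp) hβ h1.1 Tv.2⟩
  by_cases hγ : γ = 0
  · right
    have hδ : δ ≠ 0 := by rintro rfl; simp [hγ] at hD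
    exact ⟨_, pt_fin hH ev.symm hα h1.1 Tv.1,
      pt_inf hH hd (by rw [← ew, hγ]; simp) hδ h2.1 Tw.2⟩
  left
  have hpq : β / α ≠ δ / γ := by
    intro h; rw [div_eq_div_iff hα hγ] at h
    apply hD; rw [h]; ring
  exact ⟨_, _, hpq, (cop hpq 2 2).mul_dvd (pt_fin hH ev.symm hα h1.1 Tv.1)
    (pt_fin hH ew.symm hγ h2.1 Tw.1)⟩

lemma core_bwd (hH : H.IsHomogeneous d) {p q : ℂ} (h : (X - C p) ^ 2 ∣ linePoly H u x) :
    ContactLE H (u + p • x) (u + q • x) 2 := by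
  rw [sq_dvd_iff, linePoly_eval, linePoly_deriv] at h
  rw [contact_iff]
  refine ⟨h.1, ?_⟩
  rw [show u + q • x = (u + p • x) + (q - p) • x by module, dirD_add, dirD_smul, dirD_self hH, h.1, h.2]
  simp
end core

lemma degree_lt_of_top {h : ℂ[X]} {d : ℕ} (hd : 3 ≤ d) (h0 : h.natDegree ≤ d) (h1 : h.coeff d = 0)
    (h2 : h.coeff (d - 1) = 0) : h.degree < (d - 1 : ℕ) := by
  rw [degree_lt_iff_coeff_zero]
  intro m hm
  rcases (show m = d - 1 ∨ m = d ∨ d < m by omega) with rfl | rfl | h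
  · exact h2
  · exact h1
  · exact coeff_eq_zero_of_natDegree_lt (h0.trans_lt h)

lemma pencil_cases {h f g : ℂ[X]} {c0 c1 : ℂ} (hc : ¬ (c0 = 0 ∧ c1 = 0)) (e : h = C c0 * f + C c1 * g) :
    (∃ l s : ℂ, s ≠ 0 ∧ f - C l * g = C s * h) ∨ (∃ s : ℂ, s ≠ 0 ∧ g = C s * h) := by
  by_cases h0 : c0 = 0
  · right
    have h1 : c1 ≠ 0 := fun h => hc ⟨h0, h⟩
    refine ⟨c1⁻¹, inv_ne_zero h1, ?_⟩
    rw [e, h0, C_0, zero_mul, zero_add, ← mul_assoc, ← C_mul, inv_mul_cancel₀ h1, C_1, one_mul]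
  · left
    refine ⟨-c1 / c0, c0⁻¹, inv_ne_zero h0, ?_⟩
    rw [e, mul_add, ← mul_assoc, ← mul_assoc, ← C_mul, ← C_mul, inv_mul_cancel₀ h0, C_1, one_mul,
      neg_div, C_neg, neg_mul, sub_neg_eq_add, div_eq_inv_mul]

lemma natDegree_pen {h f : ℂ[X]} {s : ℂ} {d : ℕ} (e : f = C s * h) (h0 : h.degree < (d : ℕ)) :
    f.degree < (d : ℕ) := by rw [e]; exact (degree_C_mul_le' _ _).trans_lt h0

lemma mov_node {d : ℕ} (hd : 3 ≤ d) {f g h : ℂ[X]} (M : Mov d f g) {c0 c1 : ℂ}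
    (hc : ¬ (c0 = 0 ∧ c1 = 0)) (e : h = C c0 * f + C c1 * g) (hdeg : h.natDegree ≤ d)
    (H : (∃ p q, p ≠ q ∧ (X - C p) ^ 2 * (X - C q) ^ 2 ∣ h) ∨
    (∃ p, (X - C p) ^ 2 ∣ h ∧ h.coeff d = 0 ∧ h.coeff (d - 1) = 0)) : IsNode f g := by
  rcases pencil_cases hc e with ⟨l, s, hs, el⟩ | ⟨s, hs, el⟩
  · rcases H with ⟨p, q, hpq, hdv⟩ | ⟨p, hdv, t1, t2⟩
    · exact ⟨l, p, q, hpq, by rw [el]; exact hdv.mul_left _⟩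
    · exfalso
      refine M.L22 (mkL' (N := d - 1) M.dg l ![p] ?_ (natDegree_pen el (degree_lt_of_top hd hdeg t1 t2)) ?_)
      · rw [el]; simpa [rootProd] using hdv.mul_left _
      · simp; omega
  · exfalso
    rcases H with ⟨p, q, hpq, hdv⟩ | ⟨p, hdv, t1, t2⟩
    · refine M.G22 (mkG M.df M.dg ![p, q] ?_ ?_)
      · rw [rp22, el]; exact hdv.mul_left _
      · simp [Fin.sum_univ_two]
    · apply M.gd; rw [el, coeff_C_mul, t1, mul_zero]

lemma inf_no {d : ℕ} (hd : 3 ≤ d) {f g h : ℂ[X]} (M : GInf d f g) {c0 c1 : ℂ}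
    (hc : ¬ (c0 = 0 ∧ c1 = 0)) (e : h = C c0 * f + C c1 * g) (hdeg : h.natDegree ≤ d)
    (H : (∃ p q, p ≠ q ∧ (X - C p) ^ 2 * (X - C q) ^ 2 ∣ h) ∨
    (∃ p, (X - C p) ^ 2 ∣ h ∧ h.coeff d = 0 ∧ h.coeff (d - 1) = 0)) : False := by
  rcases pencil_cases hc e with ⟨l, s, hs, el⟩ | ⟨s, hs, el⟩
  · rcases H with ⟨p, q, hpq, hdv⟩ | ⟨p, hdv, t1, t2⟩
    · refine M.L22 (mkL M.df M.dg l ![p, q] ?_ ?_)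
      · rw [rp22, el]; exact hdv.mul_left _
      · simp [Fin.sum_univ_two]
    · refine M.L02 (mkL' (N := d - 1) M.dg l ![] ?_ (natDegree_pen el (degree_lt_of_top hd hdeg t1 t2)) ?_)
      · simp [rootProd]
      · simp
  · rcases H with ⟨p, q, hpq, hdv⟩ | ⟨p, hdv, t1, t2⟩
    · refine M.G22 (mkG M.df M.dg ![p, q] ?_ ?_)
      · rw [rp22, el]; exact hdv.mul_left _
      · simp [Fin.sum_univ_two]
    · apply M.gd; rw [el, coeff_C_mul, t1, mul_zero]

lemma li_pair {x : Fin 3 → ℂ} (hx : x 2 ≠ 0) {u : Fin 3 → ℂ} (hu : u 2 = 0) (hu0 : u ≠ 0) :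
    LinearIndependent ℂ ![u, x] := by
  rw [LinearIndependent.pair_iff]
  intro s t h
  have h2 := congrFun h 2
  simp [hu, hx] at h2
  subst h2
  simp [hu0] at h
  exact ⟨h, rfl⟩

lemma finrank_pair {u x : Fin 3 → ℂ} (h : LinearIndependent ℂ ![u, x]) :
    Module.finrank ℂ (Submodule.span ℂ {u, x}) = 2 := by
  have := finrank_span_eq_card h
  rw [Matrix.range_cons, Matrix.range_cons, Matrix.range_empty, Set.union_empty, Set.singleton_union] at this
  simpa using this

lemma line_cases {x : Fin 3 → ℂ} (hx : x 2 ≠ 0) {W : Submodule ℂ (Fin 3 → ℂ)} (hxW : x ∈ W)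
    (hW : Module.finrank ℂ W = 2) :
    (∃ a : ℂ, W = Submodule.span ℂ {![1, a, 0], x}) ∨ W = Submodule.span ℂ {![0, 1, 0], x} := by
  have key : ∀ u ∈ W, u 2 = 0 → u ≠ 0 → W = Submodule.span ℂ {u, x} := by
    intro u hu h2 h0
    symm
    refine Submodule.eq_of_le_of_finrank_eq ?_ ?_
    · rw [Submodule.span_le]; rintro z (rfl | rfl) <;> assumption
    · rw [finrank_pair (li_pair hx h2 h0), hW]
  obtain ⟨y, hy, hy'⟩ : ∃ y ∈ W, y ∉ Submodule.span ℂ {x} := by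
    by_contra! hcon
    have := Submodule.finrank_mono (show W ≤ Submodule.span ℂ {x} from hcon)
    have := finrank_span_le_card (R := ℂ) ({x} : Set (Fin 3 → ℂ))
    rw [Set.toFinset_singleton, Finset.card_singleton] at this
    omega
  set z := y - (y 2 / x 2) • x with hz
  have hzW : z ∈ W := W.sub_mem hy (W.smul_mem _ hxW)
  have hz2 : z 2 = 0 := by simp [hz, hx]
  have hz0 : z ≠ 0 := fun h => hy' (by
    rw [Submodule.mem_span_singleton]; exact ⟨_, (sub_eq_zero.1 h).symm⟩)
  by_cases h0 : z 0 = 0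
  · right
    have h1 : z 1 ≠ 0 := by
      intro h1; apply hz0; funext i; fin_cases i <;> simp [h0, h1, hz2]
    refine key _ ?_ (by simp) ?_
    · have : (![0, 1, 0] : Fin 3 → ℂ) = (z 1)⁻¹ • z := by
        funext i; fin_cases i <;> simp [h0, h1, hz2]
      rw [this]; exact W.smul_mem _ hzW
    · intro h; simpa using congrFun h 1
  · left
    refine ⟨z 1 / z 0, key _ ?_ (by simp) ?_⟩
    · have : (![1, z 1 / z 0, 0] : Fin 3 → ℂ) = (z 0)⁻¹ • z := by
        funext i; fin_cases i <;> simp [h0, hz2, div_eq_inv_mul]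
      rw [this]; exact W.smul_mem _ hzW
    · intro h; simpa using congrFun h 0

lemma line_inj {x : Fin 3 → ℂ} (hx : x 2 ≠ 0) :
    Function.Injective (fun a : ℂ => Submodule.span ℂ {![1, a, 0], x}) := by
  intro a b h
  have h1 : (![1, a, 0] : Fin 3 → ℂ) ∈ Submodule.span ℂ {![1, b, 0], x} := by
    have h' : Submodule.span ℂ {![1, a, 0], x} = Submodule.span ℂ {![1, b, 0], x} := h
    rw [← h']; exact Submodule.subset_span (by simp)
  obtain ⟨s, t, e⟩ := Submodule.mem_span_pair.1 h1
  have e2 := congrFun e 2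
  simp [hx] at e2
  subst e2
  have e0 := congrFun e 0
  have e1 := congrFun e 1
  simp at e0 e1
  rw [← e1, e0, one_mul]

lemma member_line (F G : MvPolynomial (Fin 3) ℂ) (c) (u x : Fin 3 → ℂ) :
    linePoly (pencilMember F G c) u x = C (c.rep 0) * linePoly F u x + C (c.rep 1) * linePoly G u x := by
  rw [pencilMember, linePoly_add, linePoly_smul, linePoly_smul]

lemma member_hom {F G : MvPolynomial (Fin 3) ℂ} {d : ℕ} (hF : F.IsHomogeneous d)
    (hG : G.IsHomogeneous d) (c) : (pencilMember F G c).IsHomogeneous d := by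
  rw [pencilMember, MvPolynomial.smul_eq_C_mul, MvPolynomial.smul_eq_C_mul]
  exact (hF.C_mul _).add (hG.C_mul _)

lemma rep_ne (c : Projectivization ℂ (Fin 2 → ℂ)) : ¬ (c.rep 0 = 0 ∧ c.rep 1 = 0) := by
  rintro ⟨h0, h1⟩
  apply c.rep_nonzero
  funext i; fin_cases i <;> simp [h0, h1]

theorem link {F G : MvPolynomial (Fin 3) ℂ} {x : Fin 3 → ℂ} {d : ℕ} (hd : 3 ≤ d)
    (hF : F.IsHomogeneous d) (hG : G.IsHomogeneous d) (hx : x 2 ≠ 0)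
    (good : Good d (ph F x) (ph G x)) :
    bitangentLinesThrough F G x = Set.image (fun a : ℂ => Submodule.span ℂ {![1, a, 0], x})
      {a | IsNode (sl a (ph F x)) (sl a (ph G x))} := by
  ext W
  constructor
  · rintro ⟨hxW, hW, c, v, w, hv, hw, li, h1, h2⟩
    have hH := member_hom hF hG c
    rcases line_cases hx hxW hW with ⟨a, rfl⟩ | rfl
    · refine ⟨a, ?_, rfl⟩
      have M := good.mov a
      show IsNode _ _
      rw [ph_sl hF, ph_sl hG] at M ⊢
      exact mov_node hd M (rep_ne c) (member_line F G c _ _) (linePoly_natDegree hH _ _)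
        (core_fwd hH hd hv hw li h1 h2)
    · exfalso
      have M := good.inf
      rw [ph_slInf hF, ph_slInf hG] at M
      exact inf_no hd M (rep_ne c) (member_line F G c _ _) (linePoly_natDegree hH _ _)
        (core_fwd hH hd hv hw li h1 h2)
  · rintro ⟨a, ⟨l, p, q, hpq, hdv⟩, rfl⟩
    rw [ph_sl hF, ph_sl hG] at hdv
    have hu0 : (![1, a, 0] : Fin 3 → ℂ) ≠ 0 := by intro h; simpa using congrFun h 0
    have li := li_pair hx (u := ![1, a, 0]) (by simp) hu0
    refine ⟨Submodule.subset_span (by simp), finrank_pair li, ?_⟩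
    have hne : (![1, -l] : Fin 2 → ℂ) ≠ 0 := by intro h; simpa using congrFun h 0
    obtain ⟨s, hs⟩ := Projectivization.exists_smul_eq_mk_rep ℂ _ hne
    generalize hc : Projectivization.mk ℂ (![1, -l] : Fin 2 → ℂ) hne = c at hs
    have hH := member_hom hF hG c
    have e : linePoly (pencilMember F G c) ![1, a, 0] x =
        C (s : ℂ) * (linePoly F ![1, a, 0] x - C l * linePoly G ![1, a, 0] x) := by
      rw [member_line, ← hs]
      simp [Units.smul_def]; ring
    beta_reduce
    generalize (![1, a, 0] : Fin 3 → ℂ) = u at *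
    have hu : u ∈ Submodule.span ℂ {u, x} := Submodule.subset_span (by simp)
    have hx' : x ∈ Submodule.span ℂ {u, x} := Submodule.subset_span (by simp)
    have hdv' := hdv.mul_left (C (s : ℂ))
    rw [← e] at hdv'
    refine ⟨c, u + p • x, u + q • x, Submodule.add_mem _ hu (Submodule.smul_mem _ _ hx'),
      Submodule.add_mem _ hu (Submodule.smul_mem _ _ hx'), ?_,
      core_bwd hH ((dvd_mul_right _ _).trans hdv'), core_bwd hH ((dvd_mul_left _ _).trans hdv')⟩
    rw [LinearIndependent.pair_iff] at li ⊢
    intro y z h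
    have := li (y + z) (y * p + z * q) (by rw [← h]; module)
    have k1 : z = -y := by linear_combination this.1
    have k2 : y * (p - q) = 0 := by have := this.2; rw [k1] at this; linear_combination this
    have : y = 0 := (mul_eq_zero.1 k2).resolve_right (sub_ne_zero.2 hpq)
    exact ⟨this, by rw [k1, this, neg_zero]⟩

/-- Linear independence from goodness. -/
lemma good_li {F G : MvPolynomial (Fin 3) ℂ} {x : Fin 3 → ℂ} {d : ℕ}
    (hF : F.IsHomogeneous d) (hG : G.IsHomogeneous d)
    (good : Good d (ph F x) (ph G x)) : LinearIndependent ℂ ![F, G] := by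
  rw [LinearIndependent.pair_iff]
  intro s t h
  have M := good.mov 0
  rw [ph_sl hF, ph_sl hG] at M
  have e := congrArg (fun K => linePoly K ![1, 0, 0] x) h
  simp only [linePoly_add, linePoly_smul] at e
  have e0 : linePoly (0 : MvPolynomial (Fin 3) ℂ) ![1, 0, 0] x = 0 := by rw [linePoly, map_zero]
  rw [e0] at e
  by_contra hc
  rcases pencil_cases hc e.symm with ⟨l, r, hr, el⟩ | ⟨r, hr, el⟩
  · refine M.L03 (mkL' (N := d - 2) M.dg l ![] (by simp [rootProd]) ?_ (by simp))
    rw [el, mul_zero, degree_zero]; exact WithBot.bot_lt_coe _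
  · apply M.gd; rw [el, mul_zero, coeff_zero]

theorem final (d : ℕ) (hd : 3 ≤ d) :
    ∃ Q : MvPolynomial (((Fin 3 →₀ ℕ) ⊕ (Fin 3 →₀ ℕ)) ⊕ Fin 3) ℂ,
      (∃ (F G : MvPolynomial (Fin 3) ℂ) (x : Fin 3 → ℂ),
          F.IsHomogeneous d ∧ G.IsHomogeneous d ∧ LinearIndependent ℂ ![F, G] ∧ x ≠ 0 ∧
          MvPolynomial.eval (Sum.elim (coeffs2 F G) x) Q ≠ 0) ∧
      ∀ (F G : MvPolynomial (Fin 3) ℂ) (x : Fin 3 → ℂ),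
        F.IsHomogeneous d → G.IsHomogeneous d → LinearIndependent ℂ ![F, G] → x ≠ 0 →
        MvPolynomial.eval (Sum.elim (coeffs2 F G) x) Q ≠ 0 →
          (bitangentLinesThrough F G x).Finite ∧
            ((bitangentLinesThrough F G x).ncard : ℤ) =
              2 * (d : ℤ) * ((d : ℤ) - 2) * ((d : ℤ) - 3) := by
  obtain ⟨Q0, hQ0, HQ⟩ := gen_good hd
  let Z := (((Fin 3 →₀ ℕ) ⊕ (Fin 3 →₀ ℕ)) ⊕ Fin 3) → ℂ
  let pF : Z → ℂ[X][X] := fun z => ∑ m ∈ Finset.univ.finsuppAntidiag d,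
    C (C (z (.inl (.inl m)))) * ∏ i, xf (fun i => z (.inr i)) i ^ m i
  let pG : Z → ℂ[X][X] := fun z => ∑ m ∈ Finset.univ.finsuppAntidiag d,
    C (C (z (.inl (.inr m)))) * ∏ i, xf (fun i => z (.inr i)) i ^ m i
  have hpF : PolyFnPP pF := ph_poly d (fun m => PolyFn.proj _) (fun i => PolyFn.proj _)
  have hpG : PolyFnPP pG := ph_poly d (fun m => PolyFn.proj _) (fun i => PolyFn.proj _)
  have hP : PolyFn (fun z : Z => MvPolynomial.eval (Sum.elim (cf d (pF z)) (cf d (pG z))) Q0) := by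
    refine PolyFn.comp Q0 ?_
    rintro (i | i)
    · exact hpF _ _
    · exact hpG _ _
  obtain ⟨Q1, hQ1⟩ := hP
  have ev : ∀ (F G : MvPolynomial (Fin 3) ℂ) (x : Fin 3 → ℂ), F.IsHomogeneous d → G.IsHomogeneous d →
      MvPolynomial.eval (Sum.elim (coeffs2 F G) x) Q1 =
        MvPolynomial.eval (Sum.elim (cf d (ph F x)) (cf d (ph G x))) Q0 := by
    intro F G x hF hG
    rw [hQ1, ph_eq hF, ph_eq hG]
    rfl
  refine ⟨Q1 * MvPolynomial.X (.inr 2), ?_, ?_⟩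
  · obtain ⟨y, hy⟩ : ∃ y, MvPolynomial.eval y Q0 ≠ 0 := by
      by_contra! hcon
      exact hQ0 (MvPolynomial.funext fun y => by rw [hcon, map_zero])
    have hF := mkF_hom d (fun i => y (.inl i))
    have hG := mkF_hom d (fun i => y (.inr i))
    have e := ev _ _ ![0, 0, 1] hF hG
    have ne : MvPolynomial.eval (Sum.elim (cf d (ph (mkF d (fun i => y (.inl i))) ![0, 0, 1]))
        (cf d (ph (mkF d (fun i => y (.inr i))) ![0, 0, 1]))) Q0 ≠ 0 := by
      rw [mkF_cf, mkF_cf]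
      have : Sum.elim (fun i => y (.inl i)) (fun i => y (.inr i)) = y := by
        funext i; rcases i with i | i <;> rfl
      rw [this]; exact hy
    refine ⟨_, _, ![0, 0, 1], hF, hG, good_li hF hG (HQ _ _ (ph_InV hF _) (ph_InV hG _) ne), ?_, ?_⟩
    · intro h; simpa using congrFun h 2
    · rw [map_mul, e]
      refine mul_ne_zero ne ?_
      simp
  · intro F G x hF hG _ _ h
    rw [map_mul, ev F G x hF hG] at h
    have hx : x 2 ≠ 0 := by simpa using right_ne_zero_of_mul h
    have good := HQ _ _ (ph_InV hF x) (ph_InV hG x) (left_ne_zero_of_mul h)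
    have := VR.count hd (ph_InV hF x) (ph_InV hG x) good
    rw [link hd hF hG hx good, Set.ncard_image_of_injective _ (line_inj hx)]
    exact ⟨this.1.image _, this.2⟩
end
end Part15c

/-- For a general pencil of degree-`d` plane curves and a general point `[x] ∈ ℙ²`, the
number of lines through `[x]` that are bitangent to some member of the pencil is
`2d(d−2)(d−3)`. -/
theorem bitangent_lines_through_general_point_count (d : ℕ) (hd : 3 ≤ d) :
    ∃ Q : MvPolynomial (((Fin 3 →₀ ℕ) ⊕ (Fin 3 →₀ ℕ)) ⊕ Fin 3) ℂ,
      (∃ (F G : MvPolynomial (Fin 3) ℂ) (x : Fin 3 → ℂ),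
          F.IsHomogeneous d ∧ G.IsHomogeneous d ∧ LinearIndependent ℂ ![F, G] ∧ x ≠ 0 ∧
          MvPolynomial.eval (Sum.elim (coeffs2 F G) x) Q ≠ 0) ∧
      ∀ (F G : MvPolynomial (Fin 3) ℂ) (x : Fin 3 → ℂ),
        F.IsHomogeneous d → G.IsHomogeneous d → LinearIndependent ℂ ![F, G] → x ≠ 0 →
        MvPolynomial.eval (Sum.elim (coeffs2 F G) x) Q ≠ 0 →
          (bitangentLinesThrough F G x).Finite ∧
            ((bitangentLinesThrough F G x).ncard : ℤ) =
              2 * (d : ℤ) * ((d : ℤ) - 2) * ((d : ℤ) - 3) := by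
  exact final d hd
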